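/- arXiv:2110.03033 — 4 statements merged into one kernel-verified Lean document; each statement's English description precedes it below -/
import Mathlib

section
/- Let P ⊆ ℝ^d be compact and convex, and assume that either P is strictly convex and nondegenerate, or P is a convex d-polytope, or d = 2 and P has nonempty interior. If A ⊆ ℝ^d contains a perfect set, then A^∞_P ≠ ∅ (equivalently, A^α_P ≠ ∅ for every ordinal α). -/
open Pointwise Filter Topology Set

open RealInnerProductSpace in
/-- A convex `d`-polytope in `ℝ^d`: a compact set with nonempty interior which is the
intersection of finitely many closed half-spaces. -/
def IsPolytope (d : ℕ) (P : Set (EuclideanSpace ℝ (Fin d))) : Prop :=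
  IsCompact P ∧ (interior P).Nonempty ∧
    ∃ (k : ℕ) (a : Fin k → EuclideanSpace ℝ (Fin d)) (b : Fin k → ℝ),
      (∀ i, a i ≠ 0) ∧ P = ⋂ i, {z | ⟪a i, z⟫ ≤ b i}

open RealInnerProductSpace

/-- `H = {z | ⟪a, z⟫ = b}` (with `a ≠ 0`) is a supporting hyperplane of `Q`: it contains a
boundary point of `Q` and `Q` lies in one of the two closed half-spaces bounded by it. -/
def IsSuppHyperplane {d : ℕ} (Q : Set (EuclideanSpace ℝ (Fin d)))
    (a : EuclideanSpace ℝ (Fin d)) (b : ℝ) : Prop :=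
  a ≠ 0 ∧ (∃ w ∈ frontier Q, ⟪a, w⟫ = b) ∧ ∀ z ∈ Q, ⟪a, z⟫ ≤ b

/-- `z` is a limit point of `S`. -/
def IsLimitPt {X : Type*} [TopologicalSpace X] (S : Set X) (z : X) : Prop :=
  z ∈ closure (S \ {z})

/-- `Q = x + ρ • P` (with `ρ > 0`) is a *good copy* of `P` for `A`: the set `B` of points of
`A ∩ ∂Q` which are limit points of `A ∩ int Q`, or of `A ∩ ∂Q ∩ H` for some supporting
hyperplane `H` of `Q`, cannot be covered by a strictly smaller copy of `P`. -/
def IsGoodCopy {d : ℕ} (P A : Set (EuclideanSpace ℝ (Fin d)))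
    (x : EuclideanSpace ℝ (Fin d)) (ρ : ℝ) : Prop :=
  0 < ρ ∧
    ¬∃ (x' : EuclideanSpace ℝ (Fin d)) (ρ' : ℝ), 0 < ρ' ∧ ρ' < ρ ∧
      {z | z ∈ A ∩ frontier (x +ᵥ ρ • P) ∧
            (IsLimitPt (A ∩ interior (x +ᵥ ρ • P)) z ∨
              ∃ a b, IsSuppHyperplane (x +ᵥ ρ • P) a b ∧
                IsLimitPt (A ∩ frontier (x +ᵥ ρ • P) ∩ {w | ⟪a, w⟫ = b}) z)}
        ⊆ x' +ᵥ ρ' • P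

/-- The derivative `A'_P` of `A` with respect to `P`: `A \ A'_P` is the union of all open
balls containing no good copy of `P` for `A`. -/
def derivP {d : ℕ} (P A : Set (EuclideanSpace ℝ (Fin d))) : Set (EuclideanSpace ℝ (Fin d)) :=
  A \ ⋃₀ {U | (∃ c r, U = Metric.ball c r) ∧
    ¬∃ x ρ, IsGoodCopy P A x ρ ∧ x +ᵥ ρ • P ⊆ U}

/-- The transfinite iterates `A^α_P` of the derivative: `A^0_P = A`,
`A^{α+1}_P = (A^α_P)'_P`, and `A^λ_P = ⋂_{α<λ} A^α_P` at limits. -/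
noncomputable def derivIterP {d : ℕ} (P A : Set (EuclideanSpace ℝ (Fin d))) (o : Ordinal.{0}) :
    Set (EuclideanSpace ℝ (Fin d)) :=
  Ordinal.limitRecOn o A (fun _ ih => derivP P ih)
    (fun o _ ih => ⋂ (o' : Ordinal.{0}) (h : o' < o), ih o' h)

/-- `A` contains a perfect set (a nonempty closed set with no isolated points). -/
def ContainsPerfectSet {X : Type*} [TopologicalSpace X] (A : Set X) : Prop :=
  ∃ F : Set X, F ⊆ A ∧ Perfect F ∧ F.Nonempty

theorem derivP_mono {d : ℕ} {P A B : Set (EuclideanSpace ℝ (Fin d))} (h : A ⊆ B) :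
    derivP P A ⊆ derivP P B := by
  rintro z ⟨hzA, hz⟩
  refine ⟨h hzA, fun hzB => hz ?_⟩
  obtain ⟨U, ⟨hU, hno⟩, hzU⟩ := hzB
  refine ⟨U, ⟨hU, ?_⟩, hzU⟩
  rintro ⟨x, ρ, ⟨hρ, hg⟩, hsub⟩
  refine hno ⟨x, ρ, ⟨hρ, ?_⟩, hsub⟩
  rintro ⟨x', ρ', h1, h2, h3⟩
  refine hg ⟨x', ρ', h1, h2, fun w hw => h3 ?_⟩
  obtain ⟨⟨hwA, hwf⟩, hw⟩ := hw
  refine ⟨⟨h hwA, hwf⟩, ?_⟩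
  rcases hw with hw | ⟨a, b, hab, hw⟩
  · left
    exact closure_mono (by gcongr) hw
  · right
    exact ⟨a, b, hab, closure_mono (by gcongr) hw⟩

theorem subset_derivIterP {d : ℕ} {P A K : Set (EuclideanSpace ℝ (Fin d))} (h : K ⊆ A)
    (hK : K ⊆ derivP P K) (o : Ordinal.{0}) : K ⊆ derivIterP P A o := by
  induction o using Ordinal.limitRecOn with
  | zero => simpa [derivIterP] using h
  | add_one o ih =>
    have : derivIterP P A (o + 1) = derivP P (derivIterP P A o) := by
      simp [derivIterP]
    rw [this]
    exact hK.trans (derivP_mono ih)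
  | limit o ho ih =>
    have : derivIterP P A o = ⋂ (o' : Ordinal.{0}) (_ : o' < o), derivIterP P A o' := by
      unfold derivIterP
      rw [Ordinal.limitRecOn_limit _ _ _ _ ho]
    rw [this]
    exact subset_iInter₂ fun o' h' => ih o' h'

theorem subset_derivP {d : ℕ} {P K : Set (EuclideanSpace ℝ (Fin d))}
    (h : ∀ z ∈ K, ∀ ε > 0, ∃ x ρ, IsGoodCopy P K x ρ ∧ x +ᵥ ρ • P ⊆ Metric.ball z ε) :
    K ⊆ derivP P K := by
  intro z hz
  refine ⟨hz, ?_⟩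
  rintro ⟨U, ⟨⟨c, r, rfl⟩, hno⟩, hzU⟩
  obtain ⟨ε, hε, hsub⟩ := Metric.isOpen_iff.1 Metric.isOpen_ball z hzU
  obtain ⟨x, ρ, h1, h2⟩ := h z hz ε hε
  exact hno ⟨x, ρ, h1, h2.trans hsub⟩

theorem mem_copy_iff {d : ℕ} {P : Set (EuclideanSpace ℝ (Fin d))}
    {x z : EuclideanSpace ℝ (Fin d)} {ρ : ℝ} (hρ : 0 < ρ) :
    z ∈ x +ᵥ ρ • P ↔ ρ⁻¹ • (z - x) ∈ P := by
  rw [Set.mem_vadd_set_iff_neg_vadd_mem, Set.mem_smul_set_iff_inv_smul_mem₀ hρ.ne']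
  simp [sub_eq_neg_add]

theorem interior_copy {d : ℕ} {P : Set (EuclideanSpace ℝ (Fin d))}
    {x : EuclideanSpace ℝ (Fin d)} {ρ : ℝ} (hρ : 0 < ρ) :
    interior (x +ᵥ ρ • P) = x +ᵥ ρ • interior P := by
  rw [interior_vadd, interior_smul₀ hρ.ne']

/-- pairs of `F` with difference in `C` occur everywhere -/
def ActiveAll {E : Type*} [NormedAddCommGroup E] (F C : Set E) : Prop :=
  ∀ U : Set E, IsOpen U → (F ∩ U).Nonempty → ∃ z ∈ F ∩ U, ∃ y ∈ F ∩ U, y - z ∈ C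

theorem active_or {E : Type*} [NormedAddCommGroup E] {F C : Set E} (hF : Perfect F)
    (hC : IsOpen C) :
    ActiveAll F C ∨ ∃ F' ⊆ F, Perfect F' ∧ F'.Nonempty ∧ ∀ z ∈ F', ∀ y ∈ F', y - z ∉ C := by
  by_cases h : ActiveAll F C
  · exact Or.inl h
  right
  unfold ActiveAll at h
  push Not at h
  obtain ⟨U, hU, ⟨x, hxF, hxU⟩, hno⟩ := h
  obtain ⟨h1, h2⟩ := hF.closure_nhds_inter x hxF hxU hU
  refine ⟨closure (U ∩ F), ?_, h1, h2, ?_⟩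
  · exact closure_minimal inter_subset_right hF.closed
  · intro z hz y hy hzy
    have hp : (z, y) ∈ closure ((U ∩ F) ×ˢ (U ∩ F)) := by
      rw [closure_prod_eq]; exact ⟨hz, hy⟩
    have ho : IsOpen {p : E × E | p.2 - p.1 ∈ C} :=
      hC.preimage (continuous_snd.sub continuous_fst)
    obtain ⟨⟨a, b⟩, hab, ha, hb⟩ := mem_closure_iff.1 hp _ ho hzy
    exact hno a ⟨ha.2, ha.1⟩ b ⟨hb.2, hb.1⟩ hab

theorem active_or_finset {E ι : Type*} [NormedAddCommGroup E] (s : Finset ι) (C : ι → Set E)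
    (hC : ∀ i ∈ s, IsOpen (C i)) (F : Set E) (hF : Perfect F) (hne : F.Nonempty) :
    ∃ F' ⊆ F, Perfect F' ∧ F'.Nonempty ∧
      ((∃ i ∈ s, ActiveAll F' (C i)) ∨ ∀ i ∈ s, ∀ z ∈ F', ∀ y ∈ F', y - z ∉ C i) := by
  classical
  induction s using Finset.induction_on with
  | empty => exact ⟨F, Subset.rfl, hF, hne, Or.inr (by simp)⟩
  | insert i s hi ih =>
    obtain ⟨F1, h1, h2, h3, h4⟩ := ih (fun j hj => hC j (Finset.mem_insert_of_mem hj))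
    rcases h4 with ⟨j, hj, h4⟩ | h4
    · exact ⟨F1, h1, h2, h3, Or.inl ⟨j, Finset.mem_insert_of_mem hj, h4⟩⟩
    rcases active_or h2 (hC i (Finset.mem_insert_self _ _)) with h5 | ⟨F2, h5, h6, h7, h8⟩
    · exact ⟨F1, h1, h2, h3, Or.inl ⟨i, Finset.mem_insert_self _ _, h5⟩⟩
    · refine ⟨F2, h5.trans h1, h6, h7, Or.inr ?_⟩
      intro j hj
      rcases Finset.mem_insert.1 hj with rfl | hj
      · exact h8
      · exact fun z hz y hy => h4 j hj z (h5 hz) y (h5 hy)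

theorem perfect_subset_of_finite_cover {E ι : Type*} [NormedAddCommGroup E] (s : Finset ι)
    (L : ι → Set E) (hL : ∀ i ∈ s, IsClosed (L i)) (F : Set E) (hF : Perfect F)
    (hne : F.Nonempty) (hcov : F ⊆ ⋃ i ∈ s, L i) :
    ∃ F' ⊆ F, Perfect F' ∧ F'.Nonempty ∧ ∃ i ∈ s, F' ⊆ L i := by
  classical
  induction s using Finset.induction_on generalizing F with
  | empty =>
    obtain ⟨x, hx⟩ := hne
    simpa using hcov hx
  | insert i s hi ih =>
    by_cases h : F ⊆ L i
    · exact ⟨F, Subset.rfl, hF, hne, i, Finset.mem_insert_self _ _, h⟩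
    obtain ⟨x, hxF, hx⟩ := not_subset.1 h
    obtain ⟨h1, h2⟩ := hF.closure_nhds_inter x hxF (U := (L i)ᶜ) hx
      (hL i (Finset.mem_insert_self _ _)).isOpen_compl
    obtain ⟨F', a, b, c, j, hj, e⟩ := ih (fun j hj => hL j (Finset.mem_insert_of_mem hj))
      (closure ((L i)ᶜ ∩ F)) h1 h2 (by
        apply closure_minimal
        · rintro y ⟨hy, hyF⟩
          have := hcov hyF
          rw [Finset.set_biUnion_insert] at this
          exact this.resolve_left hy
        · exact Set.Finite.isClosed_biUnion s.finite_toSet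
            (fun j hj => hL j (Finset.mem_insert_of_mem hj)))
    exact ⟨F', a.trans (closure_minimal inter_subset_right hF.closed), b, c, j,
      Finset.mem_insert_of_mem hj, e⟩

theorem active_generic {E : Type*} [NormedAddCommGroup E] [CompleteSpace E] {F C : Set E}
    (hF : IsClosed F) (hC : IsOpen C) (h : ActiveAll F C) {U : Set E} (hU : IsOpen U)
    (hne : (F ∩ U).Nonempty) :
    ∃ z ∈ F ∩ U, ∃ y ∈ F ∩ U, y - z ∈ C ∧
      (∀ ε > 0, ∃ w ∈ F, dist w z < ε ∧ w - z ∈ C) ∧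
      (∀ ε > 0, ∃ w ∈ F, dist w y < ε ∧ y - w ∈ C) := by
  have : CompleteSpace F := hF.completeSpace_coe
  let G : ℕ → Set F := fun n => {z : F | ∃ w ∈ F, dist w z < 1 / ((n : ℝ) + 1) ∧ w - z ∈ C}
  let H : ℕ → Set F := fun n =>
    {z : F | ∃ w ∈ F, dist w z < 1 / ((n : ℝ) + 1) ∧ (z : E) - w ∈ C}
  have hGo : ∀ n, IsOpen (G n) := by
    intro n
    have : G n = ⋃ w ∈ F, {z : F | dist w (z : E) < 1 / ((n : ℝ) + 1)} ∩
        (fun z : F => w - (z : E)) ⁻¹' C := by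
      ext z; simp only [G, mem_ofPred_eq, mem_iUnion, mem_inter_iff, mem_preimage, exists_prop]
    rw [this]
    exact isOpen_biUnion fun w _ => (isOpen_lt (by fun_prop) (by fun_prop)).inter
      (hC.preimage (by fun_prop))
  have hHo : ∀ n, IsOpen (H n) := by
    intro n
    have : H n = ⋃ w ∈ F, {z : F | dist w (z : E) < 1 / ((n : ℝ) + 1)} ∩
        (fun z : F => (z : E) - w) ⁻¹' C := by
      ext z; simp only [H, mem_ofPred_eq, mem_iUnion, mem_inter_iff, mem_preimage, exists_prop]
    rw [this]
    exact isOpen_biUnion fun w _ => (isOpen_lt (by fun_prop) (by fun_prop)).inter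
      (hC.preimage (by fun_prop))
  have key : ∀ (V : Set F) (n : ℕ), IsOpen V → V.Nonempty →
      ∃ z : F, z ∈ V ∧ ∃ y : F, y ∈ V ∧ dist (y : E) z < 1 / ((n : ℝ) + 1) ∧
        (y : E) - z ∈ C := by
    intro V n hV ⟨x, hx⟩
    obtain ⟨W, hW, rfl⟩ := isOpen_induced_iff.1 hV
    have hpos : (0 : ℝ) < 1 / ((n : ℝ) + 1) / 2 := by positivity
    obtain ⟨z, hz, y, hy, hzy⟩ := h (W ∩ Metric.ball x (1 / ((n : ℝ) + 1) / 2))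
      (hW.inter Metric.isOpen_ball) ⟨x, x.2, hx, Metric.mem_ball_self hpos⟩
    refine ⟨⟨z, hz.1⟩, hz.2.1, ⟨y, hy.1⟩, hy.2.1, ?_, hzy⟩
    have h1 := hz.2.2
    have h2 := hy.2.2
    rw [Metric.mem_ball] at h1 h2
    calc dist y z ≤ dist y x + dist z x := dist_triangle_right _ _ _
      _ < _ := by linarith
  have hGd : ∀ n, Dense (G n) := by
    intro n
    rw [dense_iff_inter_open]
    intro V hV hne
    obtain ⟨z, hz, y, hy, h1, h2⟩ := key V n hV hne
    exact ⟨z, hz, y, y.2, h1, h2⟩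
  have hHd : ∀ n, Dense (H n) := by
    intro n
    rw [dense_iff_inter_open]
    intro V hV hne
    obtain ⟨z, hz, y, hy, h1, h2⟩ := key V n hV hne
    exact ⟨y, hy, z, z.2, by rwa [dist_comm], h2⟩
  have hD : Dense (⋂ n, G n ∩ H n) :=
    dense_iInter_of_isOpen_nat (fun n => (hGo n).inter (hHo n))
      (fun n => (hGd n).inter_of_isOpen_left (hHd n) (hGo n))
  obtain ⟨z0, hz0, y0, hy0, hzy0⟩ := h U hU hne
  have ho : IsOpen {p : F × F | (p.1 : E) ∈ U ∧ (p.2 : E) ∈ U ∧ (p.2 : E) - p.1 ∈ C} := by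
    refine (hU.preimage (by fun_prop : Continuous fun p : F × F => (p.1 : E))).inter
      ((hU.preimage (by fun_prop : Continuous fun p : F × F => (p.2 : E))).inter
      (hC.preimage (by fun_prop : Continuous fun p : F × F => (p.2 : E) - p.1)))
  obtain ⟨⟨z, y⟩, ⟨h1, h2, h3⟩, h4, h5⟩ := (hD.prod hD).inter_open_nonempty _ ho
    ⟨(⟨z0, hz0.1⟩, ⟨y0, hy0.1⟩), hz0.2, hy0.2, hzy0⟩
  refine ⟨z, ⟨z.2, h1⟩, y, ⟨y.2, h2⟩, h3, ?_, ?_⟩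
  · intro ε hε
    obtain ⟨n, hn⟩ := exists_nat_one_div_lt hε
    obtain ⟨w, hw, h6, h7⟩ := (mem_iInter.1 h4 n).1
    exact ⟨w, hw, h6.trans hn, h7⟩
  · intro ε hε
    obtain ⟨n, hn⟩ := exists_nat_one_div_lt hε
    obtain ⟨w, hw, h6, h7⟩ := (mem_iInter.1 h5 n).2
    exact ⟨w, hw, h6.trans hn, h7⟩

theorem isLimitPt_of {X : Type*} [MetricSpace X] {S : Set X} {z : X}
    (h : ∀ ε > 0, ∃ w ∈ S, dist w z < ε ∧ w ≠ z) : IsLimitPt S z := by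
  rw [IsLimitPt, Metric.mem_closure_iff]
  intro ε hε
  obtain ⟨w, hw, h1, h2⟩ := h ε hε
  exact ⟨w, ⟨hw, h2⟩, by rwa [dist_comm]⟩

theorem mem_chordCopy {d : ℕ} {P : Set (EuclideanSpace ℝ (Fin d))}
    {p z w : EuclideanSpace ℝ (Fin d)} {τ : ℝ} (hτ : 0 < τ) :
    w ∈ (z - τ⁻¹ • p) +ᵥ τ⁻¹ • P ↔ p + τ • (w - z) ∈ P := by
  rw [mem_copy_iff (inv_pos.2 hτ), inv_inv]
  have : τ • (w - (z - τ⁻¹ • p)) = p + τ • (w - z) := by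
    rw [sub_sub_eq_add_sub, add_sub_right_comm, smul_add, smul_smul, mul_inv_cancel₀ hτ.ne',
      one_smul, add_comm]
  rw [this]

theorem goodCopy_of_pair {d : ℕ} {P K : Set (EuclideanSpace ℝ (Fin d))} (hP : IsCompact P)
    {p c z : EuclideanSpace ℝ (Fin d)} {τ : ℝ} (hτ : 0 < τ) (hp : p ∈ P) (hq : p + τ • c ∈ P)
    (hmax : ∀ a ∈ P, ∀ s : ℝ, a + s • c ∈ P → s ≤ τ) (hz : z ∈ K) (hw : z + c ∈ K)
    (hB : ∀ w, w = z ∨ w = z + c →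
      (IsLimitPt (K ∩ interior ((z - τ⁻¹ • p) +ᵥ τ⁻¹ • P)) w ∨
        ∃ a b, IsSuppHyperplane ((z - τ⁻¹ • p) +ᵥ τ⁻¹ • P) a b ∧
          IsLimitPt (K ∩ frontier ((z - τ⁻¹ • p) +ᵥ τ⁻¹ • P) ∩ {w | ⟪a, w⟫ = b}) w)) :
    IsGoodCopy P K (z - τ⁻¹ • p) τ⁻¹ := by
  have hρ := inv_pos.2 hτ
  refine ⟨hρ, ?_⟩
  rintro ⟨x', ρ', h1, h2, h3⟩
  have hfr : ∀ w, p + τ • (w - z) ∈ P → p + τ • (w - z) ∉ interior P →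
      w ∈ frontier ((z - τ⁻¹ • p) +ᵥ τ⁻¹ • P) := by
    intro w hw1 hw2
    refine ⟨subset_closure ((mem_chordCopy hτ).2 hw1), ?_⟩
    rw [interior_copy hρ]
    intro h
    exact hw2 ((mem_chordCopy hτ).1 h)
  have hpi : p ∉ interior P := by
    intro h
    have hc : Tendsto (fun δ : ℝ => p - δ • c) (𝓝[>] 0) (𝓝 p) := by
      have : Tendsto (fun δ : ℝ => p - δ • c) (𝓝 0) (𝓝 (p - (0 : ℝ) • c)) :=
        Continuous.tendsto (by fun_prop) _
      simp only [zero_smul, sub_zero] at this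
      exact this.mono_left nhdsWithin_le_nhds
    obtain ⟨δ, h4, h5⟩ := ((hc.eventually (mem_interior_iff_mem_nhds.1 h)).and
      self_mem_nhdsWithin).exists
    have := hmax _ h4 (τ + δ) (by
      have : p - δ • c + (τ + δ) • c = p + τ • c := by module
      rwa [this])
    have h6 : 0 < δ := h5
    linarith
  have hqi : p + τ • c ∉ interior P := by
    intro h
    have hc : Tendsto (fun δ : ℝ => p + (τ + δ) • c) (𝓝[>] 0) (𝓝 (p + τ • c)) := by
      have : Tendsto (fun δ : ℝ => p + (τ + δ) • c) (𝓝 0) (𝓝 (p + (τ + (0 : ℝ)) • c)) :=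
        Continuous.tendsto (by fun_prop) _
      simp only [add_zero] at this
      exact this.mono_left nhdsWithin_le_nhds
    obtain ⟨δ, h4, h5⟩ := ((hc.eventually (mem_interior_iff_mem_nhds.1 h)).and
      self_mem_nhdsWithin).exists
    have := hmax _ hp (τ + δ) h4
    have h6 : 0 < δ := h5
    linarith
  have hzc := h3 ⟨⟨hz, hfr z (by simpa using hp) (by simpa using hpi)⟩, hB z (Or.inl rfl)⟩
  have hwc := h3 ⟨⟨hw, hfr (z + c) (by simpa using hq) (by simpa using hqi)⟩,
    hB (z + c) (Or.inr rfl)⟩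
  rw [mem_copy_iff h1] at hzc hwc
  have := hmax _ hzc ρ'⁻¹ (by
    convert hwc using 1
    module)
  rw [inv_le_comm₀ h1 hτ] at this
  linarith

theorem chordCopy_subset {d : ℕ} {P : Set (EuclideanSpace ℝ (Fin d))}
    {p z : EuclideanSpace ℝ (Fin d)} {τ D ε : ℝ} (hτ : 0 < τ) (hp : p ∈ P)
    (hD : ∀ a ∈ P, ∀ b ∈ P, dist a b ≤ D) (hε : D < ε * τ) :
    (z - τ⁻¹ • p) +ᵥ τ⁻¹ • P ⊆ Metric.ball z ε := by
  intro w hw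
  have := hD _ ((mem_chordCopy hτ).1 hw) _ hp
  rw [Metric.mem_ball, dist_eq_norm]
  rw [dist_eq_norm, add_sub_cancel_left, norm_smul, Real.norm_of_nonneg hτ.le] at this
  by_contra! hcon
  have := mul_le_mul_of_nonneg_left hcon hτ.le
  linarith

theorem exists_maxChord {d : ℕ} {P : Set (EuclideanSpace ℝ (Fin d))} (hP : IsCompact P)
    {x0 : EuclideanSpace ℝ (Fin d)} {l : ℝ} (hl : 0 < l) (hx0 : Metric.closedBall x0 l ⊆ P)
    {c : EuclideanSpace ℝ (Fin d)} (hc : c ≠ 0) :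
    ∃ (p : EuclideanSpace ℝ (Fin d)) (τ : ℝ), 0 < τ ∧ p ∈ P ∧ p + τ • c ∈ P ∧
      (∀ a ∈ P, ∀ s : ℝ, a + s • c ∈ P → s ≤ τ) := by
  have hcn : 0 < ‖c‖ := norm_pos_iff.2 hc
  obtain ⟨R, hR⟩ := hP.isBounded.subset_closedBall 0
  have h1 : x0 ∈ P := hx0 (Metric.mem_closedBall_self hl.le)
  have h2 : x0 + (l / ‖c‖) • c ∈ P := hx0 (by
    rw [Metric.mem_closedBall, dist_eq_norm, add_sub_cancel_left, norm_smul, norm_div, norm_norm,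
      div_mul_cancel₀ _ hcn.ne', Real.norm_of_nonneg hl.le])
  let S : Set (EuclideanSpace ℝ (Fin d) × ℝ) :=
    (P ×ˢ Icc 0 (2 * R / ‖c‖)) ∩ {q | q.1 + q.2 • c ∈ P}
  have hS : IsCompact S := (hP.prod isCompact_Icc).inter_right
    (hP.isClosed.preimage (by fun_prop : Continuous fun q : EuclideanSpace ℝ (Fin d) × ℝ =>
      q.1 + q.2 • c))
  have hb : ∀ a ∈ P, ∀ s : ℝ, a + s • c ∈ P → s ≤ 2 * R / ‖c‖ := by
    intro a ha s hs
    rw [le_div_iff₀ hcn]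
    have h3 := hR ha
    have h4 := hR hs
    rw [mem_closedBall_zero_iff] at h3 h4
    have : ‖s • c‖ ≤ ‖a + s • c‖ + ‖a‖ := by
      have := norm_sub_le (a + s • c) a
      rwa [add_sub_cancel_left] at this
    rw [norm_smul, Real.norm_eq_abs] at this
    have := mul_le_mul_of_nonneg_right (le_abs_self s) hcn.le
    linarith
  have hlc : 0 < l / ‖c‖ := by positivity
  have hmem : (x0, l / ‖c‖) ∈ S := ⟨⟨h1, hlc.le, hb _ h1 _ h2⟩, h2⟩
  obtain ⟨⟨p, τ⟩, hpS, hm⟩ := hS.exists_isMaxOn ⟨_, hmem⟩ continuous_snd.continuousOn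
  have hm' : ∀ q ∈ S, q.2 ≤ τ := fun q hq => hm hq
  have h0 : 0 < τ := hlc.trans_le (hm' _ hmem)
  refine ⟨p, τ, h0, hpS.1.1, hpS.2, ?_⟩
  intro a ha s hs
  by_cases h : 0 ≤ s
  · exact hm' (a, s) ⟨⟨ha, h, hb a ha s hs⟩, hs⟩
  · push Not at h
    linarith

theorem maxChord_ge {d : ℕ} {P : Set (EuclideanSpace ℝ (Fin d))}
    {x0 : EuclideanSpace ℝ (Fin d)} {l : ℝ} (hl : 0 < l) (hx0 : Metric.closedBall x0 l ⊆ P)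
    {c : EuclideanSpace ℝ (Fin d)} (hc : c ≠ 0) {τ : ℝ}
    (hmax : ∀ a ∈ P, ∀ s : ℝ, a + s • c ∈ P → s ≤ τ) : l ≤ τ * ‖c‖ := by
  have hcn : 0 < ‖c‖ := norm_pos_iff.2 hc
  have h1 : x0 ∈ P := hx0 (Metric.mem_closedBall_self hl.le)
  have h2 : x0 + (l / ‖c‖) • c ∈ P := hx0 (by
    rw [Metric.mem_closedBall, dist_eq_norm, add_sub_cancel_left, norm_smul, norm_div, norm_norm,
      div_mul_cancel₀ _ hcn.ne', Real.norm_of_nonneg hl.le])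
  have := hmax _ h1 _ h2
  rwa [div_le_iff₀ hcn] at this

def GoodCone {d : ℕ} (P C : Set (EuclideanSpace ℝ (Fin d))) : Prop :=
  IsOpen C ∧ (∀ c ∈ C, ∀ t : ℝ, 0 < t → t • c ∈ C) ∧ (0 ∉ C) ∧
    ∀ c ∈ C, ∃ (p : EuclideanSpace ℝ (Fin d)) (τ : ℝ), 0 < τ ∧ p ∈ P ∧ p + τ • c ∈ P ∧
      (∀ a ∈ P, ∀ s : ℝ, a + s • c ∈ P → s ≤ τ) ∧
      ∀ᶠ y in 𝓝 (0 : EuclideanSpace ℝ (Fin d)), y ∈ C →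
        p + y ∈ interior P ∧ p + τ • c - y ∈ interior P

theorem exists_ball_diam {d : ℕ} {P : Set (EuclideanSpace ℝ (Fin d))} (hP : IsCompact P)
    (hint : (interior P).Nonempty) :
    ∃ (x0 : EuclideanSpace ℝ (Fin d)) (l D : ℝ), 0 < l ∧ 0 < D ∧ Metric.closedBall x0 l ⊆ P ∧
      ∀ a ∈ P, ∀ b ∈ P, dist a b ≤ D := by
  obtain ⟨x0, hx0⟩ := hint
  obtain ⟨l, hl, hsub⟩ := Metric.nhds_basis_closedBall.mem_iff.1
    (mem_interior_iff_mem_nhds.1 hx0)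
  refine ⟨x0, l, Metric.diam P + 1, hl, by positivity, hsub, fun a ha b hb => ?_⟩
  have := Metric.dist_le_diam_of_mem hP.isBounded ha hb
  linarith

theorem subset_derivP_of_goodCone {d : ℕ} {P F C : Set (EuclideanSpace ℝ (Fin d))}
    (hP : IsCompact P) (hint : (interior P).Nonempty) (hF : IsClosed F) (hC : GoodCone P C)
    (hact : ActiveAll F C) : F ⊆ derivP P F := by
  obtain ⟨x0, l, D, hl, hD0, hx0, hD⟩ := exists_ball_diam hP hint
  obtain ⟨hCo, hCs, hC0, hCg⟩ := hC
  apply subset_derivP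
  intro z0 hz0 ε hε
  have hr : 0 < min (ε / 2) (ε * l / (8 * D)) := by positivity
  obtain ⟨z, hz, y, hy, hzy, hl1, hl2⟩ := active_generic hF hCo hact Metric.isOpen_ball
    ⟨z0, hz0, Metric.mem_ball_self hr⟩
  obtain ⟨c, rfl⟩ : ∃ c, y = z + c := ⟨y - z, by abel⟩
  rw [add_sub_cancel_left] at hzy
  obtain ⟨p, τ, hτ, hp, hq, hmax, hev⟩ := hCg c hzy
  have hc0 : c ≠ 0 := fun h => hC0 (h ▸ hzy)
  have hge := maxChord_ge hl hx0 hc0 hmax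
  have hzd := hz.2
  have hyd := hy.2
  rw [Metric.mem_ball] at hzd hyd
  have hcn : ‖c‖ < ε * l / (4 * D) := by
    have h1 : dist (z + c) z ≤ dist (z + c) z0 + dist z z0 := dist_triangle_right _ _ _
    rw [dist_eq_norm, add_sub_cancel_left] at h1
    have h2 := min_le_right (ε / 2) (ε * l / (8 * D))
    have h3 : ε * l / (4 * D) = ε * l / (8 * D) + ε * l / (8 * D) := by field_simp; ring
    linarith
  have hρ := inv_pos.2 hτ
  refine ⟨z - τ⁻¹ • p, τ⁻¹, ?_, ?_⟩
  · obtain ⟨r, hr, hball⟩ := Metric.eventually_nhds_iff.1 hev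
    refine goodCopy_of_pair hP hτ hp hq hmax hz.1 hy.1 ?_
    rintro w (rfl | rfl)
    · left
      apply isLimitPt_of
      intro δ hδ
      obtain ⟨u, hu, h1, h2⟩ := hl1 (min δ (r / τ)) (by positivity)
      refine ⟨u, ⟨hu, ?_⟩, h1.trans_le (min_le_left _ _), ?_⟩
      · rw [interior_copy hρ, mem_chordCopy hτ]
        refine (hball ?_ (hCs _ h2 τ hτ)).1
        have := h1.trans_le (min_le_right _ _)
        rw [lt_div_iff₀ hτ] at this
        rw [dist_zero_right, norm_smul, Real.norm_of_nonneg hτ.le, ← dist_eq_norm]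
        linarith
      · rintro rfl
        exact hC0 (by simpa using h2)
    · left
      apply isLimitPt_of
      intro δ hδ
      obtain ⟨u, hu, h1, h2⟩ := hl2 (min δ (r / τ)) (by positivity)
      refine ⟨u, ⟨hu, ?_⟩, h1.trans_le (min_le_left _ _), ?_⟩
      · rw [interior_copy hρ, mem_chordCopy hτ]
        have h3 := (hball (y := τ • (z + c - u)) ?_ (hCs _ h2 τ hτ)).2
        · convert h3 using 1
          module
        have := h1.trans_le (min_le_right _ _)
        rw [lt_div_iff₀ hτ] at this
        rw [dist_zero_right, norm_smul, Real.norm_of_nonneg hτ.le, ← dist_eq_norm, dist_comm]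
        linarith
      · rintro rfl
        exact hC0 (by simpa using h2)
  · refine (chordCopy_subset hτ hp hD (ε := ε / 2) ?_).trans ?_
    · have hcp : 0 < ‖c‖ := norm_pos_iff.2 hc0
      rw [lt_div_iff₀ (by positivity)] at hcn
      have : D * (4 * ‖c‖) < ε * τ * ‖c‖ := by
        have := mul_le_mul_of_nonneg_left hge hε.le
        nlinarith
      have : D * 4 < ε * τ := by
        by_contra! hh
        have := mul_le_mul_of_nonneg_right hh hcp.le
        nlinarith
      linarith
    · apply Metric.ball_subset_ball'
      have := min_le_left (ε / 2) (ε * l / (8 * D))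
      linarith

theorem subset_derivP_of_line {d : ℕ} {P F : Set (EuclideanSpace ℝ (Fin d))}
    (hP : IsCompact P) (hconv : Convex ℝ P) (hint : (interior P).Nonempty) (hF : Perfect F)
    (o v : EuclideanSpace ℝ (Fin d)) (hline : ∀ z ∈ F, ∃ t : ℝ, z = o + t • v) :
    F ⊆ derivP P F := by
  obtain ⟨x0, l, D, hl, hD0, hx0, hD⟩ := exists_ball_diam hP hint
  let C : Set (EuclideanSpace ℝ (Fin d)) := {c | 0 < ⟪v, c⟫}
  have hCo : IsOpen C := isOpen_lt (by fun_prop) (by fun_prop)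
  have hdiff : ∀ z ∈ F, ∀ y ∈ F, ∃ t : ℝ, y - z = t • v := by
    intro z hz y hy
    obtain ⟨t, rfl⟩ := hline z hz
    obtain ⟨s, rfl⟩ := hline y hy
    exact ⟨s - t, by module⟩
  have hact : ActiveAll F C := by
    rintro U hU ⟨x, hxF, hxU⟩
    obtain ⟨y, ⟨hyU, hyF⟩, hne⟩ := preperfect_iff_nhds.1 hF.acc x hxF U (hU.mem_nhds hxU)
    obtain ⟨t, ht⟩ := hdiff x hxF y hyF
    have hv : v ≠ 0 := by
      rintro rfl
      rw [smul_zero, sub_eq_zero] at ht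
      exact hne ht
    have hvv : 0 < ⟪v, v⟫ := real_inner_self_pos.2 hv
    have ht0 : t ≠ 0 := by
      rintro rfl
      rw [zero_smul, sub_eq_zero] at ht
      exact hne ht
    rcases lt_or_gt_of_ne ht0 with h | h
    · refine ⟨y, ⟨hyF, hyU⟩, x, ⟨hxF, hxU⟩, ?_⟩
      have : x - y = (-t) • v := by rw [neg_smul, ← ht]; abel
      change 0 < ⟪v, x - y⟫
      rw [this, inner_smul_right]
      exact mul_pos (by linarith) hvv
    · refine ⟨x, ⟨hxF, hxU⟩, y, ⟨hyF, hyU⟩, ?_⟩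
      change 0 < ⟪v, y - x⟫
      rw [ht, inner_smul_right]
      exact mul_pos (by linarith) hvv
  apply subset_derivP
  intro z0 hz0 ε hε
  have hr : 0 < min (ε / 2) (ε * l / (8 * D)) := by positivity
  obtain ⟨z, hz, y, hy, hzy, hl1, hl2⟩ := active_generic hF.closed hCo hact Metric.isOpen_ball
    ⟨z0, hz0, Metric.mem_ball_self hr⟩
  obtain ⟨c, rfl⟩ : ∃ c, y = z + c := ⟨y - z, by abel⟩
  rw [add_sub_cancel_left] at hzy
  have hC0 : (0 : EuclideanSpace ℝ (Fin d)) ∉ C := by simp [C]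
  have hc0 : c ≠ 0 := fun h => hC0 (h ▸ hzy)
  have hcp : 0 < ‖c‖ := norm_pos_iff.2 hc0
  -- differences are positive multiples of c
  have hmul : ∀ a ∈ F, ∀ b ∈ F, b - a ∈ C → ∃ s : ℝ, 0 < s ∧ b - a = s • c := by
    intro a ha b hb hab
    obtain ⟨t, ht⟩ := hdiff z hz.1 _ hy.1
    rw [add_sub_cancel_left] at ht
    obtain ⟨s, hs⟩ := hdiff a ha b hb
    have hvv : 0 ≤ ⟪v, v⟫ := real_inner_self_nonneg
    have h1 : 0 < ⟪v, c⟫ := hzy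
    have h2 : 0 < ⟪v, b - a⟫ := hab
    rw [ht, inner_smul_right] at h1
    rw [hs, inner_smul_right] at h2
    have ht0 : 0 < t := pos_of_mul_pos_left h1 hvv
    have hs0 : 0 < s := pos_of_mul_pos_left h2 hvv
    refine ⟨s / t, by positivity, ?_⟩
    rw [hs, ht, smul_smul, div_mul_cancel₀ _ ht0.ne']
  obtain ⟨p, τ, hτ, hp, hq, hmax⟩ := exists_maxChord hP hl hx0 hc0
  have hge := maxChord_ge hl hx0 hc0 hmax
  have hzd := hz.2
  have hyd := hy.2
  rw [Metric.mem_ball] at hzd hyd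
  have hcn : ‖c‖ < ε * l / (4 * D) := by
    have h1 : dist (z + c) z ≤ dist (z + c) z0 + dist z z0 := dist_triangle_right _ _ _
    rw [dist_eq_norm, add_sub_cancel_left] at h1
    have h2 := min_le_right (ε / 2) (ε * l / (8 * D))
    have h3 : ε * l / (4 * D) = ε * l / (8 * D) + ε * l / (8 * D) := by field_simp; ring
    linarith
  have hρ := inv_pos.2 hτ
  refine ⟨z - τ⁻¹ • p, τ⁻¹, ?_, ?_⟩
  · refine goodCopy_of_pair hP hτ hp hq hmax hz.1 hy.1 ?_
    set Q := (z - τ⁻¹ • p) +ᵥ τ⁻¹ • P with hQ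
    have hQconv : Convex ℝ Q := (hconv.smul _).vadd _
    have hzQ : z ∈ Q := (mem_chordCopy hτ).2 (by simpa using hp)
    have hyQ : z + c ∈ Q := (mem_chordCopy hτ).2 (by simpa using hq)
    -- approach points
    have hap : ∀ w, w = z ∨ w = z + c → ∀ δ > 0, ∃ u ∈ F, dist u w < δ ∧ u ≠ w ∧
        ∃ s : ℝ, 0 < s ∧ s < 1 ∧ u = z + s • c := by
      rintro w (rfl | rfl) δ hδ
      · obtain ⟨u, hu, h1, h2⟩ := hl1 (min δ ‖c‖) (by positivity)
        obtain ⟨s, hs, h3⟩ := hmul w hz.1 u hu h2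
        refine ⟨u, hu, h1.trans_le (min_le_left _ _), ?_, s, hs, ?_, ?_⟩
        · rintro rfl
          exact hC0 (by simpa using h2)
        · have := h1.trans_le (min_le_right _ _)
          rw [dist_eq_norm, h3, norm_smul, Real.norm_of_nonneg hs.le] at this
          by_contra! hh
          have := mul_le_mul_of_nonneg_right hh hcp.le
          linarith
        · rw [← h3]; abel
      · obtain ⟨u, hu, h1, h2⟩ := hl2 (min δ ‖c‖) (by positivity)
        obtain ⟨s, hs, h3⟩ := hmul u hu _ hy.1 h2
        refine ⟨u, hu, h1.trans_le (min_le_left _ _), ?_, 1 - s, ?_, by linarith, ?_⟩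
        · rintro rfl
          exact hC0 (by simpa using h2)
        · have := h1.trans_le (min_le_right _ _)
          rw [dist_comm, dist_eq_norm, h3, norm_smul, Real.norm_of_nonneg hs.le] at this
          by_contra! hh
          have := mul_le_mul_of_nonneg_right (show 1 ≤ s by linarith) hcp.le
          linarith
        · rw [sub_smul, ← h3, one_smul]; abel
    have hsegQ : ∀ s : ℝ, 0 < s → s < 1 → z + s • c ∈ Q := by
      intro s h1 h2
      have := hQconv hzQ hyQ (show 0 ≤ 1 - s by linarith) h1.le (by ring)
      convert this using 1
      module
    have hQi : (interior Q).Nonempty := by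
      rw [interior_copy hρ]
      exact (hint.smul_set).vadd_set
    by_cases hm : z + (1 / 2 : ℝ) • c ∈ interior Q
    · intro w hw
      left
      apply isLimitPt_of
      intro δ hδ
      obtain ⟨u, hu, h1, h2, s, hs0, hs1, rfl⟩ := hap w hw δ hδ
      refine ⟨_, ⟨hu, ?_⟩, h1, h2⟩
      rcases le_total s (1 / 2) with hs | hs
      · have := hQconv.combo_self_interior_mem_interior hzQ hm
          (show 0 ≤ 1 - 2 * s by linarith) (show 0 < 2 * s by linarith) (by ring)
        convert this using 1
        module
      · have := hQconv.combo_self_interior_mem_interior hyQ hm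
          (show 0 ≤ 2 * s - 1 by linarith) (show 0 < 2 - 2 * s by linarith) (by ring)
        convert this using 1
        module
    · obtain ⟨f, hf0, hf⟩ := geometric_hahn_banach_of_nonempty_interior_point hQconv hm hQi
      have e1 := hf _ hzQ
      have e2 := hf _ hyQ
      simp only [map_add, map_smul, smul_eq_mul] at e1 e2
      have hfc : f c = 0 := by linarith
      set a := (InnerProductSpace.toDual ℝ (EuclideanSpace ℝ (Fin d))).symm f with ha
      have hfa : ∀ x, ⟪a, x⟫ = f x := fun x => InnerProductSpace.toDual_symm_apply
      have ha0 : a ≠ 0 := by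
        rw [ha]
        simpa using hf0
      have hsup : ∀ x ∈ Q, f x ≤ f z := by
        intro x hx
        have := hf x hx
        simp only [map_add, map_smul, smul_eq_mul, hfc] at this
        linarith
      have hfr : ∀ x ∈ Q, f x = f z → x ∈ frontier Q := by
        intro x hx hxz
        refine ⟨subset_closure hx, fun hxi => ?_⟩
        have hc : Tendsto (fun δ : ℝ => x + δ • a) (𝓝[>] 0) (𝓝 x) := by
          have : Tendsto (fun δ : ℝ => x + δ • a) (𝓝 0) (𝓝 (x + (0 : ℝ) • a)) :=
            Continuous.tendsto (by fun_prop) _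
          simp only [zero_smul, add_zero] at this
          exact this.mono_left nhdsWithin_le_nhds
        obtain ⟨δ, h4, h5⟩ := ((hc.eventually (mem_interior_iff_mem_nhds.1 hxi)).and
          self_mem_nhdsWithin).exists
        have h6 : 0 < δ := h5
        have h7 := hsup _ h4
        have h8 : 0 < f a := by rw [← hfa]; exact real_inner_self_pos.2 ha0
        simp only [map_add, map_smul, smul_eq_mul, hxz] at h7
        nlinarith
      intro w hw
      right
      refine ⟨a, f z, ⟨ha0, ⟨z, hfr z hzQ rfl, hfa z⟩, fun x hx => by
        rw [hfa]; exact hsup x hx⟩, ?_⟩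
      apply isLimitPt_of
      intro δ hδ
      obtain ⟨u, hu, h1, h2, s, hs0, hs1, rfl⟩ := hap w hw δ hδ
      have h3 : f (z + s • c) = f z := by simp [hfc]
      exact ⟨_, ⟨⟨hu, hfr _ (hsegQ s hs0 hs1) h3⟩, (hfa _).trans h3⟩, h1, h2⟩
  · refine (chordCopy_subset hτ hp hD (ε := ε / 2) ?_).trans ?_
    · rw [lt_div_iff₀ (by positivity)] at hcn
      have : D * (4 * ‖c‖) < ε * τ * ‖c‖ := by
        have := mul_le_mul_of_nonneg_left hge hε.le
        nlinarith
      have : D * 4 < ε * τ := by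
        by_contra! hh
        have := mul_le_mul_of_nonneg_right hh hcp.le
        nlinarith
      linarith
    · apply Metric.ball_subset_ball'
      have := min_le_left (ε / 2) (ε * l / (8 * D))
      linarith

theorem exists_subset_derivP_of_cover {d : ℕ} {P F : Set (EuclideanSpace ℝ (Fin d))}
    (hP : IsCompact P) (hconv : Convex ℝ P) (hint : (interior P).Nonempty) (hF : Perfect F)
    (hne : F.Nonempty)
    (hcov : ∀ v : EuclideanSpace ℝ (Fin d), ‖v‖ = 1 → ∃ N ∈ 𝓝 v, ∃ C1 C2, GoodCone P C1 ∧
      GoodCone P C2 ∧ ∀ c ∈ N, c ∈ C1 ∨ c ∈ C2 ∨ ∃ t : ℝ, c = t • v) :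
    ∃ K ⊆ F, K.Nonempty ∧ K ⊆ derivP P K := by
  classical
  choose! N hN C1 C2 hC1 hC2 hc using hcov
  obtain ⟨s, hs, hscov⟩ := (isCompact_sphere (0 : EuclideanSpace ℝ (Fin d)) 1).elim_nhds_subcover N
    (fun v hv => hN v (by simpa using hv))
  have hs1 : ∀ v ∈ s, ‖v‖ = 1 := fun v hv => by simpa using hs v hv
  obtain ⟨F1, h1, h2, h3, h4⟩ := active_or_finset s C1 (fun v hv => (hC1 v (hs1 v hv)).1) F hF hne
  rcases h4 with ⟨v, hv, h4⟩ | h4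
  · exact ⟨F1, h1, h3, subset_derivP_of_goodCone hP hint h2.closed (hC1 v (hs1 v hv)) h4⟩
  obtain ⟨F2, g1, g2, g3, g4⟩ := active_or_finset s C2 (fun v hv => (hC2 v (hs1 v hv)).1) F1 h2 h3
  rcases g4 with ⟨v, hv, g4⟩ | g4
  · exact ⟨F2, g1.trans h1, g3,
      subset_derivP_of_goodCone hP hint g2.closed (hC2 v (hs1 v hv)) g4⟩
  obtain ⟨o, ho⟩ := id g3
  have hpair : ∀ y ∈ F2, y ≠ o → ∃ v ∈ s, ∃ t : ℝ, y = o + t • v := by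
    intro y hy hyo
    have hpos : 0 < ‖y - o‖ := norm_pos_iff.2 (sub_ne_zero.2 hyo)
    have hsph : ‖y - o‖⁻¹ • (y - o) ∈ Metric.sphere (0 : EuclideanSpace ℝ (Fin d)) 1 := by
      rw [mem_sphere_zero_iff_norm, norm_smul, norm_inv, norm_norm, inv_mul_cancel₀ hpos.ne']
    have heq : ‖y - o‖ • (‖y - o‖⁻¹ • (y - o)) = y - o := by
      rw [smul_smul, mul_inv_cancel₀ hpos.ne', one_smul]
    obtain ⟨v, hv, hvN⟩ := mem_iUnion₂.1 (hscov hsph)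
    rcases hc v (hs1 v hv) _ hvN with h | h | ⟨t, h⟩
    · have := (hC1 v (hs1 v hv)).2.1 _ h _ hpos
      rw [heq] at this
      exact absurd this (h4 v hv o (g1 ho) y (g1 hy))
    · have := (hC2 v (hs1 v hv)).2.1 _ h _ hpos
      rw [heq] at this
      exact absurd this (g4 v hv o ho y hy)
    · refine ⟨v, hv, ‖y - o‖ * t, ?_⟩
      rw [mul_smul, ← h, heq]; abel
  obtain ⟨y1, ⟨_, hy1⟩, hyne⟩ := preperfect_iff_nhds.1 g2.acc o ho univ univ_mem
  obtain ⟨v1, hv1, _⟩ := hpair y1 hy1 hyne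
  obtain ⟨F3, k1, k2, k3, v, hv, k4⟩ := perfect_subset_of_finite_cover s
    (fun v => (fun x => x - o) ⁻¹' (Submodule.span ℝ {v} : Set (EuclideanSpace ℝ (Fin d))))
    (fun v _ => (Submodule.closed_of_finiteDimensional _).preimage (by fun_prop)) F2 g2 g3 (by
      intro y hy
      by_cases hyo : y = o
      · exact mem_iUnion₂.2 ⟨v1, hv1, by simp [hyo]⟩
      · obtain ⟨v, hv, t, ht⟩ := hpair y hy hyo
        refine mem_iUnion₂.2 ⟨v, hv, ?_⟩
        simp only [mem_preimage, SetLike.mem_coe, Submodule.mem_span_singleton]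
        exact ⟨t, by rw [ht]; abel⟩)
  refine ⟨F3, k1.trans (g1.trans h1), k3, subset_derivP_of_line hP hconv hint k2 o v ?_⟩
  intro z hz
  have := k4 hz
  simp only [mem_preimage, SetLike.mem_coe, Submodule.mem_span_singleton] at this
  obtain ⟨t, ht⟩ := this
  exact ⟨t, by rw [ht]; abel⟩


theorem interior_nonempty_of_strictConvex {d : ℕ} {P : Set (EuclideanSpace ℝ (Fin d))}
    (hs : StrictConvex ℝ P) (hn : P.Nontrivial) : (interior P).Nonempty := by
  obtain ⟨a, ha, b, hb, hab⟩ := hn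
  exact ⟨_, hs ha hb hab (by norm_num : (0:ℝ) < 1/2) (by norm_num : (0:ℝ) < 1/2) (by norm_num)⟩

theorem strictConvex_uniform {d : ℕ} {P : Set (EuclideanSpace ℝ (Fin d))}
    (hP : IsCompact P) (hs : StrictConvex ℝ P) {l : ℝ} (hl : 0 < l) :
    ∃ δ > 0, ∀ a ∈ P, ∀ b ∈ P, l ≤ ‖b - a‖ → ∀ e : EuclideanSpace ℝ (Fin d), ‖e‖ < δ →
      (1/2 : ℝ) • a + (1/2 : ℝ) • b + e ∈ interior P := by
  set S : Set (EuclideanSpace ℝ (Fin d) × EuclideanSpace ℝ (Fin d)) :=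
    (P ×ˢ P) ∩ {q | l ≤ ‖q.2 - q.1‖} with hS
  have hSc : IsCompact S := (hP.prod hP).inter_right
    (isClosed_le continuous_const (by fun_prop))
  have hfc : Continuous (fun q : EuclideanSpace ℝ (Fin d) × EuclideanSpace ℝ (Fin d) =>
    (1/2 : ℝ) • q.1 + (1/2 : ℝ) • q.2) := by fun_prop
  have hI := hSc.image hfc
  obtain ⟨δ, hδ, hsub⟩ := hI.exists_thickening_subset_open isOpen_interior (by
    rintro _ ⟨⟨a, b⟩, ⟨⟨ha, hb⟩, hab⟩, rfl⟩
    refine hs ha hb ?_ (by norm_num) (by norm_num) (by norm_num)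
    rintro h
    simp only [mem_ofPred_eq] at hab h
    rw [h, sub_self, norm_zero] at hab
    linarith)
  refine ⟨δ, hδ, fun a ha b hb hab e he => hsub ?_⟩
  rw [Metric.mem_thickening_iff]
  refine ⟨_, ⟨(a, b), ⟨⟨ha, hb⟩, hab⟩, rfl⟩, ?_⟩
  simpa [dist_eq_norm] using he

theorem exists_subset_derivP_strict {d : ℕ} {P F : Set (EuclideanSpace ℝ (Fin d))}
    (hP : IsCompact P) (hs : StrictConvex ℝ P) (hn : P.Nontrivial) (hF : Perfect F)
    (hne : F.Nonempty) : ∃ K ⊆ F, K.Nonempty ∧ K ⊆ derivP P K := by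
  have hint := interior_nonempty_of_strictConvex hs hn
  have hconv := hs.convex
  obtain ⟨x0, l, D, hl, hD0, hx0, hD⟩ := exists_ball_diam hP hint
  obtain ⟨δ, hδ, hunif⟩ := strictConvex_uniform hP hs hl
  refine exists_subset_derivP_of_cover hP hconv hint hF hne fun v hv => ?_
  set κ := δ / (2 * D) with hκ
  have hκ0 : 0 < κ := by positivity
  set C : Set (EuclideanSpace ℝ (Fin d)) := {c | ‖c - ‖c‖ • v‖ < κ * ‖c‖} with hCdef
  have hCo : IsOpen C := isOpen_lt (by fun_prop) (by fun_prop)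
  have hC : GoodCone P C := by
    refine ⟨hCo, ?_, ?_, ?_⟩
    · intro c hc t ht
      simp only [hCdef, mem_ofPred_eq] at hc ⊢
      rw [norm_smul, Real.norm_of_nonneg ht.le, mul_smul, ← smul_sub, norm_smul,
        Real.norm_of_nonneg ht.le]
      nlinarith
    · simp [hCdef]
    · intro c hc
      have hc0 : c ≠ 0 := by
        rintro rfl
        simp [hCdef] at hc
      have hcn : 0 < ‖c‖ := norm_pos_iff.2 hc0
      obtain ⟨p, τ, hτ, hp, hq, hmax⟩ := exists_maxChord hP hl hx0 hc0
      refine ⟨p, τ, hτ, hp, hq, hmax, ?_⟩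
      have hLl := maxChord_ge hl hx0 hc0 hmax
      have hLD : τ * ‖c‖ ≤ D := by
        have := hD _ hq _ hp
        rwa [dist_eq_norm, add_sub_cancel_left, norm_smul, Real.norm_of_nonneg hτ.le] at this
      set L := τ * ‖c‖ with hL
      have hL0 : 0 < L := by positivity
      filter_upwards [Metric.ball_mem_nhds (0 : EuclideanSpace ℝ (Fin d)) (half_pos hl)] with y hy hyC
      rw [mem_ball_zero_iff] at hy
      have hy0 : 0 < ‖y‖ := by
        rw [norm_pos_iff]
        rintro rfl
        simp [hCdef] at hyC
      set e := (L / ‖y‖) • y - τ • c with he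
      have hyC' : ‖(L / ‖y‖) • y - L • v‖ < κ * L := by
        have : (L / ‖y‖) • y - L • v = (L / ‖y‖) • (y - ‖y‖ • v) := by
          rw [smul_sub, smul_smul, div_mul_cancel₀ _ hy0.ne']
        rw [this, norm_smul, Real.norm_of_nonneg (by positivity)]
        calc (L / ‖y‖) * ‖y - ‖y‖ • v‖ < (L / ‖y‖) * (κ * ‖y‖) := by
              apply mul_lt_mul_of_pos_left hyC (by positivity)
          _ = κ * L := by field_simp
      have hcC' : ‖τ • c - L • v‖ < κ * L := by
        have : τ • c - L • v = τ • (c - ‖c‖ • v) := by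
          rw [smul_sub, smul_smul]
        rw [this, norm_smul, Real.norm_of_nonneg hτ.le, hL]
        have : ‖c - ‖c‖ • v‖ < κ * ‖c‖ := hc
        nlinarith
      have hen : ‖e‖ < δ := by
        have h1 : e = ((L / ‖y‖) • y - L • v) - (τ • c - L • v) := by rw [he]; abel
        rw [h1]
        refine (norm_sub_le _ _).trans_lt ?_
        have : κ * L ≤ κ * D := by gcongr
        have h2 : κ * D = δ / 2 := by rw [hκ]; field_simp
        linarith
      have hqp : l ≤ ‖p + τ • c - p‖ := by
        rw [add_sub_cancel_left, norm_smul, Real.norm_of_nonneg hτ.le]; exact hLl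
      have hm1 := hunif p hp _ hq hqp ((1/2 : ℝ) • e) (by
        rw [norm_smul]; norm_num; linarith)
      have hm2 := hunif p hp _ hq hqp (-((1/2 : ℝ) • e)) (by
        rw [norm_neg, norm_smul]; norm_num; linarith)
      set s := ‖y‖ / L with hsdef
      have hs0 : 0 < s := by positivity
      have hs1 : s ≤ 1 / 2 := by
        rw [hsdef, div_le_iff₀ hL0]; linarith
      have hye : y = s • (τ • c + e) := by
        rw [he, add_sub_cancel, smul_smul, hsdef]
        rw [div_mul_div_cancel₀ hL0.ne', div_self hy0.ne', one_smul]
      have key := fun {a m : EuclideanSpace ℝ (Fin d)} (ha : a ∈ P) (hm : m ∈ interior P) =>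
        hconv.combo_self_interior_mem_interior ha hm (a := 1 - 2 * s) (b := 2 * s)
          (by linarith) (by linarith) (by ring)
      constructor
      · convert key hp hm1 using 1
        rw [hye]
        module
      · convert key hq hm2 using 1
        rw [hye]
        module
  have hvC : v ∈ C := by
    simp only [hCdef, mem_ofPred_eq, hv, one_smul, sub_self, norm_zero]
    linarith
  exact ⟨C, hCo.mem_nhds hvC, C, C, hC, hC, fun c hc => Or.inl hc⟩


theorem poly_mem {d k : ℕ} {P : Set (EuclideanSpace ℝ (Fin d))}
    {a : Fin k → EuclideanSpace ℝ (Fin d)} {b : Fin k → ℝ} (hPe : P = ⋂ i, {z | ⟪a i, z⟫ ≤ b i})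
    {x z : EuclideanSpace ℝ (Fin d)} {ρ : ℝ} (hρ : 0 < ρ) :
    z ∈ x +ᵥ ρ • P ↔ ∀ i, ⟪a i, z⟫ ≤ ⟪a i, x⟫ + ρ * b i := by
  rw [mem_copy_iff hρ, hPe, mem_iInter]
  refine forall_congr' fun i => ?_
  rw [mem_ofPred_eq, real_inner_smul_right, inner_sub_right, inv_mul_le_iff₀ hρ]
  constructor <;> intro h <;> linarith

theorem poly_interior {d k : ℕ} {P : Set (EuclideanSpace ℝ (Fin d))}
    {a : Fin k → EuclideanSpace ℝ (Fin d)} {b : Fin k → ℝ} (hPe : P = ⋂ i, {z | ⟪a i, z⟫ ≤ b i})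
    {x z : EuclideanSpace ℝ (Fin d)} {ρ : ℝ} (hρ : 0 < ρ)
    (h : ∀ i, ⟪a i, z⟫ < ⟪a i, x⟫ + ρ * b i) : z ∈ interior (x +ᵥ ρ • P) := by
  rw [mem_interior]
  refine ⟨⋂ i, {z | ⟪a i, z⟫ < ⟪a i, x⟫ + ρ * b i}, ?_, ?_, ?_⟩
  · intro w hw
    rw [poly_mem hPe hρ]
    intro i
    exact (mem_iInter.1 hw i).le
  · exact isOpen_iInter_of_finite fun i => isOpen_lt (by fun_prop) (by fun_prop)
  · exact mem_iInter.2 h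

theorem poly_frontier {d k : ℕ} {P : Set (EuclideanSpace ℝ (Fin d))}
    {a : Fin k → EuclideanSpace ℝ (Fin d)} {b : Fin k → ℝ} (ha : ∀ i, a i ≠ 0)
    (hPe : P = ⋂ i, {z | ⟪a i, z⟫ ≤ b i})
    {x z : EuclideanSpace ℝ (Fin d)} {ρ : ℝ} (hρ : 0 < ρ) (hz : z ∈ x +ᵥ ρ • P) {i : Fin k}
    (h : ⟪a i, z⟫ = ⟪a i, x⟫ + ρ * b i) : z ∈ frontier (x +ᵥ ρ • P) := by
  refine ⟨subset_closure hz, fun hi => ?_⟩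
  have hc : Tendsto (fun t : ℝ => z + t • a i) (𝓝[>] 0) (𝓝 z) := by
    have : Continuous (fun t : ℝ => z + t • a i) := by fun_prop
    have h2 := this.tendsto 0
    simp only [zero_smul, add_zero] at h2
    exact h2.mono_left nhdsWithin_le_nhds
  have h3 := hc.eventually (mem_interior_iff_mem_nhds.1 hi)
  obtain ⟨t, ht, ht0⟩ := (h3.and self_mem_nhdsWithin).exists
  have h4 := (poly_mem hPe hρ).1 ht i
  rw [inner_add_right, real_inner_smul_right, h] at h4
  have h5 : 0 < ⟪a i, a i⟫ := real_inner_self_pos.2 (ha i)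
  have h6 : 0 < t := ht0
  nlinarith [mul_pos h6 h5]

theorem poly_minCopy {d k : ℕ} {P F0 : Set (EuclideanSpace ℝ (Fin d))} (hP : IsCompact P)
    {a : Fin k → EuclideanSpace ℝ (Fin d)} {b : Fin k → ℝ} (hPe : P = ⋂ i, {z | ⟪a i, z⟫ ≤ b i})
    {w1 w2 x1 : EuclideanSpace ℝ (Fin d)} {ρ1 : ℝ} (hw1 : w1 ∈ F0) (hw2 : w2 ∈ F0) (hw : w1 ≠ w2)
    (hρ1 : 0 < ρ1) (hx1 : F0 ⊆ x1 +ᵥ ρ1 • P) :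
    ∃ (x : EuclideanSpace ℝ (Fin d)) (ρ : ℝ), 0 < ρ ∧ ρ ≤ ρ1 ∧ F0 ⊆ x +ᵥ ρ • P ∧
      ∀ (x' : EuclideanSpace ℝ (Fin d)) (ρ' : ℝ), 0 < ρ' → F0 ⊆ x' +ᵥ ρ' • P → ρ ≤ ρ' := by
  obtain ⟨M, hM⟩ := hP.isBounded.subset_closedBall (0 : EuclideanSpace ℝ (Fin d))
  have hM' : ∀ u ∈ P, ‖u‖ ≤ M := fun u hu => by simpa using hM hu
  have hwd : 0 < ‖w1 - w2‖ := norm_pos_iff.2 (sub_ne_zero.2 hw)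
  have hkey : ∀ (x : EuclideanSpace ℝ (Fin d)) (ρ : ℝ), 0 < ρ → F0 ⊆ x +ᵥ ρ • P →
      ‖x - w1‖ ≤ ρ * M ∧ ‖w1 - w2‖ ≤ ρ * (2 * M) := by
    intro x ρ hρ hx
    have h1 := hM' _ ((mem_copy_iff hρ).1 (hx hw1))
    have h2 := hM' _ ((mem_copy_iff hρ).1 (hx hw2))
    rw [norm_smul, Real.norm_of_nonneg (by positivity), inv_mul_le_iff₀ hρ] at h1 h2
    refine ⟨by rwa [norm_sub_rev], ?_⟩
    have : w1 - w2 = (w1 - x) - (w2 - x) := by abel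
    rw [this]
    refine (norm_sub_le _ _).trans ?_
    linarith
  have hM0 : 0 < M := by
    have := (hkey x1 ρ1 hρ1 hx1).2
    by_contra h
    nlinarith
  set ρ0 := ‖w1 - w2‖ / (2 * M) with hρ0
  have hρ00 : 0 < ρ0 := by positivity
  set S : Set (EuclideanSpace ℝ (Fin d) × ℝ) := (Metric.closedBall w1 (ρ1 * M) ×ˢ Icc ρ0 ρ1) ∩
    ⋂ w ∈ F0, ⋂ i, {q | ⟪a i, w⟫ ≤ ⟪a i, q.1⟫ + q.2 * b i} with hS
  have hSc : IsCompact S := by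
    refine ((isCompact_closedBall _ _).prod isCompact_Icc).inter_right ?_
    exact isClosed_biInter fun w _ => isClosed_iInter fun i =>
      isClosed_le (by fun_prop) (by fun_prop)
  have hmemS : ∀ (x : EuclideanSpace ℝ (Fin d)) (ρ : ℝ), 0 < ρ → ρ ≤ ρ1 → F0 ⊆ x +ᵥ ρ • P →
      (x, ρ) ∈ S := by
    intro x ρ hρ hρ' hx
    obtain ⟨h1, h2⟩ := hkey x ρ hρ hx
    refine ⟨⟨?_, ?_, hρ'⟩, ?_⟩
    · rw [Metric.mem_closedBall, dist_eq_norm]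
      exact h1.trans (by gcongr)
    · rw [hρ0, div_le_iff₀ (by positivity)]; exact h2
    · simp only [mem_iInter]
      intro w hw i
      exact (poly_mem hPe hρ).1 (hx hw) i
  obtain ⟨⟨x, ρ⟩, hq, hmin⟩ := hSc.exists_isMinOn ⟨_, hmemS x1 ρ1 hρ1 le_rfl hx1⟩
    (f := fun q => q.2) (by fun_prop)
  have hρpos : 0 < ρ := hρ00.trans_le hq.1.2.1
  refine ⟨x, ρ, hρpos, hq.1.2.2, ?_, ?_⟩
  · intro w hw
    rw [poly_mem hPe hρpos]
    intro i
    have := hq.2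
    simp only [mem_iInter] at this
    exact this w hw i
  · intro x' ρ' hρ' hx'
    by_contra hlt
    push Not at hlt
    have := hmin (hmemS x' ρ' hρ' (hlt.le.trans hq.1.2.2) hx')
    exact absurd this (not_le.2 hlt)

theorem poly_contact {d k : ℕ} {P F0 : Set (EuclideanSpace ℝ (Fin d))} (hF0 : IsCompact F0)
    (hne : F0.Nonempty)
    {a : Fin k → EuclideanSpace ℝ (Fin d)} {b : Fin k → ℝ} (ha : ∀ i, a i ≠ 0)
    (hPe : P = ⋂ i, {z | ⟪a i, z⟫ ≤ b i})
    {x : EuclideanSpace ℝ (Fin d)} {ρ : ℝ} (hρ : 0 < ρ) (hx : F0 ⊆ x +ᵥ ρ • P)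
    (hmin : ∀ (x' : EuclideanSpace ℝ (Fin d)) (ρ' : ℝ), 0 < ρ' → F0 ⊆ x' +ᵥ ρ' • P → ρ ≤ ρ')
    {x' : EuclideanSpace ℝ (Fin d)} {ρ' : ℝ} (hρ' : 0 < ρ') (hlt : ρ' < ρ)
    (hsub : F0 ∩ frontier (x +ᵥ ρ • P) ⊆ x' +ᵥ ρ' • P) : False := by
  have hev : ∀ i, ∀ᶠ t : ℝ in 𝓝[>] 0, ∀ w ∈ F0,
      ⟪a i, w⟫ ≤ (1 - t) * (⟪a i, x⟫ + ρ * b i) + t * (⟪a i, x'⟫ + ρ' * b i) := by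
    intro i
    obtain ⟨w, hw, hwmax⟩ := hF0.exists_isMaxOn hne (f := fun w => ⟪a i, w⟫) (by fun_prop)
    have hle := (poly_mem hPe hρ).1 (hx hw) i
    rcases hle.lt_or_eq with h | h
    · have hc : Tendsto (fun t : ℝ => (1 - t) * (⟪a i, x⟫ + ρ * b i) + t * (⟪a i, x'⟫ + ρ' * b i))
          (𝓝[>] 0) (𝓝 (⟪a i, x⟫ + ρ * b i)) := by
        have : Continuous (fun t : ℝ =>
          (1 - t) * (⟪a i, x⟫ + ρ * b i) + t * (⟪a i, x'⟫ + ρ' * b i)) := by fun_prop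
        have h2 := this.tendsto 0
        simp only [sub_zero, one_mul, zero_mul, add_zero] at h2
        exact h2.mono_left nhdsWithin_le_nhds
      filter_upwards [hc.eventually (lt_mem_nhds h)] with t ht w' hw'
      have h3 : ⟪a i, w'⟫ ≤ ⟪a i, w⟫ := hwmax hw'
      linarith
    · have hfr := poly_frontier ha hPe hρ (hx hw) h
      have h4 := (poly_mem hPe hρ').1 (hsub ⟨hw, hfr⟩) i
      filter_upwards [self_mem_nhdsWithin] with t ht w' hw'
      have h3 : ⟪a i, w'⟫ ≤ ⟪a i, w⟫ := hwmax hw'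
      have ht0 : 0 < t := ht
      nlinarith
  have h1 : ∀ᶠ t : ℝ in 𝓝[>] 0, t < 1 :=
    nhdsWithin_le_nhds (gt_mem_nhds one_pos)
  obtain ⟨t, ⟨hall, ht1⟩, ht0⟩ := (((eventually_all.2 hev).and h1).and self_mem_nhdsWithin).exists
  have ht0 : 0 < t := ht0
  have hρ'' : 0 < (1 - t) * ρ + t * ρ' := by
    have : 0 < 1 - t := by linarith
    positivity
  have := hmin ((1 - t) • x + t • x') ((1 - t) * ρ + t * ρ') hρ'' (by
    intro w hw
    rw [poly_mem hPe hρ'']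
    intro i
    rw [inner_add_right, real_inner_smul_right, real_inner_smul_right]
    have := hall i w hw
    linarith)
  nlinarith

theorem subset_derivP_polytope {d : ℕ} {P F : Set (EuclideanSpace ℝ (Fin d))}
    (hP : IsPolytope d P) (hF : Perfect F) : F ⊆ derivP P F := by
  obtain ⟨hPc, hint, k, a, b, ha, hPe⟩ := hP
  obtain ⟨x0, l, D, hl, hD0, hx0, hD⟩ := exists_ball_diam hPc hint
  refine subset_derivP fun z hz ε hε => ?_
  set r := ε * l / (2 * D) with hr
  have hr0 : 0 < r := by positivity
  obtain ⟨hF0p, -⟩ := hF.closure_nhds_inter z hz (Metric.mem_ball_self hr0) Metric.isOpen_ball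
  set F0 := closure (Metric.ball z r ∩ F) with hF0
  have hzF0 : z ∈ F0 := subset_closure ⟨Metric.mem_ball_self hr0, hz⟩
  have hF0F : F0 ⊆ F := closure_minimal inter_subset_right hF.closed
  have hF0b : F0 ⊆ Metric.closedBall z r :=
    closure_minimal (inter_subset_left.trans Metric.ball_subset_closedBall) Metric.isClosed_closedBall
  have hF0c : IsCompact F0 := (isCompact_closedBall z r).of_isClosed_subset isClosed_closure hF0b
  have hacc : ∀ w ∈ F0, w ∈ closure (F0 \ {w}) := fun w hw => by
    have := hF0p.acc w hw
    rwa [accPt_principal_iff_clusterPt, ← mem_closure_iff_clusterPt] at this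
  obtain ⟨w2, hw2, hw2z⟩ := closure_nonempty_iff.1 ⟨z, hacc z hzF0⟩
  have hrl : 0 < r / l := by positivity
  obtain ⟨x, ρ, hρ, hρr, hx, hmin⟩ := poly_minCopy hPc hPe hzF0 hw2
    (fun h => hw2z (by simp [h])) hrl (x1 := z - (r / l) • x0) (by
      intro w hw
      rw [mem_copy_iff hrl]
      apply hx0
      have h1 := hF0b hw
      rw [Metric.mem_closedBall, dist_eq_norm] at h1 ⊢
      have : (r / l)⁻¹ • (w - (z - (r / l) • x0)) - x0 = (r / l)⁻¹ • (w - z) := by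
        have h2 : w - (z - (r / l) • x0) = (w - z) + (r / l) • x0 := by abel
        rw [h2, smul_add, smul_smul, inv_mul_cancel₀ hrl.ne', one_smul, add_sub_cancel_right]
      rw [this, norm_smul, Real.norm_of_nonneg (by positivity), inv_mul_le_iff₀ hrl,
        div_mul_cancel₀ _ hl.ne']
      exact h1)
  refine ⟨x, ρ, ⟨hρ, ?_⟩, ?_⟩
  · rintro ⟨x', ρ', hρ', hlt, hsub⟩
    refine poly_contact hF0c ⟨z, hzF0⟩ ha hPe hρ hx hmin (x' := x') hρ' hlt ?_
    refine Subset.trans ?_ hsub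
    rintro w ⟨hw, hwf⟩
    refine ⟨⟨hF0F hw, hwf⟩, ?_⟩
    have hcov : F0 \ {w} ⊆ ((F ∩ interior (x +ᵥ ρ • P)) \ {w}) ∪
        ⋃ i, ((F ∩ frontier (x +ᵥ ρ • P) ∩ {w | ⟪a i, w⟫ = ⟪a i, x⟫ + ρ * b i}) \ {w}) := by
      rintro u ⟨hu, huw⟩
      by_cases hall : ∀ i, ⟪a i, u⟫ < ⟪a i, x⟫ + ρ * b i
      · exact Or.inl ⟨⟨hF0F hu, poly_interior hPe hρ hall⟩, huw⟩
      · push Not at hall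
        obtain ⟨i, hi⟩ := hall
        have hi' := le_antisymm ((poly_mem hPe hρ).1 (hx hu) i) hi
        refine Or.inr (mem_iUnion.2 ⟨i, ⟨⟨hF0F hu, poly_frontier ha hPe hρ (hx hu) hi'⟩, hi'⟩, huw⟩)
    have h1 := closure_mono hcov (hacc w hw)
    rw [closure_union, closure_iUnion_of_finite] at h1
    rcases h1 with h1 | h1
    · exact Or.inl h1
    · obtain ⟨i, hi⟩ := mem_iUnion.1 h1
      refine Or.inr ⟨a i, _, ⟨ha i, ?_, ?_⟩, hi⟩
      · obtain ⟨u, hu⟩ := closure_nonempty_iff.1 ⟨w, hi⟩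
        exact ⟨u, hu.1.1.2, hu.1.2⟩
      · intro u hu
        exact (poly_mem hPe hρ).1 hu i
  · intro w hw
    have h1 := (mem_copy_iff hρ).1 hw
    have h2 := (mem_copy_iff hρ).1 (hx hzF0)
    have h3 := hD _ h1 _ h2
    rw [dist_eq_norm, ← smul_sub, sub_sub_sub_cancel_right, norm_smul,
      Real.norm_of_nonneg (by positivity), inv_mul_le_iff₀ hρ] at h3
    rw [Metric.mem_ball, dist_eq_norm]
    have h4 : ρ * D ≤ (r / l) * D := by gcongr
    have h5 : (r / l) * D = ε / 2 := by rw [hr]; field_simp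
    linarith


structure Coords {d : ℕ} (X Y : EuclideanSpace ℝ (Fin d) →L[ℝ] ℝ)
    (v n : EuclideanSpace ℝ (Fin d)) : Prop where
  eq : ∀ z, z = X z • v + Y z • n
  Xv : X v = 1
  Yv : Y v = 0
  Xn : X n = 0
  Yn : Y n = 1

/-- a maximal chord of `P` in direction `c` starting at `p` -/
structure MaxChord {d : ℕ} (P : Set (EuclideanSpace ℝ (Fin d)))
    (c p : EuclideanSpace ℝ (Fin d)) (τ : ℝ) : Prop where
  pos : 0 < τ
  mem : p ∈ P
  mem' : p + τ • c ∈ P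
  max : ∀ a ∈ P, ∀ s : ℝ, a + s • c ∈ P → s ≤ τ

theorem convex_three {d : ℕ} {P : Set (EuclideanSpace ℝ (Fin d))} (hconv : Convex ℝ P)
    {p g h : EuclideanSpace ℝ (Fin d)} (hp : p ∈ P) (hg : g ∈ P) (hh : h ∈ P) {α β γ : ℝ}
    (hα : 0 ≤ α) (hβ : 0 ≤ β) (hγ : 0 ≤ γ) (hs : α + β + γ = 1) :
    α • p + β • g + γ • h ∈ P := by
  have := hconv.sum_mem (t := Finset.univ) (w := ![α, β, γ]) (z := ![p, g, h])
    (by intro i _; fin_cases i <;> simpa) (by simpa [Fin.sum_univ_three] using hs)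
    (by intro i _; fin_cases i <;> simpa)
  simpa [Fin.sum_univ_three] using this

theorem reach_combo {d : ℕ} {P : Set (EuclideanSpace ℝ (Fin d))} (hconv : Convex ℝ P)
    {p g h w : EuclideanSpace ℝ (Fin d)} (hp : p ∈ P) (hg : g ∈ P) (hh : h ∈ P) {α β : ℝ}
    (hα : 0 ≤ α) (hβ : 0 ≤ β) (hw : w = α • (g - p) + β • (h - p)) :
    ∃ s : ℝ, 0 < s ∧ p + s • w ∈ P := by
  have h0 : 0 < α + β + 1 := by linarith
  refine ⟨1 / (α + β + 1), by positivity, ?_⟩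
  have h1 : p + (1 / (α + β + 1)) • w = (1 / (α + β + 1)) • p + (α / (α + β + 1)) • g
      + (β / (α + β + 1)) • h := by
    rw [hw]
    match_scalars <;> field_simp <;> ring
  rw [h1]
  exact convex_three hconv hp hg hh (by positivity) (by positivity) (by positivity)
    (by field_simp; ring)

section planar
variable {d : ℕ} {P : Set (EuclideanSpace ℝ (Fin d))} {X Y : EuclideanSpace ℝ (Fin d) →L[ℝ] ℝ}
  {v n : EuclideanSpace ℝ (Fin d)}

theorem Coords.ext_iff' (hc : Coords X Y v n) {a b : EuclideanSpace ℝ (Fin d)}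
    (h1 : X a = X b) (h2 : Y a = Y b) : a = b := by
  rw [hc.eq a, hc.eq b, h1, h2]

theorem reach_one (hconv : Convex ℝ P) (hc : Coords X Y v n) {p g : EuclideanSpace ℝ (Fin d)}
    {σ τ : ℝ} (hσ : 0 < σ) (hch : MaxChord P (v + σ • n) p τ) (hg : g ∈ P)
    (h1 : Y g - Y p ≤ 0) (h2 : Y g - Y p < σ * (X g - X p)) : ∃ s : ℝ, 0 < s ∧ p + s • v ∈ P := by
  have hτ := hch.pos
  set Δ := σ * (X g - X p) - (Y g - Y p) with hΔ
  have hΔ0 : 0 < Δ := by linarith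
  refine reach_combo hconv hch.mem hg hch.mem' (α := σ / Δ) (β := -(Y g - Y p) / Δ / τ)
    (by positivity) (div_nonneg (div_nonneg (by linarith) hΔ0.le) hτ.le) ?_
  refine hc.ext_iff' ?_ ?_
  · simp only [map_add, map_sub, map_smul, hc.Xv, hc.Yv, hc.Xn, hc.Yn, smul_eq_mul]
    field_simp
    rw [hΔ]; ring
  · simp only [map_add, map_sub, map_smul, hc.Xv, hc.Yv, hc.Xn, hc.Yn, smul_eq_mul]
    field_simp
    ring

theorem reach_two (hconv : Convex ℝ P) (hc : Coords X Y v n) {p g : EuclideanSpace ℝ (Fin d)}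
    {σ τ ε : ℝ} (hσε : σ < ε) (hch : MaxChord P (v + σ • n) p τ) (hg : g ∈ P)
    (h1 : ε * (X g - X p) ≤ Y g - Y p) (h2 : σ * (X g - X p) < Y g - Y p) :
    ∃ s : ℝ, 0 < s ∧ p + s • (v + ε • n) ∈ P := by
  have hτ := hch.pos
  set Δ := (Y g - Y p) - σ * (X g - X p) with hΔ
  have hΔ0 : 0 < Δ := by linarith
  refine reach_combo hconv hch.mem hg hch.mem' (α := (ε - σ) / Δ)
    (β := ((Y g - Y p) - ε * (X g - X p)) / Δ / τ)
    (div_nonneg (by linarith) hΔ0.le) (div_nonneg (div_nonneg (by linarith) hΔ0.le) hτ.le) ?_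
  refine hc.ext_iff' ?_ ?_
  · simp only [map_add, map_sub, map_smul, hc.Xv, hc.Yv, hc.Xn, hc.Yn, smul_eq_mul]
    field_simp
    rw [hΔ]; ring
  · simp only [map_add, map_sub, map_smul, hc.Xv, hc.Yv, hc.Xn, hc.Yn, smul_eq_mul]
    field_simp
    rw [hΔ]; ring

theorem chord_limit (hP : IsCompact P) (hconv : Convex ℝ P) (hint : (interior P).Nonempty)
    (hc : Coords X Y v n) {σ τ : ℕ → ℝ} {p : ℕ → EuclideanSpace ℝ (Fin d)}
    (hσ : Tendsto σ atTop (𝓝 0)) (hch : ∀ k, MaxChord P (v + σ k • n) (p k) (τ k)) :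
    ∃ φ : ℕ → ℕ, StrictMono φ ∧ ∃ (p' : EuclideanSpace ℝ (Fin d)) (τ' : ℝ),
      Tendsto (p ∘ φ) atTop (𝓝 p') ∧ Tendsto (τ ∘ φ) atTop (𝓝 τ') ∧ MaxChord P v p' τ' := by
  obtain ⟨x0, l, D, hl, hD0, hx0, hD⟩ := exists_ball_diam hP hint
  obtain ⟨⟨p', q'⟩, ⟨hp', hq'⟩, φ, hφ, hlim⟩ := (hP.prod hP).tendsto_subseq
    (x := fun k => (p k, p k + τ k • (v + σ k • n))) (fun k => ⟨(hch k).mem, (hch k).mem'⟩)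
  have hlp : Tendsto (p ∘ φ) atTop (𝓝 p') := (continuous_fst.tendsto _).comp hlim
  have hlq : Tendsto (fun k => p (φ k) + τ (φ k) • (v + σ (φ k) • n)) atTop (𝓝 q') :=
    (continuous_snd.tendsto _).comp hlim
  have hlσ : Tendsto (σ ∘ φ) atTop (𝓝 0) := hσ.comp hφ.tendsto_atTop
  have hlτ : Tendsto (τ ∘ φ) atTop (𝓝 (X q' - X p')) := by
    have h1 := ((X.continuous.tendsto _).comp hlq).sub ((X.continuous.tendsto _).comp hlp)
    refine h1.congr fun k => ?_
    simp [hc.Xv, hc.Xn]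
  set τ' := X q' - X p' with hτ'
  have hlc : Tendsto (fun k => v + σ (φ k) • n) atTop (𝓝 v) := by
    have := (hlσ.smul_const n).const_add v
    simpa using this
  have hq : q' = p' + τ' • v := by
    refine tendsto_nhds_unique hlq ?_
    exact hlp.add (hlτ.smul hlc)
  have hpos : 0 < τ' := by
    have h1 : l ≤ τ' * ‖v‖ := by
      refine ge_of_tendsto' (hlτ.mul hlc.norm) fun k => ?_
      refine maxChord_ge hl hx0 ?_ (hch (φ k)).max
      intro h
      have := congrArg X h
      simp [hc.Xv, hc.Xn] at this
    by_contra h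
    nlinarith [norm_nonneg v]
  refine ⟨φ, hφ, p', τ', hlp, hlτ, hpos, hp', hq ▸ hq', ?_⟩
  intro a ha s hs
  obtain ⟨o, ho⟩ := hint
  have hδ : ∀ᶠ δ : ℝ in 𝓝[>] 0, (1 - δ) * s ≤ τ' := by
    have h1 : ∀ᶠ t : ℝ in 𝓝[>] 0, t < 1 :=
      nhdsWithin_le_nhds (gt_mem_nhds one_pos)
    filter_upwards [h1, self_mem_nhdsWithin] with δ hδ1 hδ0
    have hδ0 : 0 < δ := hδ0
    have ha' : (1 - δ) • a + δ • o ∈ interior P :=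
      hconv.combo_self_interior_mem_interior ha ho (by linarith) hδ0 (by ring)
    have hb' : (1 - δ) • a + δ • o + ((1 - δ) * s) • v ∈ interior P := by
      convert hconv.combo_self_interior_mem_interior hs ho (a := 1 - δ) (b := δ)
        (by linarith) hδ0 (by ring) using 1
      module
    have hl2 : Tendsto (fun k => (1 - δ) • a + δ • o + ((1 - δ) * s) • (v + σ (φ k) • n)) atTop
        (𝓝 ((1 - δ) • a + δ • o + ((1 - δ) * s) • v)) :=
      (hlc.const_smul _).const_add _
    refine ge_of_tendsto hlτ ?_
    filter_upwards [hl2.eventually (mem_interior_iff_mem_nhds.1 hb')] with k hk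
    exact (hch (φ k)).max _ (interior_subset ha') _ hk
  have h3 : Tendsto (fun δ : ℝ => (1 - δ) * s) (𝓝[>] 0) (𝓝 s) := by
    have : Continuous (fun δ : ℝ => (1 - δ) * s) := by fun_prop
    have h2 := this.tendsto 0
    simp only [sub_zero, one_mul] at h2
    exact h2.mono_left nhdsWithin_le_nhds
  exact le_of_tendsto h3 hδ

theorem exists_reach_one (hP : IsCompact P) (hconv : Convex ℝ P) (hint : (interior P).Nonempty)
    (hc : Coords X Y v n) : ∃ ε > 0, ∀ σ : ℝ, 0 < σ → σ < ε → ∀ p τ,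
      MaxChord P (v + σ • n) p τ → ∃ s : ℝ, 0 < s ∧ p + s • v ∈ P := by
  by_contra hcon
  push Not at hcon
  choose σ hσ0 hσ1 p τ hch hfail using fun k : ℕ =>
    hcon (1 / ((k : ℝ) + 1)) (by positivity)
  have hσ : Tendsto σ atTop (𝓝 0) :=
    squeeze_zero (fun k => (hσ0 k).le) (fun k => (hσ1 k).le) tendsto_one_div_add_atTop_nhds_zero_nat
  obtain ⟨φ, hφ, p', τ', hlp, hlτ, hch'⟩ := chord_limit hP hconv hint hc hσ hch
  have hlσ : Tendsto (fun k => σ (φ k)) atTop (𝓝 0) := hσ.comp hφ.tendsto_atTop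
  have hlX : Tendsto (fun k => X (p (φ k))) atTop (𝓝 (X p')) := (X.continuous.tendsto _).comp hlp
  have hlY : Tendsto (fun k => Y (p (φ k))) atTop (𝓝 (Y p')) := (Y.continuous.tendsto _).comp hlp
  have hno : ∀ k, ∀ g ∈ P, Y g - Y (p (φ k)) ≤ 0 →
      σ (φ k) * (X g - X (p (φ k))) ≤ Y g - Y (p (φ k)) := by
    intro k g hg h1
    by_contra h2
    push Not at h2
    obtain ⟨s, hs, hm⟩ := reach_one hconv hc (hσ0 _) (hch (φ k)) hg h1 h2
    exact hfail _ s hs hm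
  have hbelow : ∀ g ∈ P, Y p' ≤ Y g := by
    intro g hg
    by_contra h
    push Not at h
    have e1 : Tendsto (fun k => Y g - Y (p (φ k))) atTop (𝓝 (Y g - Y p')) := hlY.const_sub _
    have e2 : Tendsto (fun k => σ (φ k) * (X g - X (p (φ k)))) atTop (𝓝 (0 * (X g - X p'))) :=
      hlσ.mul (hlX.const_sub _)
    rw [zero_mul] at e2
    have hneg : Y g - Y p' < 0 := by linarith
    obtain ⟨k, hk1, hk2⟩ := ((e1.eventually (gt_mem_nhds hneg)).and
      (e1.eventually_lt e2 hneg)).exists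
    exact absurd (hno k g hg hk1.le) (not_le.2 hk2)
  have e3 : Tendsto (fun k => X (p' + τ' • v) - X (p (φ k))) atTop
      (𝓝 (X (p' + τ' • v) - X p')) := hlX.const_sub _
  have hpos : 0 < X (p' + τ' • v) - X p' := by
    simpa [hc.Xv] using hch'.pos
  obtain ⟨k, hk⟩ := (e3.eventually (lt_mem_nhds hpos)).exists
  have hYq : Y (p' + τ' • v) = Y p' := by simp [hc.Yv]
  have h4 := hbelow _ (hch (φ k)).mem
  have h5 := hno k _ hch'.mem' (by rw [hYq]; linarith)
  have := mul_pos (hσ0 (φ k)) hk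
  rw [hYq] at h5
  linarith

theorem exists_reach_two (hP : IsCompact P) (hconv : Convex ℝ P) (hint : (interior P).Nonempty)
    (hc : Coords X Y v n) : ∃ ε > 0, ∀ σ : ℝ, 0 < σ → σ < ε → ∀ p τ,
      MaxChord P (v + σ • n) p τ → ∃ s : ℝ, 0 < s ∧ p + s • (v + ε • n) ∈ P := by
  by_contra hcon
  push Not at hcon
  choose σ hσ0 hσ1 p τ hch hfail using fun k : ℕ =>
    hcon (1 / ((k : ℝ) + 1)) (by positivity)
  set η : ℕ → ℝ := fun k => 1 / ((k : ℝ) + 1) with hη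
  have hη0 : ∀ k, 0 < η k := fun k => by simp only [hη]; positivity
  have hηl : Tendsto η atTop (𝓝 0) := tendsto_one_div_add_atTop_nhds_zero_nat
  have hσ : Tendsto σ atTop (𝓝 0) :=
    squeeze_zero (fun k => (hσ0 k).le) (fun k => (hσ1 k).le) hηl
  obtain ⟨φ, hφ, p', τ', hlp, hlτ, hch'⟩ := chord_limit hP hconv hint hc hσ hch
  have hlσ : Tendsto (fun k => σ (φ k)) atTop (𝓝 0) := hσ.comp hφ.tendsto_atTop
  have hlη : Tendsto (fun k => η (φ k)) atTop (𝓝 0) := hηl.comp hφ.tendsto_atTop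
  have hlX : Tendsto (fun k => X (p (φ k))) atTop (𝓝 (X p')) := (X.continuous.tendsto _).comp hlp
  have hlY : Tendsto (fun k => Y (p (φ k))) atTop (𝓝 (Y p')) := (Y.continuous.tendsto _).comp hlp
  have hno : ∀ k, ∀ g ∈ P, η (φ k) * (X g - X (p (φ k))) ≤ Y g - Y (p (φ k)) →
      Y g - Y (p (φ k)) ≤ σ (φ k) * (X g - X (p (φ k))) := by
    intro k g hg h1
    by_contra h2
    push Not at h2
    obtain ⟨s, hs, hm⟩ := reach_two hconv hc (hσ1 _) (hch (φ k)) hg h1 h2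
    exact hfail _ s hs hm
  have habove : ∀ g ∈ P, Y g ≤ Y p' := by
    intro g hg
    by_contra h
    push Not at h
    have e1 : Tendsto (fun k => Y g - Y (p (φ k))) atTop (𝓝 (Y g - Y p')) := hlY.const_sub _
    have e2 : Tendsto (fun k => σ (φ k) * (X g - X (p (φ k)))) atTop (𝓝 (0 * (X g - X p'))) :=
      hlσ.mul (hlX.const_sub _)
    have e3 : Tendsto (fun k => η (φ k) * (X g - X (p (φ k)))) atTop (𝓝 (0 * (X g - X p'))) :=
      hlη.mul (hlX.const_sub _)
    rw [zero_mul] at e2 e3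
    have hneg : 0 < Y g - Y p' := by linarith
    obtain ⟨k, hk1, hk2⟩ := ((e3.eventually_lt e1 hneg).and
      (e2.eventually_lt e1 hneg)).exists
    exact absurd (hno k g hg hk1.le) (not_le.2 hk2)
  obtain ⟨o, ho, hoY⟩ : ∃ o ∈ P, Y o < Y p' := by
    obtain ⟨x0, l, D, hl, hD0, hx0, hD⟩ := exists_ball_diam hP hint
    by_contra hall
    push Not at hall
    have hn0 : n ≠ 0 := by
      rintro rfl
      have := hc.Yn
      simp at this
    have hnn : 0 < ‖n‖ := norm_pos_iff.2 hn0
    have hm : x0 - (l / ‖n‖) • n ∈ P := hx0 (by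
      rw [Metric.mem_closedBall, dist_eq_norm, sub_sub_cancel_left, norm_neg, norm_smul,
        Real.norm_of_nonneg (by positivity), div_mul_cancel₀ _ hnn.ne'])
    have h1 := hall _ hm
    have h2 := habove x0 (hx0 (Metric.mem_closedBall_self hl.le))
    simp only [map_sub, map_smul, hc.Yn, smul_eq_mul, mul_one] at h1
    have : 0 < l / ‖n‖ := by positivity
    linarith
  set q := p' + τ' • v with hq
  have hYq : Y q = Y p' := by simp [hq, hc.Yv]
  have hXq : X q = X p' + τ' := by simp [hq, hc.Xv]
  set h := Y p' - Y o with hh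
  have hh0 : 0 < h := by linarith
  have e1 : Tendsto (fun k => Y p' - Y (p (φ k))) atTop (𝓝 (Y p' - Y p')) := hlY.const_sub _
  rw [sub_self] at e1
  have e2 : Tendsto (fun k => η (φ k) * (|X o - X q| / h)) atTop (𝓝 (0 * (|X o - X q| / h))) :=
    hlη.mul_const _
  rw [zero_mul] at e2
  obtain ⟨k, hk1, hk2⟩ := ((e1.eventually (gt_mem_nhds hh0)).and
    (e2.eventually (gt_mem_nhds one_pos))).exists
  set pk := p (φ k) with hpk
  have hb : 0 < Y p' - Y pk := by
    have := habove _ (hch (φ k)).mem'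
    simp only [map_add, map_smul, hc.Yn, hc.Yv, smul_eq_mul, mul_one, zero_add] at this
    have h3 := mul_pos (hch (φ k)).pos (hσ0 (φ k))
    linarith
  have hfp := hno k p' hch'.mem
  have ha : 0 < X p' - X pk := by
    by_contra hneg
    push Not at hneg
    have h1 : η (φ k) * (X p' - X pk) ≤ 0 := mul_nonpos_of_nonneg_of_nonpos (hη0 _).le hneg
    have h2 : σ (φ k) * (X p' - X pk) ≤ 0 := mul_nonpos_of_nonneg_of_nonpos (hσ0 _).le hneg
    have := hfp (by linarith)
    linarith
  have hba : Y p' - Y pk < η (φ k) * (X p' - X pk) := by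
    by_contra hge
    push Not at hge
    have h1 := hfp hge
    have h2 : σ (φ k) * (X p' - X pk) < η (φ k) * (X p' - X pk) :=
      mul_lt_mul_of_pos_right (hσ1 _) ha
    linarith
  set lam := (Y p' - Y pk) / h with hlam
  have hlam0 : 0 < lam := by positivity
  have hlam1 : lam ≤ 1 := by rw [hlam, div_le_one hh0]; exact hk1.le
  have hq' : (1 - lam) • q + lam • o ∈ P :=
    hconv hch'.mem' ho (by linarith) hlam0.le (by ring)
  have hlamh : lam * h = Y p' - Y pk := by rw [hlam]; field_simp
  have heq : (1 - lam) • q + lam • o = pk + (τ' + (X p' - X pk) + lam * (X o - X q)) • v := by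
    refine hc.ext_iff' ?_ ?_
    · simp only [map_add, map_smul, hc.Xv, smul_eq_mul, hXq]
      ring
    · simp only [map_add, map_smul, hc.Yv, smul_eq_mul, hYq, mul_zero, add_zero]
      have : lam * (Y p' - Y o) = Y p' - Y pk := hlamh
      linarith
  rw [heq] at hq'
  have hmx := hch'.max _ (hch (φ k)).mem _ hq'
  have h6 : X p' - X pk ≤ lam * |X o - X q| := by
    have : -(lam * (X o - X q)) ≤ lam * |X o - X q| := by
      rw [← mul_neg]
      exact mul_le_mul_of_nonneg_left (neg_le_abs _) hlam0.le
    linarith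
  have h7 : lam * |X o - X q| = (Y p' - Y pk) * (|X o - X q| / h) := by
    rw [hlam]; ring
  have h8 : (Y p' - Y pk) * (|X o - X q| / h) ≤
      η (φ k) * (X p' - X pk) * (|X o - X q| / h) :=
    mul_le_mul_of_nonneg_right hba.le (by positivity)
  have h9 : (η (φ k) * (|X o - X q| / h)) * (X p' - X pk) < 1 * (X p' - X pk) :=
    mul_lt_mul_of_pos_right hk2 ha
  linarith

theorem interior_of_reach (hconv : Convex ℝ P) (hc : Coords X Y v n)
    {p : EuclideanSpace ℝ (Fin d)} {s s' ε : ℝ} (hp : p ∈ P) (hε : 0 < ε) (hs : 0 < s)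
    (hs' : 0 < s') (h1 : p + s • v ∈ P) (h2 : p + s' • (v + ε • n) ∈ P) :
    ∀ᶠ y in 𝓝 (0 : EuclideanSpace ℝ (Fin d)), 0 < Y y → Y y < ε * X y → p + y ∈ interior P := by
  have hcont : Continuous (fun y : EuclideanSpace ℝ (Fin d) =>
    (X y - Y y / ε) / s + Y y / (ε * s')) := by fun_prop
  have hev : ∀ᶠ y in 𝓝 (0 : EuclideanSpace ℝ (Fin d)),
      (X y - Y y / ε) / s + Y y / (ε * s') < 1 := by
    have := hcont.tendsto 0
    simp only [map_zero, zero_div, sub_zero, add_zero] at this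
    exact this.eventually (gt_mem_nhds one_pos)
  filter_upwards [hev] with y hy hY hYX
  rw [mem_interior]
  refine ⟨{w | 0 < Y (w - p) ∧ Y (w - p) < ε * X (w - p) ∧
    (X (w - p) - Y (w - p) / ε) / s + Y (w - p) / (ε * s') < 1}, ?_, ?_, ?_⟩
  · rintro w ⟨hw1, hw2, hw3⟩
    set y := w - p with hyd
    have hα : 0 ≤ (X y - Y y / ε) / s := by
      refine div_nonneg ?_ hs.le
      rw [sub_nonneg, div_le_iff₀ hε]
      linarith
    have hβ : 0 ≤ Y y / (ε * s') := by positivity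
    have hm := convex_three hconv hp h1 h2 (α := 1 - ((X y - Y y / ε) / s + Y y / (ε * s')))
      (by linarith) hα hβ (by ring)
    convert hm using 1
    have hw : w = p + y := by rw [hyd]; abel
    rw [hw]
    refine hc.ext_iff' ?_ ?_
    · simp only [map_add, map_smul, hc.Xv, hc.Yv, hc.Xn, hc.Yn, smul_eq_mul]
      field_simp
      ring
    · simp only [map_add, map_smul, hc.Xv, hc.Yv, hc.Xn, hc.Yn, smul_eq_mul]
      field_simp
      ring
  · have o1 : IsOpen {w | 0 < Y (w - p)} := isOpen_lt (by fun_prop) (by fun_prop)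
    have o2 : IsOpen {w | Y (w - p) < ε * X (w - p)} := isOpen_lt (by fun_prop) (by fun_prop)
    have o3 : IsOpen {w | (X (w - p) - Y (w - p) / ε) / s + Y (w - p) / (ε * s') < 1} :=
      isOpen_lt (by fun_prop) (by fun_prop)
    exact o1.and (o2.and o3)
  · simpa using ⟨hY, hYX, hy⟩

theorem cone_half (hP : IsCompact P) (hconv : Convex ℝ P) (hint : (interior P).Nonempty)
    (hc : Coords X Y v n) : ∃ ε > 0, ∀ σ : ℝ, 0 < σ → σ < ε → ∀ p τ,
      MaxChord P (v + σ • n) p τ → ∀ᶠ y in 𝓝 (0 : EuclideanSpace ℝ (Fin d)),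
        0 < Y y → Y y < ε * X y → p + y ∈ interior P := by
  obtain ⟨ε1, hε1, h1⟩ := exists_reach_one hP hconv hint hc
  obtain ⟨ε2, hε2, h2⟩ := exists_reach_two hP hconv hint hc
  refine ⟨min ε1 ε2, lt_min hε1 hε2, fun σ hσ hσε p τ hch => ?_⟩
  obtain ⟨s, hs, hsm⟩ := h1 σ hσ (hσε.trans_le (min_le_left _ _)) p τ hch
  obtain ⟨s', hs', hsm'⟩ := h2 σ hσ (hσε.trans_le (min_le_right _ _)) p τ hch
  filter_upwards [interior_of_reach hconv hc hch.mem hε2 hs hs' hsm hsm'] with y hy hY hYX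
  have hX : 0 < X y := by
    have h0 : 0 < min ε1 ε2 := lt_min hε1 hε2
    by_contra hX
    push Not at hX
    have := mul_nonpos_of_nonneg_of_nonpos h0.le hX
    linarith
  refine hy hY (hYX.trans_le ?_)
  exact mul_le_mul_of_nonneg_right (min_le_right _ _) hX.le

theorem exists_goodCone_up (hP : IsCompact P) (hconv : Convex ℝ P)
    (hint : (interior P).Nonempty) (hc : Coords X Y v n) :
    ∃ ε > 0, GoodCone P {c | 0 < Y c ∧ Y c < ε * X c} := by
  have hnP : IsCompact (-P) := hP.neg
  have hnint : (interior (-P)).Nonempty := by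
    obtain ⟨o, ho⟩ := hint
    refine ⟨-o, preimage_interior_subset_interior_preimage continuous_neg ?_⟩
    simpa using ho
  obtain ⟨ε1, hε1, h1⟩ := cone_half hP hconv hint hc
  obtain ⟨ε2, hε2, h2⟩ := cone_half hnP hconv.neg hnint hc
  have h0 : 0 < min ε1 ε2 := lt_min hε1 hε2
  have hXpos : ∀ y, 0 < Y y → Y y < min ε1 ε2 * X y → 0 < X y := by
    intro y hY hYX
    by_contra hX
    push Not at hX
    have := mul_nonpos_of_nonneg_of_nonpos h0.le hX
    linarith
  obtain ⟨x0, l, D, hl, hD0, hx0, hD⟩ := exists_ball_diam hP hint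
  refine ⟨min ε1 ε2, h0, ?_, ?_, ?_, ?_⟩
  · have o1 : IsOpen {c | 0 < Y c} := isOpen_lt (by fun_prop) (by fun_prop)
    have o2 : IsOpen {c | Y c < min ε1 ε2 * X c} := isOpen_lt (by fun_prop) (by fun_prop)
    exact o1.and o2
  · rintro c ⟨hc1, hc2⟩ t ht
    refine ⟨by simpa using mul_pos ht hc1, ?_⟩
    simp only [map_smul, smul_eq_mul]
    nlinarith
  · simp
  · rintro c ⟨hc1, hc2⟩
    have hX := hXpos c hc1 hc2
    have hc0 : c ≠ 0 := by
      rintro rfl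
      simp at hX
    obtain ⟨p, τ, hτ, hp, hq, hmax⟩ := exists_maxChord hP hl hx0 hc0
    set σ := Y c / X c with hσ
    have hσ0 : 0 < σ := by positivity
    have hσ1 : σ < min ε1 ε2 := by rw [hσ, div_lt_iff₀ hX]; exact hc2
    have hce : c = X c • (v + σ • n) := by
      conv_lhs => rw [hc.eq c]
      rw [smul_add, smul_smul, hσ, mul_div_cancel₀ _ hX.ne']
    have hsc : ∀ s : ℝ, s • (v + σ • n) = (s / X c) • c := by
      intro s
      have h9 : (s / X c) • c = (s / X c) • (X c • (v + σ • n)) := congrArg _ hce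
      rw [h9, smul_smul, div_mul_cancel₀ _ hX.ne']
    have hτe : (τ * X c) • (v + σ • n) = τ • c := by
      rw [hsc, mul_div_cancel_right₀ _ hX.ne']
    have hmx : ∀ a ∈ P, ∀ s : ℝ, a + s • (v + σ • n) ∈ P → s ≤ τ * X c := by
      intro a ha s hs
      rw [hsc] at hs
      have := hmax a ha _ hs
      rwa [div_le_iff₀ hX] at this
    have hch : MaxChord P (v + σ • n) p (τ * X c) :=
      ⟨by positivity, hp, by rw [hτe]; exact hq, hmx⟩
    have hch' : MaxChord (-P) (v + σ • n) (-(p + τ • c)) (τ * X c) := by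
      refine ⟨by positivity, by simpa using hq, ?_, ?_⟩
      · rw [hτe]
        simpa using hp
      · intro a ha s hs
        refine hmx (-(a + s • (v + σ • n))) hs s ?_
        rw [neg_add, neg_add_cancel_right]
        exact ha
    refine ⟨p, τ, hτ, hp, hq, hmax, ?_⟩
    filter_upwards [h1 σ hσ0 (hσ1.trans_le (min_le_left _ _)) _ _ hch,
      h2 σ hσ0 (hσ1.trans_le (min_le_right _ _)) _ _ hch'] with y hy1 hy2 hy
    have hXy := hXpos y hy.1 hy.2
    constructor
    · exact hy1 hy.1 (hy.2.trans_le (mul_le_mul_of_nonneg_right (min_le_left _ _) hXy.le))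
    · have h3 := hy2 hy.1 (hy.2.trans_le (mul_le_mul_of_nonneg_right (min_le_right _ _) hXy.le))
      have h4 : p + τ • c - y ∈ (fun w : EuclideanSpace ℝ (Fin d) => -w) ⁻¹' interior (-P) := by
        rw [mem_preimage]
        convert h3 using 1
        abel
      have h5 := preimage_interior_subset_interior_preimage continuous_neg h4
      have h6 : (fun w : EuclideanSpace ℝ (Fin d) => -w) ⁻¹' (-P) = P := by
        ext w; simp
      rwa [h6] at h5

end planar

theorem exists_coords (v : EuclideanSpace ℝ (Fin 2)) (hv : ‖v‖ = 1) :
    ∃ X Y n, Coords X Y v n := by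
  have hv2 : v 0 ^ 2 + v 1 ^ 2 = 1 := by
    have := EuclideanSpace.norm_sq_eq v
    rw [hv, Fin.sum_univ_two] at this
    simpa using this.symm
  set n : EuclideanSpace ℝ (Fin 2) := !₂[-v 1, v 0] with hn
  have hX : ∀ z, innerSL ℝ v z = v 0 * z 0 + v 1 * z 1 := fun z => by
    simp [PiLp.inner_apply, Fin.sum_univ_two, mul_comm]
  have hY : ∀ z, innerSL ℝ n z = -v 1 * z 0 + v 0 * z 1 := fun z => by
    simp [PiLp.inner_apply, Fin.sum_univ_two, mul_comm, hn]
  refine ⟨innerSL ℝ v, innerSL ℝ n, n, ?_, ?_, ?_, ?_, ?_⟩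
  · intro z
    rw [hX, hY]
    ext i
    fin_cases i
    · simp [hn]
      linear_combination (-z 0) * hv2
    · simp [hn]
      linear_combination (-z 1) * hv2
  · rw [hX]; linarith
  · rw [hY]; ring
  · rw [hX]; simp [hn]; ring
  · rw [hY]; simp [hn]; linarith

theorem Coords.neg {d : ℕ} {X Y : EuclideanSpace ℝ (Fin d) →L[ℝ] ℝ}
    {v n : EuclideanSpace ℝ (Fin d)} (hc : Coords X Y v n) : Coords X (-Y) v (-n) :=
  ⟨fun z => by simpa using hc.eq z, hc.Xv, by simp [hc.Yv], by simp [hc.Xn], by simp [hc.Yn]⟩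

theorem exists_subset_derivP_planar {P F : Set (EuclideanSpace ℝ (Fin 2))}
    (hP : IsCompact P) (hconv : Convex ℝ P) (hint : (interior P).Nonempty) (hF : Perfect F)
    (hne : F.Nonempty) : ∃ K ⊆ F, K.Nonempty ∧ K ⊆ derivP P K := by
  refine exists_subset_derivP_of_cover hP hconv hint hF hne fun v hv => ?_
  obtain ⟨X, Y, n, hc⟩ := exists_coords v hv
  obtain ⟨ε1, hε1, h1⟩ := exists_goodCone_up hP hconv hint hc
  obtain ⟨ε2, hε2, h2⟩ := exists_goodCone_up hP hconv hint hc.neg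
  refine ⟨{c | Y c < ε1 * X c ∧ (-Y) c < ε2 * X c}, ?_, _, _, h1, h2, ?_⟩
  · have o1 : IsOpen {c | Y c < ε1 * X c} := isOpen_lt (by fun_prop) (by fun_prop)
    have o2 : IsOpen {c | (-Y) c < ε2 * X c} := isOpen_lt (by fun_prop) (by fun_prop)
    refine IsOpen.mem_nhds (o1.and o2) ?_
    simp [hc.Xv, hc.Yv, hε1, hε2]
  · rintro c ⟨hc1, hc2⟩
    rcases lt_trichotomy (Y c) 0 with h | h | h
    · right; left
      exact ⟨by simpa using h, hc2⟩
    · right; right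
      refine ⟨X c, ?_⟩
      conv_lhs => rw [hc.eq c]
      simp [h]
    · left
      exact ⟨h, hc1⟩

/-- **Theorem.** Let `P ⊆ ℝ^d` be compact and convex, and assume that either `P` is strictly
convex and nondegenerate, or `P` is a convex `d`-polytope, or `d = 2` and `P` has nonempty
interior.  If `A ⊆ ℝ^d` contains a perfect set, then `A^∞_P ≠ ∅`, equivalently
`A^α_P ≠ ∅` for every ordinal `α`. -/
theorem derivIter_nonempty_of_containsPerfectSet (d : ℕ)
    (P : Set (EuclideanSpace ℝ (Fin d))) (hPcomp : IsCompact P) (hPconv : Convex ℝ P)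
    (hP : (StrictConvex ℝ P ∧ P.Nontrivial) ∨ IsPolytope d P ∨
      (d = 2 ∧ (interior P).Nonempty))
    (A : Set (EuclideanSpace ℝ (Fin d))) (hA : ContainsPerfectSet A) :
    ∀ α : Ordinal.{0}, (derivIterP P A α).Nonempty := by
  obtain ⟨F, hFA, hF, hne⟩ := hA
  have key : ∃ K ⊆ F, K.Nonempty ∧ K ⊆ derivP P K := by
    rcases hP with ⟨hs, hn⟩ | hpoly | ⟨rfl, hint⟩
    · exact exists_subset_derivP_strict hPcomp hs hn hF hne
    · exact ⟨F, Subset.rfl, hne, subset_derivP_polytope hpoly hF⟩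
    · exact exists_subset_derivP_planar hPcomp hPconv hint hF hne
  obtain ⟨K, hKF, hKne, hK⟩ := key
  intro α
  exact hKne.mono (subset_derivIterP (hKF.trans hFA) hK α)
end

section
/- Let P ⊆ ℝ^d be compact and convex, and assume that either P is strictly convex and nondegenerate, or P is a convex d-polytope, or d = 2 and P has nonempty interior. Let A ⊆ ℝ^d be a closed set. Then: (1) if A^∞_P ≠ ∅, player I has a winning strategy in the no-β McMullen game G_P(A); (2) if A^∞_P = ∅, player II has a winning strategy in G_P(A). -/
open Pointwise Filter Topology Set

/-- The set played by the move `c = (x, ρ)`: the translated scaled copy `x + ρ • P` of `P`. -/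
def copySet {X : Type*} [AddCommGroup X] [Module ℝ X] (P : Set X) (c : X × ℝ) : Set X :=
  c.1 +ᵥ c.2 • P

/-- The rule that the `n`-th move of the run `m` must obey in the no-β McMullen game:
every scaling factor is positive; player II's scaling factor is strictly smaller than that of
player I's preceding move; and each of player I's moves after the first is contained in his
previous move with player II's intervening move removed. -/
def Rule {X : Type*} [AddCommGroup X] [Module ℝ X] (P : Set X) (m : ℕ → X × ℝ) (n : ℕ) : Prop :=
  0 < (m n).2 ∧
    (if n % 2 = 1 then (m n).2 < (m (n - 1)).2
     else n ≠ 0 → copySet P (m n) ⊆ copySet P (m (n - 2)) \ copySet P (m (n - 1)))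

/-- A strategy: a function assigning a next move to each finite position. -/
abbrev Strategy (X : Type*) := List (X × ℝ) → X × ℝ

/-- The run `m` is one in which player I follows the strategy `σ` (player I moves at the
even rounds). -/
def FollowsI {X : Type*} (σ : Strategy X) (m : ℕ → X × ℝ) : Prop :=
  ∀ n, m (2 * n) = σ (List.ofFn fun i : Fin (2 * n) => m i)

/-- The run `m` is one in which player II follows the strategy `σ` (player II moves at the
odd rounds). -/
def FollowsII {X : Type*} (σ : Strategy X) (m : ℕ → X × ℝ) : Prop :=
  ∀ n, m (2 * n + 1) = σ (List.ofFn fun i : Fin (2 * n + 1) => m i)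

/-- `σ` is a winning strategy for player I in the no-β McMullen game `G_P(A)`:
in every run in which player I follows `σ`, player I is never the first to violate the rules,
and if the run obeys all the rules then `(⋂ n, P_{2n}) ∩ A ≠ ∅`. -/
def WinningI {X : Type*} [AddCommGroup X] [Module ℝ X] (P A : Set X) (σ : Strategy X) : Prop :=
  ∀ m : ℕ → X × ℝ, FollowsI σ m →
    (∀ n, (∀ k < 2 * n, Rule P m k) → Rule P m (2 * n)) ∧
    ((∀ n, Rule P m n) → ((⋂ n, copySet P (m (2 * n))) ∩ A).Nonempty)

/-- `σ` is a winning strategy for player II in the no-β McMullen game `G_P(A)`: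
in every run in which player II follows `σ`, player II is never the first to violate the rules,
and if the run obeys all the rules then `(⋂ n, P_{2n}) ∩ A = ∅`. -/
def WinningII {X : Type*} [AddCommGroup X] [Module ℝ X] (P A : Set X) (σ : Strategy X) : Prop :=
  ∀ m : ℕ → X × ℝ, FollowsII σ m →
    (∀ n, (∀ k < 2 * n + 1, Rule P m k) → Rule P m (2 * n + 1)) ∧
    ((∀ n, Rule P m n) → (⋂ n, copySet P (m (2 * n))) ∩ A = ∅)

open RealInnerProductSpace

abbrev Eu (d : ℕ) := EuclideanSpace ℝ (Fin d)

def PCN {d : ℕ} (K : Set (Eu d)) : Prop := IsCompact K ∧ Preperfect K ∧ K.Nonempty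

def NormAt {d : ℕ} (Q : Set (Eu d)) (w n : Eu d) : Prop := ∀ q ∈ Q, ⟪n, q⟫ ≤ ⟪n, w⟫

def MinC {d : ℕ} (P K : Set (Eu d)) (c : Eu d × ℝ) : Prop :=
  0 < c.2 ∧ K ⊆ copySet P c ∧ ∀ c' : Eu d × ℝ, 0 < c'.2 → c'.2 < c.2 → ¬ K ⊆ copySet P c'

def Typ {d : ℕ} (P K : Set (Eu d)) (c : Eu d × ℝ) (J : Set (Eu d)) : Prop :=
  MinC P K c ∧ (∀ a ∈ J, a ≠ 0 ∧ ∀ w ∈ K, NormAt (copySet P c) w a) ∧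
  K ⊆ closure {w | w ∈ K ∧ ∃ r > 0, ∀ x ∈ Metric.ball w r,
    (∀ a ∈ J, ⟪a, x⟫ ≤ ⟪a, w⟫) → x ∈ copySet P c}

theorem mem_cpy {d : ℕ} {P : Set (Eu d)} {c : Eu d × ℝ} {z : Eu d} :
    z ∈ copySet P c ↔ ∃ p ∈ P, c.1 + c.2 • p = z := by
  unfold copySet
  simp [Set.mem_vadd_set, Set.mem_smul_set]

theorem copy_compact {d : ℕ} {P : Set (Eu d)} (hP : IsCompact P) (c : Eu d × ℝ) :
    IsCompact (copySet P c) := by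
  have : copySet P c = (fun p => c.1 + c.2 • p) '' P := by
    ext z; rw [mem_cpy]; rfl
  rw [this]
  exact hP.image (by fun_prop)

theorem copy_convex {d : ℕ} {P : Set (Eu d)} (hP : Convex ℝ P) (c : Eu d × ℝ) :
    Convex ℝ (copySet P c) := by
  unfold copySet
  exact (hP.smul _).vadd _

theorem pcn_shrink {d : ℕ} {K U : Set (Eu d)} (hK : PCN K) (hU : IsOpen U)
    (h : (K ∩ U).Nonempty) : PCN (closure (K ∩ U)) ∧ closure (K ∩ U) ⊆ K := by
  have h2 : closure (K ∩ U) ⊆ K := closure_minimal inter_subset_left hK.1.isClosed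
  refine ⟨⟨hK.1.of_isClosed_subset isClosed_closure h2, ?_, h.closure⟩, h2⟩
  have : Preperfect (U ∩ K) := hK.2.1.open_inter hU
  rw [inter_comm]
  exact this.perfect_closure.acc

/-- Shrink into a ball. -/
theorem pcn_ball {d : ℕ} {K : Set (Eu d)} (hK : PCN K) {w : Eu d} (hw : w ∈ K) {r : ℝ}
    (hr : 0 < r) : ∃ K' ⊆ K, PCN K' ∧ K' ⊆ Metric.ball w r := by
  have h := pcn_shrink hK (Metric.isOpen_ball (x := w) (ε := r / 2))
    ⟨w, hw, Metric.mem_ball_self (by positivity)⟩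
  refine ⟨_, h.2, h.1, ?_⟩
  refine (closure_mono inter_subset_right).trans ?_
  exact Metric.closure_ball_subset_closedBall.trans (Metric.closedBall_subset_ball (by linarith))

theorem baire_piece {d : ℕ} {K : Set (Eu d)} (hK : PCN K) {ι : Type*} [Countable ι]
    (C : ι → Set (Eu d)) (hC : ∀ i, IsClosed (C i)) (hcov : K ⊆ ⋃ i, C i) :
    ∃ i, ∃ K' ⊆ K, PCN K' ∧ K' ⊆ C i := by
  have : CompactSpace K := isCompact_iff_compactSpace.1 hK.1
  have : Nonempty K := hK.2.2.to_subtype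
  obtain ⟨i, x, hx⟩ := nonempty_interior_of_iUnion_of_closed
    (f := fun i => ((↑) : K → Eu d) ⁻¹' (C i)) (fun i => (hC i).preimage continuous_subtype_val)
    (by
      ext x; simp only [mem_iUnion, mem_preimage, mem_univ, iff_true]
      simpa using hcov x.2)
  rw [mem_interior] at hx
  obtain ⟨t, ht, hto, hxt⟩ := hx
  obtain ⟨V, hV, rfl⟩ := isOpen_induced_iff.1 hto
  have := pcn_shrink hK hV ⟨x, x.2, hxt⟩
  refine ⟨i, _, this.2, this.1, closure_minimal ?_ (hC i)⟩
  rintro y ⟨hy, hyV⟩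
  exact ht (show (⟨y, hy⟩ : K) ∈ _ from hyV)

/-- Dichotomy: a point set is dense in `K`, or a perfect piece avoids it. -/
theorem dense_or_piece {d : ℕ} {K S : Set (Eu d)} (h : ¬ K ⊆ closure (K ∩ S)) :
    ∃ U, IsOpen U ∧ (K ∩ U).Nonempty ∧ (K ∩ U) ∩ S = ∅ := by
  obtain ⟨x, hx, hxS⟩ := not_subset.1 h
  refine ⟨(closure (K ∩ S))ᶜ, isClosed_closure.isOpen_compl, ⟨x, hx, hxS⟩, ?_⟩
  ext y
  simp only [mem_inter_iff, mem_compl_iff, mem_empty_iff_false, iff_false]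
  rintro ⟨⟨h1, h2⟩, h3⟩
  exact h2 (subset_closure ⟨h1, h3⟩)

theorem saturate {d : ℕ} {ι : Type*} (s : Finset ι) (φ : ι → Set (Eu d) → Prop)
    (hφ : ∀ i K K', K' ⊆ K → φ i K → φ i K') {K : Set (Eu d)} (hK : PCN K) :
    ∃ K₀ ⊆ K, PCN K₀ ∧ ∀ i ∈ s, ∀ K₁ ⊆ K₀, PCN K₁ → φ i K₁ → φ i K₀ := by
  classical
  induction s using Finset.induction_on with
  | empty => exact ⟨K, subset_rfl, hK, by simp⟩
  | insert a s ha ih =>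
    obtain ⟨K₀, h0, hK0, h⟩ := ih
    by_cases hex : ∃ K₁ ⊆ K₀, PCN K₁ ∧ φ a K₁
    · obtain ⟨K₁, h1, hK1, hφ1⟩ := hex
      refine ⟨K₁, h1.trans h0, hK1, ?_⟩
      intro i hi K₂ h2 hK2 hφ2
      rcases Finset.mem_insert.1 hi with rfl | hi
      · exact hφ1
      · exact hφ _ _ _ h1 (h i hi K₂ (h2.trans h1) hK2 hφ2)
    · refine ⟨K₀, h0, hK0, ?_⟩
      intro i hi K₂ h2 hK2 hφ2
      rcases Finset.mem_insert.1 hi with rfl | hi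
      · exact absurd ⟨K₂, h2, hK2, hφ2⟩ hex
      · exact h i hi K₂ h2 hK2 hφ2

theorem pcn_nontrivial {d : ℕ} {K : Set (Eu d)} (hK : PCN K) : K.Nontrivial := by
  obtain ⟨x, hx⟩ := hK.2.2
  have := hK.2.1 x hx
  rw [accPt_iff_nhds] at this
  obtain ⟨y, hy, hne⟩ := this univ univ_mem
  exact ⟨x, hx, y, hy.2, hne.symm⟩

theorem pcn_limit {d : ℕ} {K : Set (Eu d)} (hK : PCN K) {x : Eu d} (hx : x ∈ K) :
    x ∈ closure (K \ {x}) := by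
  have := hK.2.1 x hx
  rwa [accPt_principal_iff_clusterPt, ← mem_closure_iff_clusterPt] at this

/-- A ball fits into a copy. -/
theorem ball_copy {d : ℕ} {P : Set (Eu d)} (hint : (interior P).Nonempty) :
    ∃ s > 0, ∀ (w : Eu d) (r : ℝ), 0 < r → ∃ x, Metric.closedBall w r ⊆ copySet P (x, r / s) := by
  obtain ⟨o, ho⟩ := hint
  obtain ⟨s, hs, hsub⟩ := Metric.nhds_basis_closedBall.mem_iff.1 (mem_interior_iff_mem_nhds.1 ho)
  refine ⟨s, hs, fun w r hr => ⟨w - (r / s) • o, fun z hz => ?_⟩⟩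
  rw [mem_cpy]
  refine ⟨o + (s / r) • (z - w), hsub ?_, ?_⟩
  · rw [mem_closedBall_iff_norm] at hz ⊢
    rw [add_sub_cancel_left, norm_smul, Real.norm_of_nonneg (by positivity)]
    calc s / r * ‖z - w‖ ≤ s / r * r := by gcongr
      _ = s := by field_simp
  · simp only [smul_add, smul_smul]
    have : r / s * (s / r) = 1 := by field_simp
    rw [this, one_smul]; abel

theorem exists_minC {d : ℕ} {P : Set (Eu d)} (hP : IsCompact P) (hint : (interior P).Nonempty)
    {K : Set (Eu d)} (hK : PCN K) : ∃ c, MinC P K c := by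
  obtain ⟨s, hs, hball⟩ := ball_copy hint
  obtain ⟨x₀, hx₀, y₀, hy₀, hne⟩ := pcn_nontrivial hK
  obtain ⟨R, hR, hKR⟩ := hK.1.isBounded.subset_closedBall_lt 0 0
  obtain ⟨x, hx⟩ := hball 0 R hR
  set M := R / s with hM
  have hMpos : 0 < M := by positivity
  let C : Eu d → Set (Eu d × ℝ) := fun z =>
    (fun q : Eu d × ℝ => (z - q.2 • q.1, q.2)) '' (P ×ˢ Icc 0 M)
  have hCc : ∀ z, IsCompact (C z) := fun z => (hP.prod isCompact_Icc).image (by fun_prop)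
  have hCm : ∀ z (c : Eu d × ℝ), c ∈ C z ↔ (0 ≤ c.2 ∧ c.2 ≤ M) ∧ z ∈ copySet P c := by
    intro z c
    rw [mem_cpy]
    constructor
    · rintro ⟨⟨p, t⟩, ⟨hp, ht⟩, rfl⟩
      exact ⟨ht, p, hp, by simp⟩
    · rintro ⟨h, p, hp, h2⟩
      refine ⟨⟨p, c.2⟩, ⟨hp, h⟩, ?_⟩
      ext1
      · simp [← h2]
      · rfl
  have hcomp : IsCompact (⋂ z ∈ K, C z) :=
    (hCc x₀).of_isClosed_subset (isClosed_biInter fun z _ => (hCc z).isClosed)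
      (biInter_subset_of_mem hx₀)
  have hne' : (⋂ z ∈ K, C z).Nonempty := by
    refine ⟨(x, M), mem_iInter₂.2 fun z hz => (hCm _ _).2 ⟨⟨hMpos.le, le_rfl⟩, hx (hKR hz)⟩⟩
  obtain ⟨c, hc, hmin⟩ := hcomp.exists_isMinOn hne' (f := Prod.snd) continuous_snd.continuousOn
  have hc' := fun z hz => (hCm z c).1 (mem_iInter₂.1 hc z hz)
  refine ⟨c, ?_, fun z hz => (hc' z hz).2, ?_⟩
  · refine lt_of_le_of_ne (hc' x₀ hx₀).1.1 fun h0 => hne ?_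
    obtain ⟨p, _, hp⟩ := mem_cpy.1 (hc' x₀ hx₀).2
    obtain ⟨q, _, hq⟩ := mem_cpy.1 (hc' y₀ hy₀).2
    rw [← hp, ← hq, ← h0]; simp
  · intro c' h0 hlt hsub
    have : c' ∈ ⋂ z ∈ K, C z := mem_iInter₂.2 fun z hz =>
      (hCm _ _).2 ⟨⟨h0.le, hlt.le.trans (hc' x₀ hx₀).1.2⟩, hsub hz⟩
    exact absurd (hmin this) (not_le.2 hlt)

theorem exists_normal {d : ℕ} {Q : Set (Eu d)} (hc : Convex ℝ Q)
    (hint : (interior Q).Nonempty) {w : Eu d} (hw : w ∉ interior Q) :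
    ∃ n : Eu d, ‖n‖ = 1 ∧ NormAt Q w n := by
  obtain ⟨f, hf⟩ := geometric_hahn_banach_open_point hc.interior isOpen_interior hw
  set a := (InnerProductSpace.toDual ℝ (Eu d)).symm f with ha
  have hfa : ∀ x, ⟪a, x⟫ = f x := fun x => InnerProductSpace.toDual_symm_apply
  have ha0 : a ≠ 0 := by
    rintro h
    obtain ⟨o, ho⟩ := hint
    have := hf o ho
    rw [← hfa, ← hfa, h] at this
    simp at this
  have hle : ∀ q ∈ Q, f q ≤ f w := by
    intro q hq
    have hq' : q ∈ closure (interior Q) := by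
      rw [hc.closure_interior_eq_closure_of_nonempty_interior hint]; exact subset_closure hq
    have : interior Q ⊆ {q | f q ≤ f w} := fun q hq => (hf q hq).le
    exact closure_minimal this (isClosed_le f.continuous continuous_const) hq'
  refine ⟨(‖a‖⁻¹) • a, ?_, ?_⟩
  · rw [norm_smul, norm_inv, norm_norm, inv_mul_cancel₀ (norm_ne_zero_iff.2 ha0)]
  · intro q hq
    rw [inner_smul_left, inner_smul_left, hfa, hfa]
    have := hle q hq
    simp only [conj_trivial]
    gcongr

theorem copy_interior {d : ℕ} {P : Set (Eu d)} (hint : (interior P).Nonempty) {c : Eu d × ℝ}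
    (hc : 0 < c.2) : (interior (copySet P c)).Nonempty := by
  unfold copySet
  rw [interior_vadd, interior_smul₀ hc.ne']
  exact (hint.smul_set).vadd_set

def Core {d : ℕ} (P : Set (Eu d)) : Prop :=
  ∀ K, PCN K → ∃ K₀ ⊆ K, PCN K₀ ∧ ∃ T : Set (Set (Eu d)), T.Finite ∧
    ∀ K₁ ⊆ K₀, PCN K₁ → ∃ K₂ ⊆ K₁, PCN K₂ ∧ ∃ c, ∃ J ∈ T, Typ P K₂ c J

theorem minC_small {d : ℕ} {P : Set (Eu d)} (hP : IsCompact P) (hint : (interior P).Nonempty) :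
    ∃ C > 0, ∀ (K : Set (Eu d)) (c : Eu d × ℝ) (w : Eu d) (r : ℝ), 0 < r → K.Nonempty →
      MinC P K c → K ⊆ Metric.ball w r → copySet P c ⊆ Metric.ball w (C * r) := by
  obtain ⟨s, hs, hball⟩ := ball_copy hint
  obtain ⟨D, hD, hPD⟩ : ∃ D > 0, ∀ p ∈ P, ∀ q ∈ P, dist p q ≤ D := by
    refine ⟨Metric.diam P + 1, by have := Metric.diam_nonneg (s := P); linarith, fun p hp q hq => ?_⟩
    have := Metric.dist_le_diam_of_mem hP.isBounded hp hq
    linarith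
  refine ⟨D / s + 1, by positivity, fun K c w r hr ⟨k, hk⟩ hmin hsub z hz => ?_⟩
  have hρ : c.2 ≤ r / s := by
    by_contra! hlt
    obtain ⟨x, hx⟩ := hball w r hr
    exact hmin.2.2 (x, r / s) (by positivity) hlt
      (hsub.trans (Metric.ball_subset_closedBall.trans hx))
  obtain ⟨p, hp, rfl⟩ := mem_cpy.1 hz
  obtain ⟨q, hq, h⟩ := mem_cpy.1 (hmin.2.1 hk)
  have h1 : dist k w < r := hsub hk
  have h2 : dist (c.1 + c.2 • p) k ≤ r / s * D := by
    rw [← h, dist_add_left, dist_smul₀, Real.norm_of_nonneg hmin.1.le]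
    have := hPD p hp q hq
    gcongr
  rw [Metric.mem_ball]
  calc dist (c.1 + c.2 • p) w ≤ dist (c.1 + c.2 • p) k + dist k w := dist_triangle _ _ _
    _ < r / s * D + r := by linarith
    _ = _ := by ring

theorem recurrent {d : ℕ} {P : Set (Eu d)} (hcore : Core P) {K : Set (Eu d)} (hK : PCN K) :
    ∃ J, ∃ K' ⊆ K, PCN K' ∧ ∀ K₁ ⊆ K', PCN K₁ → ∃ K₂ ⊆ K₁, PCN K₂ ∧ ∃ c, Typ P K₂ c J := by
  obtain ⟨K₀, h0, hK0, T, hT, h⟩ := hcore K hK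
  obtain ⟨K', h1, hK', hsat⟩ := saturate hT.toFinset
    (fun J K => ∀ K₂ ⊆ K, PCN K₂ → ∀ c, ¬ Typ P K₂ c J)
    (fun J K K' hs hφ K₂ h2 => hφ K₂ (h2.trans hs)) hK0
  obtain ⟨K₂, h2, hK2, c, J, hJ, hty⟩ := h K' h1 hK'
  refine ⟨J, K', h1.trans h0, hK', fun K₁ h3 hK1 => ?_⟩
  by_contra! hcon
  exact hsat J (by simpa using hJ) K₁ h3 hK1 hcon K₂ h2 hK2 c hty

theorem typ_step {d : ℕ} {P : Set (Eu d)} (hP : IsCompact P) (hint : (interior P).Nonempty)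
    {J K' : Set (Eu d)}
    (hrec : ∀ K₁ ⊆ K', PCN K₁ → ∃ K₂ ⊆ K₁, PCN K₂ ∧ ∃ c, Typ P K₂ c J)
    {K : Set (Eu d)} {c : Eu d × ℝ} (hK : PCN K) (hKK : K ⊆ K') (hty : Typ P K c J)
    {U : Set (Eu d)} (hU : IsOpen U) (hne : (K ∩ U).Nonempty) :
    ∃ K₂ ⊆ K, PCN K₂ ∧ ∃ c₂, Typ P K₂ c₂ J ∧ copySet P c₂ ⊆ copySet P c ∩ U := by
  obtain ⟨C, hC, hsmall⟩ := minC_small hP hint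
  obtain ⟨y, hy, hyU⟩ := hne
  obtain ⟨w, hwU, hw, r, hr, hloc⟩ := mem_closure_iff.1 (hty.2.2 hy) U hU hyU
  obtain ⟨r', hr', hball⟩ := Metric.isOpen_iff.1 hU w hwU
  set ε := min r r' / C with hε
  have hε0 : 0 < ε := by positivity
  obtain ⟨K₁, h1, hK1, hK1b⟩ := pcn_ball hK hw hε0
  obtain ⟨K₂, h2, hK2, c₂, hty2⟩ := hrec K₁ (h1.trans hKK) hK1
  have hsub := hsmall K₂ c₂ w ε hε0 hK2.2.2 hty2.1 (h2.trans hK1b)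
  have hCε : C * ε = min r r' := by rw [hε]; field_simp
  rw [hCε] at hsub
  refine ⟨K₂, h2.trans h1, hK2, c₂, hty2, fun x hx => ⟨hloc x ?_ ?_, hball ?_⟩⟩
  · exact Metric.ball_subset_ball (min_le_left _ _) (hsub hx)
  · intro a ha
    obtain ⟨w', hw'⟩ := hK2.2.2
    have e1 := (hty2.2.1 a ha).2 w' hw' x hx
    have e2 := (hty.2.1 a ha).2 w hw w' (hty.1.2.1 (h1 (h2 hw')))
    exact e1.trans e2
  · exact Metric.ball_subset_ball (min_le_right _ _) (hsub hx)

theorem winI_of_core {d : ℕ} {P : Set (Eu d)} (hP : IsCompact P) (hint : (interior P).Nonempty)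
    (hcore : Core P) {K A : Set (Eu d)} (hK : PCN K) (hKA : K ⊆ A) :
    ∃ σ, WinningI P A σ := by
  classical
  obtain ⟨J, K', hK'K, hK', hrec⟩ := recurrent hcore hK
  let S := {s : Set (Eu d) × (Eu d × ℝ) // PCN s.1 ∧ s.1 ⊆ K' ∧ Typ P s.1 s.2 J}
  obtain ⟨K₀, h0, hK0, c₀, hty0⟩ := hrec K' subset_rfl hK'
  let s₀ : S := ⟨(K₀, c₀), hK0, h0, hty0⟩
  have hstep : ∀ (s : S) (mv : Eu d × ℝ), ∃ s' : S, 0 < mv.2 → mv.2 < s.1.2.2 →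
      s'.1.1 ⊆ s.1.1 ∧ copySet P s'.1.2 ⊆ copySet P s.1.2 \ copySet P mv := by
    intro s mv
    by_cases hmv : 0 < mv.2 ∧ mv.2 < s.1.2.2
    · have hn := s.2.2.2.1.2.2 mv hmv.1 hmv.2
      obtain ⟨y, hy, hy'⟩ := not_subset.1 hn
      obtain ⟨K₂, h2, hK2, c₂, hty2, hsub⟩ := typ_step hP hint hrec s.2.1 s.2.2.1 s.2.2.2
        (copy_compact hP mv).isClosed.isOpen_compl ⟨y, hy, hy'⟩
      exact ⟨⟨(K₂, c₂), hK2, h2.trans s.2.2.1, hty2⟩, fun _ _ => ⟨h2, hsub⟩⟩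
    · exact ⟨s, fun h1 h2 => absurd ⟨h1, h2⟩ hmv⟩
  choose f hf using hstep
  let step : S × Bool → Eu d × ℝ → S × Bool := fun q mv =>
    if q.2 then (f q.1 mv, false) else (q.1, true)
  let σ : Strategy (Eu d) := fun l => (l.foldl step (s₀, false)).1.1.2
  refine ⟨σ, fun m hm => ?_⟩
  let g : ℕ → S × Bool := fun n => (List.ofFn fun i : Fin n => m i).foldl step (s₀, false)
  have hg : ∀ n, g (n + 1) = step (g n) (m n) := by
    intro n
    simp only [g]
    rw [List.ofFn_succ', List.concat_eq_append, List.foldl_append]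
    simp
  have hb : ∀ n, (g (2 * n)).2 = false := by
    intro n
    induction n with
    | zero => simp [g]
    | succ n ih =>
      rw [show 2 * (n + 1) = 2 * n + 1 + 1 by ring, hg, hg]
      simp [step, ih]
  let st : ℕ → S := fun n => (g (2 * n)).1
  have hst : ∀ n, st (n + 1) = f (st n) (m (2 * n + 1)) := by
    intro n
    simp only [st]
    rw [show 2 * (n + 1) = 2 * n + 1 + 1 by ring, hg, hg]
    simp [step, hb n]
  have hmst : ∀ n, m (2 * n) = (st n).1.2 := fun n => hm n
  have hnext : ∀ n, Rule P m (2 * n + 1) → (st (n + 1)).1.1 ⊆ (st n).1.1 ∧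
      copySet P (m (2 * (n + 1))) ⊆ copySet P (m (2 * n)) \ copySet P (m (2 * n + 1)) := by
    intro n hr
    have h1 := hr.1
    have h2 := hr.2
    rw [if_pos (by omega), show 2 * n + 1 - 1 = 2 * n by omega, hmst n] at h2
    rw [hmst (n + 1), hst, hmst n]
    exact hf _ _ h1 h2
  refine ⟨fun n hn => ⟨?_, ?_⟩, fun hall => ?_⟩
  · rw [hmst]; exact (st n).2.2.2.1.1
  · rw [if_neg (by omega)]
    intro hn0
    obtain ⟨k, rfl⟩ : ∃ k, n = k + 1 := ⟨n - 1, by omega⟩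
    have := (hnext k (hn _ (by omega))).2
    rwa [show 2 * (k + 1) - 2 = 2 * k by omega, show 2 * (k + 1) - 1 = 2 * k + 1 by omega]
  · have hne := IsCompact.nonempty_iInter_of_sequence_nonempty_isCompact_isClosed
      (fun n => (st n).1.1) (fun n => (hnext n (hall _)).1) (fun n => (st n).2.1.2.2)
      (st 0).2.1.1 (fun n => (st n).2.1.1.isClosed)
    obtain ⟨y, hy⟩ := hne
    rw [mem_iInter] at hy
    refine ⟨y, mem_iInter.2 fun n => ?_, hKA (hK'K ((st 0).2.2.1 (hy 0)))⟩
    rw [hmst]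
    exact (st n).2.2.2.1.2.1 (hy n)

theorem winII_of_countable {d : ℕ} {P A : Set (Eu d)} (hne : P.Nonempty) (hA : A.Countable) :
    ∃ σ, WinningII P A σ := by
  obtain ⟨p, hp⟩ := hne
  obtain ⟨a, ha⟩ : ∃ a : ℕ → Eu d, A ⊆ range a := by
    rcases A.eq_empty_or_nonempty with rfl | h
    · exact ⟨fun _ => 0, by simp⟩
    · obtain ⟨a, ha⟩ := hA.exists_eq_range h
      exact ⟨a, ha.subset⟩
  let σ : Strategy (Eu d) := fun l =>
    let ρ := (l.getLast?.getD (0, 0)).2 / 2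
    (a (l.length / 2) - ρ • p, ρ)
  refine ⟨σ, fun m hm => ?_⟩
  have hm' : ∀ n, m (2 * n + 1) = (a n - ((m (2 * n)).2 / 2) • p, (m (2 * n)).2 / 2) := by
    intro n
    rw [hm n]
    simp only [σ]
    rw [List.length_ofFn, show (2 * n + 1) / 2 = n by omega]
    rw [List.ofFn_succ', List.concat_eq_append]
    simp
  refine ⟨fun n hn => ?_, fun hall => ?_⟩
  · have := (hn (2 * n) (by omega)).1
    refine ⟨?_, ?_⟩
    · rw [hm']; simpa using this
    · rw [if_pos (by omega), hm']
      simp only [Nat.add_sub_cancel]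
      linarith
  · ext y
    simp only [mem_inter_iff, mem_iInter, mem_empty_iff_false, iff_false]
    rintro ⟨h1, h2⟩
    obtain ⟨n, rfl⟩ := ha h2
    have h3 := (hall (2 * (n + 1))).2
    rw [if_neg (by omega), show 2 * (n + 1) - 1 = 2 * n + 1 by omega] at h3
    refine (h3 (by omega) (h1 (n + 1))).2 ?_
    rw [mem_cpy, hm']
    exact ⟨p, hp, by simp⟩

theorem not_interior_of_norm {d : ℕ} {Q : Set (Eu d)} {z a : Eu d} (ha : a ≠ 0)
    (h : NormAt Q z a) : z ∉ interior Q := by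
  intro hz
  obtain ⟨r, hr, hb⟩ := Metric.isOpen_iff.1 isOpen_interior z hz
  have hpos : 0 < ‖a‖ := norm_pos_iff.2 ha
  have hmem : z + (r / (2 * ‖a‖)) • a ∈ Metric.ball z r := by
    rw [mem_ball_iff_norm, add_sub_cancel_left, norm_smul, Real.norm_of_nonneg (by positivity)]
    have : r / (2 * ‖a‖) * ‖a‖ = r / 2 := by field_simp
    rw [this]; linarith
  have := h _ (interior_subset (hb hmem))
  rw [inner_add_right, inner_smul_right, real_inner_self_eq_norm_sq] at this
  have h2 : 0 < r / (2 * ‖a‖) * ‖a‖ ^ 2 := by positivity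
  linarith

theorem mem_copy_interp {d : ℕ} {P : Set (Eu d)} (hP : Convex ℝ P) {c c' : Eu d × ℝ}
    (hc : 0 < c.2) (hc' : 0 < c'.2) {t : ℝ} (ht : 0 ≤ t) (ht1 : t ≤ 1) {z : Eu d}
    (h : z ∈ copySet P c) (h' : z ∈ copySet P c') : z ∈ copySet P (c + t • (c' - c)) := by
  obtain ⟨p, hp, e⟩ := mem_cpy.1 h
  obtain ⟨q, hq, e'⟩ := mem_cpy.1 h'
  have hρ : 0 < (1 - t) * c.2 + t * c'.2 := by
    rcases eq_or_lt_of_le ht with rfl | h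
    · simpa using hc
    · have := mul_pos h hc'
      have := mul_nonneg (sub_nonneg.2 ht1) hc.le
      linarith
  set ρ := (1 - t) * c.2 + t * c'.2 with hρd
  have h1 := mul_nonneg (sub_nonneg.2 ht1) hc.le
  have h2 := mul_nonneg ht hc'.le
  rw [mem_cpy]
  refine ⟨((1 - t) * c.2 / ρ) • p + (t * c'.2 / ρ) • q,
    hP hp hq (by positivity) (by positivity) (by rw [← add_div]; exact div_self hρ.ne'), ?_⟩
  have e2 : (c + t • (c' - c)).2 = ρ := by simp [hρd]; ring
  have e1 : (c + t • (c' - c)).1 = (1 - t) • c.1 + t • c'.1 := by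
    simp only [Prod.fst_add, Prod.smul_fst, Prod.fst_sub]; module
  rw [e2, e1, smul_add, smul_smul, smul_smul, mul_div_cancel₀ _ hρ.ne', mul_div_cancel₀ _ hρ.ne']
  have : z = (1 - t) • z + t • z := by module
  rw [this]
  nth_rw 1 [← e]
  rw [← e']
  module

theorem enlarge {d : ℕ} {P : Set (Eu d)} (hP : Convex ℝ P) (hint : (interior P).Nonempty)
    {c : Eu d × ℝ} (hc : 0 < c.2) {ρ : ℝ} (hρ : c.2 < ρ) :
    ∃ x, copySet P c ⊆ interior (copySet P (x, ρ)) := by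
  obtain ⟨o, ho⟩ := hint
  have hρ0 : 0 < ρ := hc.trans hρ
  refine ⟨c.1 - (ρ - c.2) • o, fun z hz => ?_⟩
  obtain ⟨p, hp, rfl⟩ := mem_cpy.1 hz
  unfold copySet
  rw [interior_vadd, interior_smul₀ hρ0.ne']
  refine Set.mem_vadd_set.2 ⟨ρ • (((ρ - c.2) / ρ) • o + (c.2 / ρ) • p), Set.smul_mem_smul_set ?_, ?_⟩
  · exact hP.combo_interior_self_mem_interior ho hp (by have := sub_pos.2 hρ; positivity)
      (by positivity) (by field_simp; ring)
  · simp only [vadd_eq_add, smul_add, smul_smul]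
    rw [mul_div_cancel₀ _ hρ0.ne', mul_div_cancel₀ _ hρ0.ne']
    abel

theorem boundary_min {d : ℕ} {P : Set (Eu d)} (hPc : IsCompact P) (hP : Convex ℝ P)
    (hint : (interior P).Nonempty) {K : Set (Eu d)} (hK : IsCompact K) {c c' : Eu d × ℝ}
    (hmin : MinC P K c) (hc' : 0 < c'.2) (hlt : c'.2 < c.2) :
    ¬ K ∩ frontier (copySet P c) ⊆ copySet P c' := by
  intro hsub
  obtain ⟨ρ, hρ1, hρ2⟩ := exists_between hlt
  obtain ⟨x, hx⟩ := enlarge hP hint hc' hρ1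
  set e : Eu d × ℝ := (x, ρ) with he
  have he0 : 0 < e.2 := hc'.trans hρ1
  have hL : IsCompact (K \ interior (copySet P e)) := hK.diff isOpen_interior
  let F : ℝ → Eu d → Eu d := fun t z => ((c + t • (e - c)).2)⁻¹ • (z - (c + t • (e - c)).1)
  have hev : ∀ᶠ t in 𝓝 (0 : ℝ), ∀ z ∈ K \ interior (copySet P e), F t z ∈ interior P := by
    apply hL.eventually_forall_of_forall_eventually
    rintro z ⟨hz, hze⟩
    have hzi : z ∈ interior (copySet P c) := by
      by_contra hcon
      exact hze (hx (hsub ⟨hz, subset_closure (hmin.2.1 hz), hcon⟩))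
    have hF0 : F 0 z ∈ interior P := by
      unfold copySet at hzi
      rw [interior_vadd, interior_smul₀ hmin.1.ne'] at hzi
      obtain ⟨y, ⟨p, hp, rfl⟩, rfl⟩ := hzi
      have : F 0 (c.1 + c.2 • p) = p := by
        simp only [F, zero_smul, add_zero, add_sub_cancel_left, smul_smul]
        rw [inv_mul_cancel₀ hmin.1.ne', one_smul]
      change F 0 (c.1 + c.2 • p) ∈ interior P
      rw [this]; exact hp
    have hcont : ContinuousAt (fun q : ℝ × Eu d => F q.1 q.2) (0, z) := by
      have h0 : ((c + (0 : ℝ) • (e - c)).2) ≠ 0 := by simpa using hmin.1.ne'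
      simp only [F]
      have hc1 : ContinuousAt (fun q : ℝ × Eu d => (c + q.1 • (e - c)).2) (0, z) :=
        Continuous.continuousAt (by fun_prop)
      have hc2 : ContinuousAt (fun q : ℝ × Eu d => q.2 - (c + q.1 • (e - c)).1) (0, z) :=
        Continuous.continuousAt (by fun_prop)
      exact ContinuousAt.smul (ContinuousAt.inv₀ hc1 h0) hc2
    exact hcont (isOpen_interior.mem_nhds hF0)
  have hev2 : ∀ᶠ t in 𝓝[>] (0 : ℝ), t < 1 := by
    exact (eventually_lt_nhds (by norm_num)).filter_mono nhdsWithin_le_nhds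
  obtain ⟨t, ⟨ht, ht1⟩, ht0⟩ := ((hev.filter_mono nhdsWithin_le_nhds).and hev2 |>.and
    self_mem_nhdsWithin).exists
  have ht0' : 0 < t := ht0
  have h2 : (c + t • (e - c)).2 = c.2 + t * (ρ - c.2) := by simp [he]
  have hpos : 0 < (c + t • (e - c)).2 := by
    rw [h2]
    have : e.2 = ρ := rfl
    rw [this] at he0
    nlinarith [hmin.1]
  refine hmin.2.2 (c + t • (e - c)) hpos ?_ fun z hz => ?_
  · rw [h2]; nlinarith
  · by_cases hze : z ∈ interior (copySet P e)
    · exact mem_copy_interp hP hmin.1 he0 ht0'.le ht1.le (hmin.2.1 hz) (interior_subset hze)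
    · rw [mem_cpy]
      refine ⟨F t z, interior_subset (ht z ⟨hz, hze⟩), ?_⟩
      simp only [F]
      rw [smul_smul, mul_inv_cancel₀ hpos.ne', one_smul]
      abel

theorem good_of_typ {d : ℕ} {P : Set (Eu d)} (hPc : IsCompact P) (hP : Convex ℝ P)
    (hint : (interior P).Nonempty) {K A J : Set (Eu d)} (hK : PCN K) {c : Eu d × ℝ}
    (hty : Typ P K c J) (hKA : K ⊆ A) : IsGoodCopy P A c.1 c.2 := by
  refine ⟨hty.1.1, ?_⟩
  rintro ⟨x', ρ', h0, hlt, hsub⟩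
  change _ ⊆ copySet P (x', ρ') at hsub
  have hcl : IsClosed (copySet P c) := (copy_compact hPc c).isClosed
  rcases J.eq_empty_or_nonempty with rfl | ⟨a, ha⟩
  · refine boundary_min hPc hP hint hK.1 hty.1 h0 hlt (Subset.trans ?_ hsub)
    rintro z ⟨hz, hzf⟩
    refine ⟨⟨hKA hz, hzf⟩, Or.inl ?_⟩
    have := hty.2.2 hz
    refine closure_mono ?_ this
    rintro w ⟨hw, r, hr, hloc⟩
    have hwi : w ∈ interior (copySet P c) :=
      mem_interior.2 ⟨Metric.ball w r, fun x hx => hloc x hx (by simp), Metric.isOpen_ball,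
        Metric.mem_ball_self hr⟩
    refine ⟨⟨hKA hw, hwi⟩, ?_⟩
    rintro rfl
    exact hzf.2 hwi
  · refine hty.1.2.2 (x', ρ') h0 hlt (Subset.trans ?_ hsub)
    have hfr : ∀ w ∈ K, w ∈ frontier (copySet P c) := fun w hw =>
      ⟨subset_closure (hty.1.2.1 hw),
        not_interior_of_norm (hty.2.1 a ha).1 ((hty.2.1 a ha).2 w hw)⟩
    intro z hz
    refine ⟨⟨hKA hz, hfr z hz⟩, Or.inr ⟨a, ⟪a, z⟫, ⟨(hty.2.1 a ha).1, ⟨z, hfr z hz, rfl⟩, ?_⟩, ?_⟩⟩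
    · exact (hty.2.1 a ha).2 z hz
    · refine closure_mono ?_ (pcn_limit hK hz)
      rintro w ⟨hw, hwz⟩
      refine ⟨⟨⟨hKA hw, hfr w hw⟩, ?_⟩, hwz⟩
      exact le_antisymm ((hty.2.1 a ha).2 z hz w (hty.1.2.1 hw))
        ((hty.2.1 a ha).2 w hw z (hty.1.2.1 hz))

theorem derivIter_zero {d : ℕ} (P A : Set (Eu d)) : derivIterP P A 0 = A := by
  unfold derivIterP; exact Ordinal.limitRecOn_zero ..

theorem derivIter_succ {d : ℕ} (P A : Set (Eu d)) (o : Ordinal.{0}) :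
    derivIterP P A (Order.succ o) = derivP P (derivIterP P A o) := by
  unfold derivIterP
  exact Ordinal.limitRecOn_add_one ..

theorem derivIter_limit {d : ℕ} (P A : Set (Eu d)) (o : Ordinal.{0}) (ho : Order.IsSuccLimit o) :
    derivIterP P A o = ⋂ (o' : Ordinal.{0}) (_ : o' < o), derivIterP P A o' := by
  unfold derivIterP
  rw [Ordinal.limitRecOn_limit _ _ _ _ ho]

theorem perfect_sub_deriv {d : ℕ} {P : Set (Eu d)} (hPc : IsCompact P) (hP : Convex ℝ P)
    (hint : (interior P).Nonempty) (hcore : Core P) {K A : Set (Eu d)} (hK : PCN K)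
    (hKA : K ⊆ A) : K ⊆ derivP P A := by
  intro x hx
  refine ⟨hKA hx, ?_⟩
  rintro ⟨U, ⟨⟨y, r, rfl⟩, hno⟩, hxU⟩
  apply hno
  obtain ⟨C, hC, hsmall⟩ := minC_small hPc hint
  obtain ⟨δ, hδ, hb⟩ := Metric.isOpen_iff.1 Metric.isOpen_ball x hxU
  have hδC : 0 < δ / C := by positivity
  obtain ⟨K₁, h1, hK1, hK1b⟩ := pcn_ball hK hx hδC
  obtain ⟨J, K', h2, hK', hrec⟩ := recurrent hcore hK1
  obtain ⟨K₂, h3, hK2, c, hty⟩ := hrec K' subset_rfl hK'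
  refine ⟨c.1, c.2, good_of_typ hPc hP hint hK2 hty ?_, ?_⟩
  · exact h3.trans (h2.trans (h1.trans hKA))
  · have := hsmall K₂ c x (δ / C) hδC hK2.2.2 hty.1 (h3.trans (h2.trans hK1b))
    rw [mul_div_cancel₀ _ hC.ne'] at this
    exact this.trans hb

theorem perfect_sub_iter {d : ℕ} {P : Set (Eu d)} (hPc : IsCompact P) (hP : Convex ℝ P)
    (hint : (interior P).Nonempty) (hcore : Core P) {K A : Set (Eu d)} (hK : PCN K)
    (hKA : K ⊆ A) (o : Ordinal.{0}) : K ⊆ derivIterP P A o := by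
  induction o using Ordinal.limitRecOn with
  | zero => rwa [derivIter_zero]
  | add_one o ih =>
    have := derivIter_succ P A o
    first
    | rw [this]; exact perfect_sub_deriv hPc hP hint hcore hK ih
    | rw [← Order.succ_eq_add_one, this]; exact perfect_sub_deriv hPc hP hint hcore hK ih
  | limit o ho ih =>
    rw [derivIter_limit _ _ _ ho]
    exact subset_iInter₂ fun o' h => ih o' h

theorem iter_closed {d : ℕ} {P A : Set (Eu d)} (hA : IsClosed A) (o : Ordinal.{0}) :
    IsClosed (derivIterP P A o) := by
  induction o using Ordinal.limitRecOn with
  | zero => rwa [derivIter_zero]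
  | add_one o ih =>
    have := derivIter_succ P A o
    have h2 : IsClosed (derivP P (derivIterP P A o)) := by
      refine ih.sdiff (isOpen_sUnion ?_)
      rintro U ⟨⟨c, r, rfl⟩, -⟩
      exact Metric.isOpen_ball
    first
    | rw [this]; exact h2
    | rw [← Order.succ_eq_add_one, this]; exact h2
  | limit o ho ih =>
    rw [derivIter_limit _ _ _ ho]
    exact isClosed_iInter fun o' => isClosed_iInter fun h => ih o' h

theorem iter_anti {d : ℕ} {P A : Set (Eu d)} : Antitone (derivIterP P A) := by
  intro a b
  induction b using Ordinal.limitRecOn with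
  | zero => intro h; rw [nonpos_iff_eq_zero.1 h]
  | add_one o ih =>
    intro h
    rw [← Order.succ_eq_add_one] at h ⊢
    rcases eq_or_lt_of_le h with rfl | h
    · exact le_rfl
    · rw [derivIter_succ]
      exact Set.diff_subset.trans (ih (Order.lt_succ_iff.1 h))
  | limit o ho ih =>
    intro h
    rcases eq_or_lt_of_le h with rfl | h
    · exact le_rfl
    · rw [derivIter_limit _ _ _ ho]
      exact iInter₂_subset a h

theorem iter_stab {d : ℕ} (P A : Set (Eu d)) :
    ∃ o, derivP P (derivIterP P A o) = derivIterP P A o := by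
  by_contra! h
  refine not_injective_of_ordinal (derivIterP P A) ?_
  have : ∀ a b, a < b → derivIterP P A a ≠ derivIterP P A b := by
    intro a b hab he
    refine h a ?_
    rw [← derivIter_succ]
    apply le_antisymm
    · exact iter_anti (Order.le_succ a)
    · rw [he]
      exact iter_anti (Order.succ_le_of_lt hab)
  intro a b he
  rcases lt_trichotomy a b with h1 | h1 | h1
  · exact absurd he (this _ _ h1)
  · exact h1
  · exact absurd he.symm (this _ _ h1)

theorem fixed_preperfect {d : ℕ} {P A : Set (Eu d)} (hPc : IsCompact P)
    (h : derivP P A = A) : Preperfect A := by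
  rw [preperfect_iff_nhds]
  intro x hx U hU
  obtain ⟨r, hr, hb⟩ := Metric.mem_nhds_iff.1 hU
  rw [← h] at hx
  have hg : ∃ y ρ, IsGoodCopy P A y ρ ∧ y +ᵥ ρ • P ⊆ Metric.ball x r := by
    by_contra hcon
    exact hx.2 ⟨Metric.ball x r, ⟨⟨x, r, rfl⟩, hcon⟩, Metric.mem_ball_self hr⟩
  obtain ⟨y, ρ, ⟨hρ, hgood⟩, hsub⟩ := hg
  by_contra! hcon
  apply hgood
  refine ⟨y, ρ / 2, by positivity, by linarith, ?_⟩
  rintro z ⟨⟨hzA, hzf⟩, hlim⟩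
  exfalso
  have hcl : IsClosed (y +ᵥ ρ • P) := (copy_compact hPc (y, ρ)).isClosed
  have hfs : frontier (y +ᵥ ρ • P) ⊆ y +ᵥ ρ • P := hcl.frontier_subset
  have hx' : ∀ w ∈ A, w ∈ y +ᵥ ρ • P → w = x := fun w hw hwQ => hcon w ⟨hb (hsub hwQ), hw⟩
  have hzx := hx' z hzA (hfs hzf)
  rcases hlim with hlim | ⟨a, b, -, hlim⟩
  · obtain ⟨w, ⟨hw, hwQ⟩, hne⟩ := closure_nonempty_iff.1 ⟨z, hlim⟩
    exact hne ((hx' w hw (interior_subset hwQ)).trans hzx.symm)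
  · obtain ⟨w, ⟨⟨hw, hwQ⟩, -⟩, hne⟩ := closure_nonempty_iff.1 ⟨z, hlim⟩
    exact hne ((hx' w hw (hfs hwQ)).trans hzx.symm)

theorem pcn_of_perfect {d : ℕ} {A : Set (Eu d)} (hA : Perfect A) (hne : A.Nonempty) :
    ∃ K ⊆ A, PCN K := by
  obtain ⟨x, hx⟩ := hne
  have h : (Metric.ball x 1 ∩ A).Nonempty := ⟨x, Metric.mem_ball_self one_pos, hx⟩
  refine ⟨closure (Metric.ball x 1 ∩ A), closure_minimal inter_subset_right hA.closed, ?_,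
    (hA.acc.open_inter Metric.isOpen_ball).perfect_closure.acc, h.closure⟩
  exact (Metric.isBounded_ball.subset inter_subset_left).isCompact_closure

theorem main_of_core {d : ℕ} {P : Set (Eu d)} (hPc : IsCompact P) (hP : Convex ℝ P)
    (hint : (interior P).Nonempty) (hcore : Core P) {A : Set (Eu d)} (hA : IsClosed A) :
    ((∀ α : Ordinal.{0}, (derivIterP P A α).Nonempty) → ∃ σ, WinningI P A σ) ∧
    ((∃ α : Ordinal.{0}, derivIterP P A α = ∅) → ∃ σ, WinningII P A σ) := by
  constructor
  · intro h
    obtain ⟨o, ho⟩ := iter_stab P A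
    obtain ⟨K, hKs, hK⟩ := pcn_of_perfect ⟨iter_closed hA o, fixed_preperfect hPc ho⟩ (h o)
    refine winI_of_core hPc hint hcore hK (hKs.trans ?_)
    have := iter_anti (P := P) (A := A) (show (0 : Ordinal) ≤ o from zero_le)
    rwa [derivIter_zero] at this
  · rintro ⟨o, ho⟩
    refine winII_of_countable (hint.mono interior_subset) ?_
    by_contra hcon
    obtain ⟨D, hD, hne, hDA⟩ := exists_perfect_nonempty_of_isClosed_of_not_countable hA hcon
    obtain ⟨K, hKs, hK⟩ := pcn_of_perfect hD hne
    have := perfect_sub_iter hPc hP hint hcore hK (hKs.trans hDA) o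
    rw [ho] at this
    exact hK.2.2.ne_empty (subset_empty_iff.1 this)

theorem core_polytope {d : ℕ} {P : Set (Eu d)} (hP : IsPolytope d P) : Core P := by
  classical
  obtain ⟨hPc, hint, k, a, b, ha0, hPeq⟩ := hP
  have hmem : ∀ (c : Eu d × ℝ), 0 < c.2 → ∀ z, z ∈ copySet P c ↔
      ∀ i, ⟪a i, z⟫ ≤ ⟪a i, c.1⟫ + c.2 * b i := by
    intro c hc z
    rw [mem_cpy]
    constructor
    · rintro ⟨p, hp, rfl⟩ i
      rw [hPeq] at hp
      have := mem_iInter.1 hp i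
      simp only [mem_setOf_eq] at this
      rw [inner_add_right, inner_smul_right]
      gcongr
    · intro h
      refine ⟨c.2⁻¹ • (z - c.1), ?_, ?_⟩
      · rw [hPeq]
        refine mem_iInter.2 fun i => ?_
        simp only [mem_setOf_eq]
        rw [inner_smul_right, inner_sub_right, inv_mul_le_iff₀ hc]
        linarith [h i]
      · rw [smul_smul, mul_inv_cancel₀ hc.ne', one_smul]; abel
  intro K hK
  obtain ⟨K₀, h0, hK0, hsat⟩ := saturate (Finset.univ : Finset (Fin k))
    (fun i K => ∀ w ∈ K, ∀ w' ∈ K, ⟪a i, w⟫ = ⟪a i, w'⟫)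
    (fun i K K' hs h w hw w' hw' => h w (hs hw) w' (hs hw')) hK
  refine ⟨K₀, h0, hK0, range fun s : Finset (Fin k) => a '' (s : Set (Fin k)), finite_range _, ?_⟩
  intro K₁ h1 hK1
  obtain ⟨c, hmin⟩ := exists_minC hPc hint hK1
  have hm := hmem c hmin.1
  let J : Finset (Fin k) := Finset.univ.filter fun i =>
    ∀ w ∈ K₁, ⟪a i, w⟫ = ⟪a i, c.1⟫ + c.2 * b i
  refine ⟨K₁, subset_rfl, hK1, c, _, ⟨J, rfl⟩, hmin, ?_, ?_⟩
  · rintro _ ⟨i, hi, rfl⟩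
    refine ⟨ha0 i, fun w hw q hq => ?_⟩
    have hi' : ∀ w ∈ K₁, ⟪a i, w⟫ = ⟪a i, c.1⟫ + c.2 * b i := by simpa [J] using hi
    rw [hi' w hw]
    exact (hm q).1 hq i
  · have key : K₁ ⊆ closure (K₁ ∩ {w | ∀ i, i ∉ J → ⟪a i, w⟫ ≠ ⟪a i, c.1⟫ + c.2 * b i}) := by
      by_contra hcon
      obtain ⟨U, hU, hne, hemp⟩ := dense_or_piece hcon
      have hs := pcn_shrink hK1 hU hne
      have hclosed : ∀ i : {i // i ∉ J}, IsClosed {w : Eu d | ⟪a i, w⟫ = ⟪a i, c.1⟫ + c.2 * b i} :=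
        fun i => isClosed_eq (by fun_prop) continuous_const
      obtain ⟨i, K₃, h3, hK3, hC⟩ := baire_piece hs.1 _ hclosed (by
        refine closure_minimal ?_ (isClosed_iUnion_of_finite hclosed)
        intro w hw
        by_contra hw2
        have : w ∈ (∅ : Set (Eu d)) := by
          rw [← hemp]
          refine ⟨hw, fun i hi he => hw2 (mem_iUnion.2 ⟨⟨i, hi⟩, he⟩)⟩
        exact this)
      apply i.2
      have hflat := hsat i (Finset.mem_univ _) K₃ (h3.trans (hs.2.trans h1)) hK3
        (fun w hw w' hw' => (hC hw).trans (hC hw').symm)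
      simp only [J, Finset.mem_filter, Finset.mem_univ, true_and]
      intro w hw
      obtain ⟨w₃, hw₃⟩ := hK3.2.2
      rw [hflat w (h1 hw) w₃ (h1 (hs.2 (h3 hw₃)))]
      exact hC hw₃
    refine key.trans (closure_mono ?_)
    rintro w ⟨hw, hwJ⟩
    refine ⟨hw, ?_⟩
    have hev : ∀ᶠ x in 𝓝 w, ∀ i, i ∉ J → ⟪a i, x⟫ < ⟪a i, c.1⟫ + c.2 * b i := by
      rw [eventually_all]
      intro i
      by_cases hi : i ∈ J
      · exact Eventually.of_forall fun x h => absurd hi h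
      · have hlt : ⟪a i, w⟫ < ⟪a i, c.1⟫ + c.2 * b i :=
          lt_of_le_of_ne ((hm w).1 (hmin.2.1 hw) i) (hwJ i hi)
        have hcont : Continuous fun x : Eu d => ⟪a i, x⟫ := by fun_prop
        filter_upwards [hcont.continuousAt.eventually_lt continuousAt_const hlt] with x hx _
        exact hx
    obtain ⟨r, hr, hb⟩ := Metric.eventually_nhds_iff_ball.1 hev
    refine ⟨r, hr, fun x hx hxJ => (hm x).2 fun i => ?_⟩
    by_cases hi : i ∈ J
    · have := hxJ (a i) ⟨i, hi, rfl⟩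
      exact this.trans ((hm w).1 (hmin.2.1 hw) i)
    · exact (hb x hx i hi).le

/-- Rigidity near a direction exposing a single point. -/
theorem exposed_radius {d : ℕ} {P : Set (Eu d)} (hPc : IsCompact P)
    (hint : (interior P).Nonempty) (n₀ : Eu d)
    (huniq : ∀ z ∈ P, ∀ w ∈ P, NormAt P z n₀ → NormAt P w n₀ → z = w) :
    ∃ R > 0, ∀ (K : Set (Eu d)) (c : Eu d × ℝ) (z n : Eu d), MinC P K c → z ∈ K →
      NormAt (copySet P c) z n → ‖n - n₀‖ ≤ R →
      ¬ ∀ w ∈ K, |⟪n₀, w - z⟫| ≤ R * ‖w - z‖ := by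
  obtain ⟨s, hs, hball⟩ := ball_copy hint
  obtain ⟨D, hD, hPD⟩ : ∃ D > 0, ∀ p ∈ P, ∀ q ∈ P, ‖p - q‖ ≤ D := by
    refine ⟨Metric.diam P + 1, by have := Metric.diam_nonneg (s := P); linarith, fun p hp q hq => ?_⟩
    have := Metric.dist_le_diam_of_mem hPc.isBounded hp hq
    rw [dist_eq_norm] at this
    linarith
  obtain ⟨p₀, hp₀, hmax⟩ := hPc.exists_isMaxOn (hint.mono interior_subset)
    (f := fun p => ⟪n₀, p⟫) (by fun_prop)
  have hN0 : NormAt P p₀ n₀ := fun q hq => hmax hq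
  obtain ⟨μ, hμ, hμP⟩ : ∃ μ > 0, ∀ p ∈ P, ⟪n₀, p₀ - p⟫ < μ → ‖p - p₀‖ < s / 4 := by
    have hM : IsCompact (P ∩ {p | s / 4 ≤ ‖p - p₀‖}) :=
      hPc.inter_right (isClosed_le continuous_const (by fun_prop))
    rcases (P ∩ {p | s / 4 ≤ ‖p - p₀‖}).eq_empty_or_nonempty with he | hne
    · refine ⟨1, one_pos, fun p hp _ => ?_⟩
      by_contra! hcon
      have : p ∈ (∅ : Set (Eu d)) := he ▸ ⟨hp, hcon⟩
      exact this
    · obtain ⟨p₁, ⟨hp₁, hp₁'⟩, hmin⟩ := hM.exists_isMinOn hne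
        (f := fun p => ⟪n₀, p₀ - p⟫) (by fun_prop)
      refine ⟨⟪n₀, p₀ - p₁⟫, ?_, fun p hp hlt => ?_⟩
      · have h1 := hN0 p₁ hp₁
        rw [inner_sub_right]
        refine sub_pos.2 (lt_of_le_of_ne h1 fun he => ?_)
        have : p₁ = p₀ := huniq p₁ hp₁ p₀ hp₀ (fun q hq => (hN0 q hq).trans he.ge) hN0
        rw [this] at hp₁'
        simp only [mem_setOf_eq, sub_self, norm_zero] at hp₁'
        linarith
      · by_contra! hcon
        exact absurd (hmin ⟨hp, hcon⟩) (not_le.2 hlt)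
  refine ⟨μ / (4 * D), by positivity, fun K c z n hmin hz hn hnn hflat => ?_⟩
  set R := μ / (4 * D) with hR
  have hRD : R * D = μ / 4 := by rw [hR]; field_simp
  have hR0 : 0 < R := by positivity
  obtain ⟨z', hz', hze⟩ := mem_cpy.1 (hmin.2.1 hz)
  have hc := hmin.1
  have hnz : ⟪n, p₀ - z'⟫ ≤ 0 := by
    have := hn (c.1 + c.2 • p₀) (mem_cpy.2 ⟨p₀, hp₀, rfl⟩)
    rw [← hze, inner_add_right, inner_add_right, inner_smul_right, inner_smul_right] at this
    rw [inner_sub_right]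
    have h2 : c.2 * ⟪n, p₀⟫ ≤ c.2 * ⟪n, z'⟫ := by linarith
    linarith [le_of_mul_le_mul_left h2 hc]
  have h1 : ⟪n₀, p₀ - z'⟫ ≤ R * D := by
    have e : ⟪n₀, p₀ - z'⟫ = ⟪n, p₀ - z'⟫ - ⟪n - n₀, p₀ - z'⟫ := by
      rw [inner_sub_left]; ring
    have h3 := abs_real_inner_le_norm (n - n₀) (p₀ - z')
    have h4 : ‖n - n₀‖ * ‖p₀ - z'‖ ≤ R * D := by
      have := hPD p₀ hp₀ z' hz'
      gcongr
    have := neg_abs_le ⟪n - n₀, p₀ - z'⟫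
    linarith
  have hz0 : ‖z' - p₀‖ < s / 4 := hμP z' hz' (by linarith)
  obtain ⟨x, hx⟩ := hball z (c.2 * (s / 2)) (by positivity)
  refine hmin.2.2 _ ?_ ?_ (Subset.trans ?_ hx)
  · have : 0 < c.2 * (s / 2) / s := by positivity
    exact this
  · change c.2 * (s / 2) / s < c.2
    have : c.2 * (s / 2) / s = c.2 / 2 := by field_simp
    rw [this]; linarith
  · intro w hw
    obtain ⟨w', hw', hwe⟩ := mem_cpy.1 (hmin.2.1 hw)
    have hwz : w - z = c.2 • (w' - z') := by rw [← hwe, ← hze, smul_sub]; abel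
    have h5 := hflat w hw
    rw [hwz, inner_smul_right, norm_smul, abs_mul, abs_of_pos hc, Real.norm_of_nonneg hc.le] at h5
    have h6 : |⟪n₀, w' - z'⟫| ≤ R * ‖w' - z'‖ := by
      refine le_of_mul_le_mul_left ?_ hc
      linarith
    have h7 : R * ‖w' - z'‖ ≤ R * D := by
      have := hPD w' hw' z' hz'
      gcongr
    have h8 : ⟪n₀, p₀ - w'⟫ = ⟪n₀, p₀ - z'⟫ - ⟪n₀, w' - z'⟫ := by
      rw [← inner_sub_right]; congr 1; abel
    have h9 := neg_abs_le ⟪n₀, w' - z'⟫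
    have hw0 : ‖w' - p₀‖ < s / 4 := hμP w' hw' (by linarith)
    rw [mem_closedBall_iff_norm, hwz, norm_smul, Real.norm_of_nonneg hc.le]
    have : ‖w' - z'‖ ≤ ‖w' - p₀‖ + ‖z' - p₀‖ := by
      have := norm_sub_le (w' - p₀) (z' - p₀)
      rwa [sub_sub_sub_cancel_right] at this
    gcongr
    linarith

def Cap {d : ℕ} (K Q : Set (Eu d)) (n₀ : Eu d) (r : ℝ) : Set (Eu d) :=
  {w | w ∈ K ∧ ∃ n, ‖n - n₀‖ ≤ r ∧ NormAt Q w n}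

theorem cap_closed {d : ℕ} {K Q : Set (Eu d)} (hK : IsCompact K) (n₀ : Eu d) (r : ℝ) :
    IsClosed (Cap K Q n₀ r) := by
  have hcl : IsClosed {q : Eu d × Eu d | NormAt Q q.1 q.2} := by
    have : {q : Eu d × Eu d | NormAt Q q.1 q.2} = ⋂ y ∈ Q, {q | ⟪q.2, y⟫ ≤ ⟪q.2, q.1⟫} := by
      ext q; simp [NormAt]
    rw [this]
    exact isClosed_biInter fun y _ => isClosed_le (by fun_prop) (by fun_prop)
  have hc : IsCompact ((K ×ˢ Metric.closedBall n₀ r) ∩ {q : Eu d × Eu d | NormAt Q q.1 q.2}) :=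
    (hK.prod (isCompact_closedBall _ _)).inter_right hcl
  have : Cap K Q n₀ r = Prod.fst ''
      ((K ×ˢ Metric.closedBall n₀ r) ∩ {q : Eu d × Eu d | NormAt Q q.1 q.2}) := by
    ext w
    constructor
    · rintro ⟨hw, n, hn, hN⟩
      exact ⟨(w, n), ⟨⟨hw, mem_closedBall_iff_norm.2 hn⟩, hN⟩, rfl⟩
    · rintro ⟨⟨w, n⟩, ⟨⟨hw, hn⟩, hN⟩, rfl⟩
      exact ⟨hw, n, mem_closedBall_iff_norm.1 hn, hN⟩
  rw [this]
  exact (hc.image continuous_fst).isClosed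

theorem cap_flat {d : ℕ} {K Q : Set (Eu d)} (hKQ : K ⊆ Q) {n₀ : Eu d} {r : ℝ} {w z : Eu d}
    (hw : w ∈ Cap K Q n₀ r) (hz : z ∈ Cap K Q n₀ r) : |⟪n₀, w - z⟫| ≤ r * ‖w - z‖ := by
  obtain ⟨hwK, m, hm, hmN⟩ := hw
  obtain ⟨hzK, n, hn, hnN⟩ := hz
  have h1 := hmN z (hKQ hzK)
  have h2 := hnN w (hKQ hwK)
  have e1 := (abs_real_inner_le_norm (m - n₀) (w - z)).trans
    (mul_le_mul_of_nonneg_right hm (norm_nonneg _))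
  have e2 := (abs_real_inner_le_norm (n - n₀) (w - z)).trans
    (mul_le_mul_of_nonneg_right hn (norm_nonneg _))
  rw [inner_sub_left, abs_le] at e1 e2
  simp only [inner_sub_right] at e1 e2 ⊢
  rw [abs_le]
  constructor <;> linarith

theorem interior_typ {d : ℕ} {P K : Set (Eu d)} {c : Eu d × ℝ} (hmin : MinC P K c)
    (h : K ⊆ closure (K ∩ interior (copySet P c))) : Typ P K c ∅ := by
  refine ⟨hmin, by simp, h.trans (closure_mono ?_)⟩
  rintro w ⟨hw, hwi⟩
  obtain ⟨r, hr, hb⟩ := Metric.isOpen_iff.1 isOpen_interior w hwi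
  exact ⟨hw, r, hr, fun x hx _ => interior_subset (hb hx)⟩

theorem boundary_piece {d : ℕ} {P K : Set (Eu d)} (hK : PCN K) {c : Eu d × ℝ}
    (hmin : MinC P K c) (h : ¬ Typ P K c ∅) :
    ∃ K' ⊆ K, PCN K' ∧ ∀ w ∈ K', w ∉ interior (copySet P c) := by
  have h2 : ¬ K ⊆ closure (K ∩ interior (copySet P c)) := fun h' => h (interior_typ hmin h')
  obtain ⟨U, hU, hne, hemp⟩ := dense_or_piece h2
  have hs := pcn_shrink hK hU hne
  refine ⟨_, hs.2, hs.1, ?_⟩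
  have : closure (K ∩ U) ⊆ (interior (copySet P c))ᶜ :=
    closure_minimal (fun w hw hwi => by
      have : w ∈ (∅ : Set (Eu d)) := hemp ▸ ⟨hw, hwi⟩
      exact this) isOpen_interior.isClosed_compl
  exact this

theorem core_strict {d : ℕ} {P : Set (Eu d)} (hPc : IsCompact P) (hP : StrictConvex ℝ P)
    (hint : (interior P).Nonempty) : Core P := by
  classical
  have huniq : ∀ n₀ ∈ Metric.sphere (0 : Eu d) 1, ∀ z ∈ P, ∀ w ∈ P, NormAt P z n₀ →
      NormAt P w n₀ → z = w := by
    intro n₀ hn₀ z hz w hw h1 h2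
    by_contra hne
    have hmid := hP hz hw hne (a := 1 / 2) (b := 1 / 2) (by norm_num) (by norm_num) (by norm_num)
    have hn0 : n₀ ≠ 0 := by
      rintro rfl
      simp at hn₀
    refine not_interior_of_norm hn0 (Q := P) ?_ hmid
    intro q hq
    have e1 := h1 q hq
    have e2 := h2 q hq
    rw [inner_add_right, inner_smul_right, inner_smul_right]
    linarith
  choose! R hR hRP using fun n₀ (h : n₀ ∈ Metric.sphere (0 : Eu d) 1) =>
    exposed_radius hPc hint n₀ (huniq n₀ h)
  obtain ⟨t, ht, hcov⟩ := (isCompact_sphere (0 : Eu d) 1).elim_nhds_subcover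
    (fun n => Metric.ball n (R n)) (fun n hn => Metric.ball_mem_nhds n (hR n hn))
  intro K hK
  obtain ⟨K₀, h0, hK0, hsat⟩ := saturate t
    (fun n K => ∀ w ∈ K, ∀ z ∈ K, |⟪n, w - z⟫| ≤ R n * ‖w - z‖)
    (fun i K K' hs h w hw w' hw' => h w (hs hw) w' (hs hw')) hK
  refine ⟨K₀, h0, hK0, {∅}, finite_singleton _, fun K₁ h1 hK1 => ?_⟩
  obtain ⟨c, hmin⟩ := exists_minC hPc hint hK1
  refine ⟨K₁, subset_rfl, hK1, c, ∅, rfl, ?_⟩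
  by_contra hcon
  obtain ⟨K₂, h2, hK2, hbd⟩ := boundary_piece hK1 hmin hcon
  obtain ⟨n₀, K₃, h3, hK3, hC⟩ := baire_piece hK2
    (fun n : t => Cap K₁ (copySet P c) n (R n)) (fun n => cap_closed hK1.1 _ _) (by
      intro w hw
      obtain ⟨n, hn1, hn⟩ := exists_normal (copy_convex hP.convex c) (copy_interior hint hmin.1)
        (hbd w hw)
      obtain ⟨n₀, hn₀, hnb⟩ := mem_iUnion₂.1 (hcov (show n ∈ Metric.sphere 0 1 by simpa using hn1))
      exact mem_iUnion.2 ⟨⟨n₀, hn₀⟩, h2 hw, n, (mem_ball_iff_norm.1 hnb).le, hn⟩)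
  have hflat := hsat n₀ n₀.2 K₃ (h3.trans (h2.trans h1)) hK3
    (fun w hw z hz => cap_flat hmin.2.1 (hC hw) (hC hz))
  obtain ⟨z, hz⟩ := hK3.2.2
  obtain ⟨hz1, n, hn, hN⟩ := hC hz
  exact hRP n₀ (ht _ n₀.2) K₁ c z n hmin hz1 hN hn
    (fun w hw => hflat w (h1 hw) z (h1 hz1))

theorem in2 (x y : Eu 2) : ⟪x, y⟫ = x 0 * y 0 + x 1 * y 1 := by
  simp [PiLp.inner_apply, Fin.sum_univ_two, mul_comm]

theorem nm2 (x : Eu 2) : ‖x‖ ^ 2 = x 0 ^ 2 + x 1 ^ 2 := by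
  rw [← real_inner_self_eq_norm_sq, in2]; ring

noncomputable def prp (u : Eu 2) : Eu 2 := !₂[-u 1, u 0]

theorem prp0 (u : Eu 2) : prp u 0 = - u 1 := by simp [prp]
theorem prp1 (u : Eu 2) : prp u 1 = u 0 := by simp [prp]

theorem unit2 {n : Eu 2} (hn : ‖n‖ = 1) : n 0 ^ 2 + n 1 ^ 2 = 1 := by
  rw [← nm2, hn]; norm_num

theorem ext2 {n : Eu 2} (hn : ‖n‖ = 1) {x y : Eu 2} (h1 : ⟪n, x⟫ = ⟪n, y⟫)
    (h2 : ⟪prp n, x⟫ = ⟪prp n, y⟫) : x = y := by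
  have hu := unit2 hn
  simp only [in2, prp0, prp1] at h1 h2
  ext i
  fin_cases i
  · show x 0 = y 0
    linear_combination n 0 * h1 - n 1 * h2 - (x 0 - y 0) * hu
  · show x 1 = y 1
    linear_combination n 1 * h1 + n 0 * h2 - (x 1 - y 1) * hu

theorem mid_point {d : ℕ} {K : Set (Eu d)} (hK : PCN K) (e : Eu d)
    (hinj : ∀ x ∈ K, ∀ y ∈ K, ⟪e, x⟫ = ⟪e, y⟫ → x = y) :
    ∃ p ∈ K, ∃ q ∈ K, K ⊆ closure {w | w ∈ K ∧ ⟪e, p⟫ < ⟪e, w⟫ ∧ ⟪e, w⟫ < ⟪e, q⟫} := by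
  have hcont : ContinuousOn (fun x => ⟪e, x⟫) K := by fun_prop
  obtain ⟨p, hp, hpm⟩ := hK.1.exists_isMinOn hK.2.2 hcont
  obtain ⟨q, hq, hqm⟩ := hK.1.exists_isMaxOn hK.2.2 hcont
  refine ⟨p, hp, q, hq, fun x hx => ?_⟩
  rw [mem_closure_iff]
  intro o ho hxo
  have hU : IsOpen (o \ (({p, q} : Set (Eu d)) \ {x})) :=
    ho.sdiff ((Set.toFinite _).isClosed)
  obtain ⟨y, ⟨hyo, hyn⟩, hyK, hyx⟩ := mem_closure_iff.1 (pcn_limit hK hx) _ hU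
    ⟨hxo, fun h => h.2 rfl⟩
  have hpq : y ∉ ({p, q} : Set (Eu d)) := fun h => hyn ⟨h, hyx⟩
  simp only [mem_insert_iff, mem_singleton_iff, not_or] at hpq
  refine ⟨y, hyo, hyK, lt_of_le_of_ne (hpm hyK) fun h => hpq.1 (hinj _ hyK _ hp h.symm),
    lt_of_le_of_ne (hqm hyK) fun h => hpq.2 (hinj _ hyK _ hq h)⟩

theorem line_typ {P : Set (Eu 2)} (hPc : IsCompact P) (hP : Convex ℝ P)
    (hint : (interior P).Nonempty) {K : Set (Eu 2)} (hK : PCN K) {n : Eu 2} (hn : ‖n‖ = 1)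
    {b : ℝ} (hline : ∀ x ∈ K, ⟪n, x⟫ = b) :
    ∃ c, ∃ J ∈ ({∅, {n}, {-n}} : Set (Set (Eu 2))), Typ P K c J := by
  obtain ⟨c, hmin⟩ := exists_minC hPc hint hK
  refine ⟨c, ?_⟩
  have hQ := copy_convex hP c
  have hKQ := hmin.2.1
  obtain ⟨o, ho⟩ := copy_interior hint hmin.1
  have hoQ := interior_subset ho
  set Q := copySet P c with hQdef
  obtain ⟨p, hp, q, hq, hdense⟩ := mid_point hK (prp n) (fun x hx y hy h =>
    ext2 hn ((hline x hx).trans (hline y hy).symm) h)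
  by_cases hall : ∀ w ∈ K, ⟪prp n, p⟫ < ⟪prp n, w⟫ → ⟪prp n, w⟫ < ⟪prp n, q⟫ → w ∈ interior Q
  · refine ⟨∅, by simp, interior_typ hmin (hdense.trans (closure_mono ?_))⟩
    rintro w ⟨h1, h2, h3⟩
    exact ⟨h1, hall w h1 h2 h3⟩
  push Not at hall
  obtain ⟨w, hw, hpw, hwq, hwi⟩ := hall
  obtain ⟨m, hm1, hm⟩ := exists_normal hQ ⟨o, ho⟩ hwi
  have hu := unit2 hn
  have hmu := unit2 hm1
  -- decomposition of inner products with `m`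
  have hdec : ∀ x, ⟪m, x⟫ = ⟪n, m⟫ * ⟪n, x⟫ + ⟪prp n, m⟫ * ⟪prp n, x⟫ := by
    intro x
    simp only [in2, prp0, prp1]
    linear_combination -(m 0 * x 0 + m 1 * x 1) * hu
  have hmv : ⟪prp n, m⟫ = 0 := by
    have h1 := hm p (hKQ hp)
    have h2 := hm q (hKQ hq)
    rw [hdec p, hdec w, hline p hp, hline w hw] at h1
    rw [hdec q, hdec w, hline q hq, hline w hw] at h2
    apply le_antisymm
    · by_contra h; push Not at h; nlinarith
    · by_contra h; push Not at h; nlinarith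
  have hsq : ⟪n, m⟫ ^ 2 = 1 := by
    have := hdec m
    rw [hmv, real_inner_self_eq_norm_sq, hm1] at this
    linarith
  have hmn : m = n ∨ m = -n := by
    rcases sq_eq_one_iff.1 hsq with h | h
    · left
      refine ext2 hn ?_ ?_
      · rw [h, real_inner_self_eq_norm_sq, hn]; norm_num
      · rw [hmv]; simp only [in2, prp0, prp1]; ring
    · right
      refine ext2 hn ?_ ?_
      · rw [h, inner_neg_right, real_inner_self_eq_norm_sq, hn]; norm_num
      · rw [hmv, inner_neg_right]; simp only [in2, prp0, prp1]; ring
  have hm0 : m ≠ 0 := by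
    rintro rfl
    simp at hm1
  set s := ⟪n, m⟫ with hs
  have hs0 : s ≠ 0 := by
    intro h; rw [h] at hsq; norm_num at hsq
  have hdec' : ∀ x, ⟪m, x⟫ = s * ⟪n, x⟫ := by
    intro x; rw [hdec x, hmv]; ring
  have hKm : ∀ x ∈ K, ⟪m, x⟫ = s * b := fun x hx => by rw [hdec', hline x hx]
  have hmo : ⟪m, o⟫ < s * b := by
    by_contra h
    push Not at h
    refine not_interior_of_norm hm0 (Q := Q) (z := o) ?_ ho
    intro y hy
    have := hm y hy
    rw [hKm w hw] at this
    linarith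
  refine ⟨{m}, ?_, hmin, ?_, ?_⟩
  · rcases hmn with h | h <;> simp [h]
  · rintro a rfl
    refine ⟨hm0, fun x hx y hy => ?_⟩
    rw [hKm x hx, ← hKm w hw]
    exact hm y hy
  · refine hdense.trans (closure_mono ?_)
    rintro x ⟨hx, h1, h2⟩
    refine ⟨hx, ?_⟩
    set D := s * b - ⟪m, o⟫ with hD
    have hDp : 0 < D := by linarith
    let t : Eu 2 → ℝ := fun z => (s * b - ⟪m, z⟫) / D
    let y : Eu 2 → Eu 2 := fun z => (1 - t z)⁻¹ • (z - t z • o)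
    have htc : Continuous t := by fun_prop
    have htx : t x = 0 := by simp only [t]; rw [hKm x hx]; simp
    have hyx : y x = x := by simp only [y, htx]; simp
    have hyc : ContinuousAt y x := by
      show ContinuousAt ((fun z => (1 - t z)⁻¹) • (fun z => z - t z • o)) x
      apply ContinuousAt.smul
      · exact (by fun_prop : ContinuousAt (fun z => 1 - t z) x).inv₀ (by rw [htx]; norm_num)
      · fun_prop
    have hfc : ContinuousAt (fun z => ⟪prp n, y z⟫) x := by
      exact ContinuousAt.inner continuousAt_const hyc
    have ev1 : ∀ᶠ z in 𝓝 x, t z < 1 :=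
      htc.continuousAt.eventually_lt continuousAt_const (by rw [htx]; norm_num)
    have ev2 : ∀ᶠ z in 𝓝 x, ⟪prp n, p⟫ < ⟪prp n, y z⟫ :=
      continuousAt_const.eventually_lt hfc (by rw [hyx]; exact h1)
    have ev3 : ∀ᶠ z in 𝓝 x, ⟪prp n, y z⟫ < ⟪prp n, q⟫ :=
      hfc.eventually_lt continuousAt_const (by rw [hyx]; exact h2)
    obtain ⟨r, hr, hball⟩ := Metric.eventually_nhds_iff_ball.1 (ev1.and (ev2.and ev3))
    refine ⟨r, hr, fun z hz hzm => ?_⟩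
    obtain ⟨g1, g2, g3⟩ := hball z hz
    have hzm' := hzm m rfl
    rw [hKm x hx] at hzm'
    have ht0 : 0 ≤ t z := div_nonneg (by linarith) hDp.le
    have htD : t z * D = s * b - ⟪m, z⟫ := div_mul_cancel₀ _ hDp.ne'
    have h1t : 0 < 1 - t z := by linarith
    have hym : ⟪m, y z⟫ = s * b := by
      simp only [y]
      rw [inner_smul_right, inner_sub_right, inner_smul_right, inv_mul_eq_iff_eq_mul₀ h1t.ne']
      rw [hD] at htD
      linear_combination htD
    have hyn : ⟪n, y z⟫ = b := by
      rw [hdec'] at hym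
      exact mul_left_cancel₀ hs0 hym
    have hyQ : y z ∈ Q := by
      set L := ⟪prp n, q⟫ - ⟪prp n, p⟫ with hL
      have hLp : 0 < L := by linarith
      set k := (⟪prp n, y z⟫ - ⟪prp n, p⟫) / L with hk
      have hkL : k * L = ⟪prp n, y z⟫ - ⟪prp n, p⟫ := div_mul_cancel₀ _ hLp.ne'
      have hk0 : 0 ≤ k := div_nonneg (by linarith) hLp.le
      have hk1 : k ≤ 1 := by rw [hk, div_le_one hLp]; linarith
      have : y z = (1 - k) • p + k • q := by
        refine ext2 hn ?_ ?_
        · rw [hyn, inner_add_right, inner_smul_right, inner_smul_right, hline p hp, hline q hq]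
          ring
        · clear_value k L y t
          rw [inner_add_right, inner_smul_right, inner_smul_right]
          rw [hL] at hkL
          linear_combination -hkL
      rw [this]
      exact hQ (hKQ hp) (hKQ hq) (by linarith) hk0 (by ring)
    have : z = (1 - t z) • y z + t z • o := by
      simp only [y]
      rw [smul_inv_smul₀ h1t.ne']
      simp
    rw [this]
    exact hQ hyQ hoQ h1t.le ht0 (by ring)

def Dset (P : Set (Eu 2)) : Set (Eu 2) :=
  {n | ‖n‖ = 1 ∧ ∃ z ∈ P, ∃ w ∈ P, NormAt P z n ∧ NormAt P w n ∧ z ≠ w}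

theorem dset_countable {P : Set (Eu 2)} (hP : Convex ℝ P) : (Dset P).Countable := by
  have key : ∀ n ∈ Dset P, n 1 ≠ 0 → ∃ q : ℚ, ∃ z ∈ P, ∃ w ∈ P, NormAt P z n ∧ NormAt P w n ∧
      z 0 < q ∧ (q : ℝ) < w 0 := by
    rintro n ⟨hn, z, hz, w, hw, hzn, hwn, hne⟩ hn1
    have heq : ⟪n, z⟫ = ⟪n, w⟫ := le_antisymm (hwn z hz) (hzn w hw)
    have h0 : z 0 ≠ w 0 := by
      intro h
      apply hne
      rw [in2, in2, h] at heq
      have : z 1 = w 1 := mul_left_cancel₀ hn1 (by linarith)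
      ext i
      fin_cases i
      · exact h
      · exact this
    rcases lt_or_gt_of_ne h0 with h | h
    · obtain ⟨q, h1, h2⟩ := exists_rat_btwn h
      exact ⟨q, z, hz, w, hw, hzn, hwn, h1, h2⟩
    · obtain ⟨q, h1, h2⟩ := exists_rat_btwn h
      exact ⟨q, w, hw, z, hz, hwn, hzn, h1, h2⟩
  choose! q hq using key
  -- the point of a face above the chosen abscissa
  have pt : ∀ n ∈ Dset P, n 1 ≠ 0 → ∃ u ∈ P, u 0 = q n ∧ NormAt P u n ∧
      ∃ z ∈ P, ∃ w ∈ P, z 0 < w 0 ∧ ⟪n, z⟫ = ⟪n, w⟫ ∧ ∃ k : ℝ, 0 < k ∧ k < 1 ∧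
        u = (1 - k) • z + k • w := by
    intro n hn hn1
    obtain ⟨z, hz, w, hw, hzn, hwn, h1, h2⟩ := hq n hn hn1
    have hL : 0 < w 0 - z 0 := by linarith
    have hkL : (q n - z 0) / (w 0 - z 0) * (w 0 - z 0) = q n - z 0 := div_mul_cancel₀ _ hL.ne'
    set k := (q n - z 0) / (w 0 - z 0) with hk
    have hk0 : 0 < k := div_pos (by linarith) hL
    have hk1 : k < 1 := by rw [hk, div_lt_one hL]; linarith
    have heq : ⟪n, z⟫ = ⟪n, w⟫ := le_antisymm (hwn z hz) (hzn w hw)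
    refine ⟨(1 - k) • z + k • w, hP hz hw (by linarith) hk0.le (by ring), ?_, ?_, z, hz, w, hw,
      by linarith, heq, k, hk0, hk1, rfl⟩
    · simp
      linear_combination hkL
    · intro y hy
      rw [inner_add_right, inner_smul_right, inner_smul_right, ← heq]
      have := hzn y hy
      linarith
  have inj : ∀ n ∈ Dset P, ∀ n' ∈ Dset P, 0 < n 1 * n' 1 → q n = q n' → n = n' := by
    intro n hn n' hn' hpos hqq
    have hn1 : n 1 ≠ 0 := by rintro h; simp [h] at hpos
    have hn1' : n' 1 ≠ 0 := by rintro h; simp [h] at hpos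
    obtain ⟨u, hu, hu0, hun, -⟩ := pt n hn hn1
    obtain ⟨u', hu', hu0', hun', z, hz, w, hw, hzw, hzwn, k, hk0, hk1, hk⟩ := pt n' hn' hn1'
    have e1 := hun u' hu'
    have e2 := hun' u hu
    rw [in2, in2, hu0, hu0', ← hqq] at e1
    rw [in2, in2, hu0, hu0', ← hqq] at e2
    have h1 : u 1 = u' 1 := by
      rcases lt_or_gt_of_ne hn1 with h | h
      · have h' : n' 1 < 0 := by nlinarith
        apply le_antisymm
        · by_contra hc; push Not at hc; nlinarith
        · by_contra hc; push Not at hc; nlinarith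
      · have h' : 0 < n' 1 := by nlinarith
        apply le_antisymm
        · by_contra hc; push Not at hc; nlinarith
        · by_contra hc; push Not at hc; nlinarith
    have huu : u = u' := by
      ext i
      fin_cases i
      · show u 0 = u' 0
        rw [hu0, hu0', hqq]
      · exact h1
    have f1 := hun z hz
    have f2 := hun w hw
    rw [huu, hk, inner_add_right, inner_smul_right, inner_smul_right] at f1 f2
    have f3 : ⟪n, z⟫ = ⟪n, w⟫ := by
      apply le_antisymm
      · by_contra hc; push Not at hc; nlinarith
      · by_contra hc; push Not at hc; nlinarith
    rw [in2, in2] at f3 hzwn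
    have hun1 := unit2 hn.1
    have hun2 := unit2 hn'.1
    have hcross : n 0 * n' 1 = n' 0 * n 1 := by
      have : (w 0 - z 0) * (n 0 * n' 1 - n' 0 * n 1) = 0 := by
        linear_combination -n' 1 * f3 + n 1 * hzwn
      rcases mul_eq_zero.1 this with h | h
      · linarith
      · linarith
    have hsq : n 1 ^ 2 = n' 1 ^ 2 := by
      linear_combination -n 1 ^ 2 * hun2 + n' 1 ^ 2 * hun1 -
        (n 0 * n' 1 + n' 0 * n 1) * hcross
    have h11 : n 1 = n' 1 := by
      rcases sq_eq_sq_iff_eq_or_eq_neg.1 hsq with h | h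
      · exact h
      · rw [h] at hpos; nlinarith [sq_nonneg (n' 1)]
    have h00 : n 0 = n' 0 := by
      rw [h11] at hcross
      exact mul_right_cancel₀ hn1' hcross
    ext i
    fin_cases i
    · exact h00
    · exact h11
  have c1 : (Dset P ∩ {n | 0 < n 1}).Countable :=
    Set.MapsTo.countable_of_injOn (f := q) (t := univ) (fun _ _ => mem_univ _)
      (fun n hn n' hn' h => inj n hn.1 n' hn'.1 (mul_pos hn.2 hn'.2) h) (Set.to_countable _)
  have c2 : (Dset P ∩ {n | n 1 < 0}).Countable :=
    Set.MapsTo.countable_of_injOn (f := q) (t := univ) (fun _ _ => mem_univ _)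
      (fun n hn n' hn' h => inj n hn.1 n' hn'.1 (mul_pos_of_neg_of_neg hn.2 hn'.2) h)
      (Set.to_countable _)
  have c3 : ({!₂[1, 0], !₂[-1, 0]} : Set (Eu 2)).Countable := Set.to_countable _
  refine ((c1.union c2).union c3).mono ?_
  intro n hn
  rcases lt_trichotomy (n 1) 0 with h | h | h
  · exact Or.inl (Or.inr ⟨hn, h⟩)
  · right
    have hu := unit2 hn.1
    rw [h] at hu
    have h0 : n 0 ^ 2 = 1 := by linarith
    rcases sq_eq_one_iff.1 h0 with h0 | h0
    · left
      ext i; fin_cases i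
      · simpa using h0
      · simpa using h
    · right
      ext i; fin_cases i
      · simpa using h0
      · simpa using h
  · exact Or.inl (Or.inl ⟨hn, h⟩)

set_option maxHeartbeats 1000000 in
theorem off_normal {n₀ n z p q : Eu 2} (h0 : ‖n₀‖ = 1) (hn : ‖n‖ = 1) {r : ℝ} (hr : 0 < r)
    (hr2 : r ≤ 1 / 2)
    (hp : |⟪n₀, p - z⟫| ≤ r * ‖p - z‖) (hq : |⟪n₀, q - z⟫| ≤ r * ‖q - z‖)
    (hpz : ⟪prp n₀, p⟫ < ⟪prp n₀, z⟫) (hzq : ⟪prp n₀, z⟫ < ⟪prp n₀, q⟫)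
    (hnp : ⟪n, p⟫ ≤ ⟪n, z⟫) (hnq : ⟪n, q⟫ ≤ ⟪n, z⟫) :
    ‖n - n₀‖ ≤ 4 * r ∨ ‖n - -n₀‖ ≤ 4 * r := by
  have hu := unit2 h0
  have hun := unit2 hn
  set a := ⟪prp n₀, n⟫ with ha
  set b := ⟪n₀, n⟫ with hb
  have hab : a ^ 2 + b ^ 2 = 1 := by
    rw [ha, hb]
    simp only [in2, prp0, prp1]
    linear_combination hun * (n₀ 0 ^ 2 + n₀ 1 ^ 2) + hu
  have hdec : ∀ x, ⟪n, x⟫ = b * ⟪n₀, x⟫ + a * ⟪prp n₀, x⟫ := by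
    intro x
    rw [ha, hb]
    simp only [in2, prp0, prp1]
    linear_combination -(n 0 * x 0 + n 1 * x 1) * hu
  have hnrm : ∀ x : Eu 2, ‖x‖ ≤ |⟪n₀, x⟫| + |⟪prp n₀, x⟫| := by
    intro x
    apply (sq_le_sq₀ (norm_nonneg _) (by positivity)).1
    have : ‖x‖ ^ 2 = |⟪n₀, x⟫| ^ 2 + |⟪prp n₀, x⟫| ^ 2 := by
      rw [sq_abs, sq_abs, nm2]
      simp only [in2, prp0, prp1]
      linear_combination -(x 0 ^ 2 + x 1 ^ 2) * hu
    rw [this]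
    nlinarith [mul_nonneg (abs_nonneg ⟪n₀, x⟫) (abs_nonneg ⟪prp n₀, x⟫)]
  have hflat : ∀ x : Eu 2, |⟪n₀, x⟫| ≤ r * ‖x‖ → |⟪n₀, x⟫| ≤ 2 * r * |⟪prp n₀, x⟫| := by
    intro x hx
    have h1 := mul_le_mul_of_nonneg_left (hnrm x) hr.le
    nlinarith [abs_nonneg ⟪n₀, x⟫]
  have hp' := hflat _ hp
  have hq' := hflat _ hq
  have hb1 : |b| ≤ 1 := by
    rw [abs_le]; constructor <;> nlinarith [sq_nonneg a]
  have e1 : ⟪n, p - z⟫ ≤ 0 := by rw [inner_sub_right]; linarith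
  have e2 : ⟪n, q - z⟫ ≤ 0 := by rw [inner_sub_right]; linarith
  rw [hdec] at e1 e2
  have g1 : ⟪prp n₀, p - z⟫ < 0 := by rw [inner_sub_right]; linarith
  have g2 : 0 < ⟪prp n₀, q - z⟫ := by rw [inner_sub_right]; linarith
  rw [abs_of_neg g1] at hp'
  rw [abs_of_pos g2] at hq'
  have b1 : -(b * ⟪n₀, p - z⟫) ≤ |⟪n₀, p - z⟫| := by
    refine (neg_le_abs _).trans ?_
    rw [abs_mul]
    exact mul_le_of_le_one_left (abs_nonneg _) hb1
  have b2 : -(b * ⟪n₀, q - z⟫) ≤ |⟪n₀, q - z⟫| := by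
    refine (neg_le_abs _).trans ?_
    rw [abs_mul]
    exact mul_le_of_le_one_left (abs_nonneg _) hb1
  have ha1 : -(2 * r) ≤ a := by
    by_contra h; push Not at h; nlinarith
  have ha2 : a ≤ 2 * r := by
    by_contra h; push Not at h; nlinarith
  have ha3 : a ^ 2 ≤ 4 * r ^ 2 := by nlinarith
  have hnn : n₀ 0 * n 0 + n₀ 1 * n 1 = b := by rw [hb, in2]
  rw [abs_le] at hb1
  clear_value a b
  clear hdec hnrm hflat hp' hq' b1 b2 e1 e2 g1 g2 hp hq hpz hzq hnp hnq
  rcases le_total 0 b with h | h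
  · left
    apply (sq_le_sq₀ (norm_nonneg _) (by positivity)).1
    have : ‖n - n₀‖ ^ 2 = 2 - 2 * b := by
      rw [nm2]
      simp only [PiLp.sub_apply]
      linear_combination hun + hu - 2 * hnn
    rw [this]
    have hbb : b ^ 2 ≤ b := by nlinarith [mul_nonneg h (sub_nonneg.2 hb1.2)]
    nlinarith
  · right
    apply (sq_le_sq₀ (norm_nonneg _) (by positivity)).1
    have : ‖n - -n₀‖ ^ 2 = 2 + 2 * b := by
      rw [nm2]
      simp only [PiLp.sub_apply, PiLp.neg_apply]
      linear_combination hun + hu + 2 * hnn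
    rw [this]
    have hbb : b ^ 2 ≤ -b := by nlinarith [mul_nonneg (neg_nonneg.2 h) (neg_le_iff_add_nonneg.1 hb1.1)]
    nlinarith

theorem core_plane {P : Set (Eu 2)} (hPc : IsCompact P) (hP : Convex ℝ P)
    (hint : (interior P).Nonempty) : Core P := by
  classical
  intro K hK
  by_cases hL : ∃ K₀ ⊆ K, PCN K₀ ∧ ∃ n : Eu 2, ‖n‖ = 1 ∧ ∃ b : ℝ, ∀ x ∈ K₀, ⟪n, x⟫ = b
  · obtain ⟨K₀, h0, hK0, n, hn, b, hline⟩ := hL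
    refine ⟨K₀, h0, hK0, {∅, {n}, {-n}}, Set.toFinite _, fun K₁ h1 hK1 => ?_⟩
    exact ⟨K₁, subset_rfl, hK1, line_typ hPc hP hint hK1 hn (fun x hx => hline x (h1 hx))⟩
  refine ⟨K, subset_rfl, hK, {∅}, finite_singleton _, fun K₁ h1 hK1 => ?_⟩
  obtain ⟨c, hmin⟩ := exists_minC hPc hint hK1
  by_cases hT : Typ P K₁ c ∅
  · exact ⟨K₁, subset_rfl, hK1, c, ∅, rfl, hT⟩
  obtain ⟨K₂, h2, hK2, hbd⟩ := boundary_piece hK1 hmin hT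
  set D : Set (Eu 2) := Dset P ∪ {n | -n ∈ Dset P} with hD
  have hDc : D.Countable := by
    refine (dset_countable hP).union ?_
    exact (dset_countable hP).preimage neg_injective
  have huniq : ∀ n, ‖n‖ = 1 → n ∉ Dset P → ∀ z ∈ P, ∀ w ∈ P, NormAt P z n → NormAt P w n →
      z = w := by
    intro n hn hnD z hz w hw hzn hwn
    by_contra hne
    exact hnD ⟨hn, z, hz, w, hw, hzn, hwn, hne⟩
  have hrad : ∀ n₀ ∈ Metric.sphere (0 : Eu 2) 1 \ D, ∃ r > 0, r ≤ 1 / 2 ∧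
      ∀ (K : Set (Eu 2)) (c : Eu 2 × ℝ) (z n : Eu 2), MinC P K c → z ∈ K →
      NormAt (copySet P c) z n → (‖n - n₀‖ ≤ 4 * r ∨ ‖n - -n₀‖ ≤ 4 * r) →
      ¬ ∀ w ∈ K, |⟪n₀, w - z⟫| ≤ r * ‖w - z‖ := by
    rintro n₀ ⟨hn₀, hnD⟩
    have hn1 : ‖n₀‖ = 1 := by simpa using hn₀
    obtain ⟨R₁, hR1, h1⟩ := exposed_radius hPc hint n₀
      (huniq n₀ hn1 fun h => hnD (Or.inl h))
    obtain ⟨R₂, hR2, h2⟩ := exposed_radius hPc hint (-n₀)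
      (huniq (-n₀) (by rw [norm_neg, hn1]) fun h => hnD (Or.inr h))
    set r := min (min (R₁ / 4) (R₂ / 4)) (1 / 2) with hr
    have r1 : r ≤ R₁ / 4 := (min_le_left _ _).trans (min_le_left _ _)
    have r2 : r ≤ R₂ / 4 := (min_le_left _ _).trans (min_le_right _ _)
    refine ⟨r, by positivity, min_le_right _ _, ?_⟩
    intro K c z n hm hz hN hor hw
    rcases hor with h | h
    · refine h1 K c z n hm hz hN (by linarith) fun w hwK => (hw w hwK).trans ?_
      exact mul_le_mul_of_nonneg_right (by linarith) (norm_nonneg _)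
    · refine h2 K c z n hm hz hN (by linarith) fun w hwK => ?_
      rw [inner_neg_left, abs_neg]
      exact (hw w hwK).trans (mul_le_mul_of_nonneg_right (by linarith) (norm_nonneg _))
  choose! r hr hr2 hrP using hrad
  obtain ⟨t, hts, htc, hcov⟩ := TopologicalSpace.countable_cover_nhdsWithin
    (s := Metric.sphere (0 : Eu 2) 1 \ D) (f := fun n => Metric.ball n (r n))
    (fun n hn => mem_nhdsWithin_of_mem_nhds (Metric.ball_mem_nhds n (hr n hn)))
  have : Countable t := htc.to_subtype
  have hSc : (D ∩ Metric.sphere (0 : Eu 2) 1).Countable := hDc.mono inter_subset_left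
  have : Countable (D ∩ Metric.sphere (0 : Eu 2) 1 : Set (Eu 2)) := hSc.to_subtype
  obtain ⟨i, K₃, h3, hK3, hC⟩ := baire_piece hK2
    (ι := t ⊕ (D ∩ Metric.sphere (0 : Eu 2) 1 : Set (Eu 2)))
    (Sum.elim (fun n => Cap K₁ (copySet P c) n (r n)) (fun n => Cap K₁ (copySet P c) n 0))
    (by rintro (n | n) <;> exact cap_closed hK1.1 _ _) (by
      intro w hw
      obtain ⟨n, hn1, hn⟩ := exists_normal (copy_convex hP c) (copy_interior hint hmin.1)
        (hbd w hw)
      have hns : n ∈ Metric.sphere (0 : Eu 2) 1 := by simpa using hn1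
      by_cases hnD : n ∈ D
      · exact mem_iUnion.2 ⟨Sum.inr ⟨n, hnD, hns⟩, h2 hw, n, by simp, hn⟩
      · obtain ⟨n₀, hn₀, hnb⟩ := mem_iUnion₂.1 (hcov ⟨hns, hnD⟩)
        exact mem_iUnion.2 ⟨Sum.inl ⟨n₀, hn₀⟩, h2 hw, n, (mem_ball_iff_norm.1 hnb).le, hn⟩)
  rcases i with ⟨n₀, hn₀⟩ | ⟨n₀, hn₀⟩
  swap
  · exfalso
    obtain ⟨z, hz⟩ := hK3.2.2
    refine hL ⟨K₃, h3.trans (h2.trans h1), hK3, n₀, by simpa using hn₀.2, ⟪n₀, z⟫, fun x hx => ?_⟩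
    have := cap_flat hmin.2.1 (hC hx) (hC hz)
    rw [zero_mul] at this
    have := abs_eq_zero.1 (le_antisymm this (abs_nonneg _))
    rw [inner_sub_right] at this
    linarith
  have hn₀s := hts hn₀
  have hn1 : ‖n₀‖ = 1 := by simpa using hn₀s.1
  have hrp := hr n₀ hn₀s
  have hrh := hr2 n₀ hn₀s
  have hflat : ∀ x ∈ K₃, ∀ y ∈ K₃, |⟪n₀, x - y⟫| ≤ r n₀ * ‖x - y‖ := fun x hx y hy =>
    cap_flat hmin.2.1 (hC hx) (hC hy)
  obtain ⟨c₁, hmin₁⟩ := exists_minC hPc hint hK3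
  refine ⟨K₃, h3.trans h2, hK3, c₁, ∅, rfl, ?_⟩
  by_contra hT1
  obtain ⟨K₄, h4, hK4, hbd4⟩ := boundary_piece hK3 hmin₁ hT1
  obtain ⟨p, hp, q, hq, hdense⟩ := mid_point hK4 (prp n₀) (by
    intro x hx y hy hxy
    have hf := hflat x (h4 hx) y (h4 hy)
    have h0 : ⟪prp n₀, x - y⟫ = 0 := by rw [inner_sub_right]; linarith
    have hsq : ‖x - y‖ ^ 2 = ⟪n₀, x - y⟫ ^ 2 := by
      have hu := unit2 hn1
      have h00 : ⟪prp n₀, x - y⟫ ^ 2 = 0 := by rw [h0]; norm_num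
      rw [nm2]
      simp only [in2, prp0, prp1] at h00 ⊢
      linear_combination -((x - y) 0 ^ 2 + (x - y) 1 ^ 2) * hu + h00
    rw [← sq_abs ⟪n₀, x - y⟫] at hsq
    have hle : |⟪n₀, x - y⟫| ≤ 1 / 2 * ‖x - y‖ :=
      hf.trans (mul_le_mul_of_nonneg_right hrh (norm_nonneg _))
    have : ‖x - y‖ = 0 := by
      nlinarith [norm_nonneg (x - y), abs_nonneg ⟪n₀, x - y⟫]
    exact sub_eq_zero.1 (norm_eq_zero.1 this))
  obtain ⟨z, hz, hpz, hzq⟩ := closure_nonempty_iff.1 (hK4.2.2.mono hdense)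
  obtain ⟨n, hnn, hN⟩ := exists_normal (copy_convex hP c₁) (copy_interior hint hmin₁.1)
    (hbd4 z hz)
  refine hrP n₀ hn₀s K₃ c₁ z n hmin₁ (h4 hz) hN ?_ (fun w hw => hflat w hw z (h4 hz))
  exact off_normal hn1 hnn hrp hrh (hflat p (h4 hp) z (h4 hz)) (hflat q (h4 hq) z (h4 hz))
    hpz hzq (hN p (hmin₁.2.1 (h4 hp))) (hN q (hmin₁.2.1 (h4 hq)))

/-- **Theorem (ordinal analysis).** Let `P ⊆ ℝ^d` be compact and convex, and assume that
either `P` is strictly convex and nondegenerate, or `P` is a convex `d`-polytope, or `d = 2`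
and `P` has nonempty interior.  Let `A ⊆ ℝ^d` be closed.  Then:
(1) if `A^∞_P ≠ ∅` (equivalently, every iterate `A^α_P` is nonempty), player I has a winning
strategy in the no-β McMullen game `G_P(A)`;
(2) if `A^∞_P = ∅` (equivalently, some iterate `A^α_P` is empty), player II has a winning
strategy in `G_P(A)`. -/
theorem derivIter_game_winning (d : ℕ)
    (P : Set (EuclideanSpace ℝ (Fin d))) (hPcomp : IsCompact P) (hPconv : Convex ℝ P)
    (hP : (StrictConvex ℝ P ∧ P.Nontrivial) ∨ IsPolytope d P ∨
      (d = 2 ∧ (interior P).Nonempty))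
    (A : Set (EuclideanSpace ℝ (Fin d))) (hA : IsClosed A) :
    ((∀ α : Ordinal.{0}, (derivIterP P A α).Nonempty) → ∃ σ, WinningI P A σ) ∧
    ((∃ α : Ordinal.{0}, derivIterP P A α = ∅) → ∃ σ, WinningII P A σ) := by
  rcases hP with ⟨hs, hnt⟩ | h | ⟨rfl, hint⟩
  · obtain ⟨x, hx, y, hy, hne⟩ := hnt
    have hint : (interior P).Nonempty := ⟨_, hs hx hy hne (a := 1 / 2) (b := 1 / 2)
      (by norm_num) (by norm_num) (by norm_num)⟩
    exact main_of_core hPcomp hPconv hint (core_strict hPcomp hs hint) hA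
  · exact main_of_core hPcomp hPconv h.2.1 (core_polytope h) hA
  · exact main_of_core hPcomp hPconv hint (core_plane hPcomp hPconv hint) hA
end

section
/- Let P ⊆ ℝ^d be compact and convex with nonempty interior. Suppose that for each n the segment [x_n, y_n] is maximal with respect to P, and that x_n → x and y_n → y. Then [x, y] is maximal with respect to P (in particular x ≠ y); that is, the set of segments maximal with respect to P is closed. -/
open Pointwise Filter Topology Set

/-- The segment `[x, y]` is *maximal* with respect to `P`: it is contained in `P` and no
translated enlarged copy `z + s • [x, y]` with `s > 1` is contained in `P`. -/
def IsMaxSeg {d : ℕ} (P : Set (EuclideanSpace ℝ (Fin d))) (x y : EuclideanSpace ℝ (Fin d)) :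
    Prop :=
  segment ℝ x y ⊆ P ∧
    ¬∃ (z : EuclideanSpace ℝ (Fin d)) (s : ℝ), 1 < s ∧ z +ᵥ s • segment ℝ x y ⊆ P

theorem vadd_smul_segment_subset {d : ℕ} {P : Set (EuclideanSpace ℝ (Fin d))}
    (hP : Convex ℝ P) (x y z : EuclideanSpace ℝ (Fin d)) (s : ℝ) :
    z +ᵥ s • segment ℝ x y ⊆ P ↔ z + s • x ∈ P ∧ z + s • y ∈ P := by
  constructor
  · intro h
    exact ⟨h ⟨s • x, ⟨x, left_mem_segment ℝ x y, rfl⟩, rfl⟩,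
      h ⟨s • y, ⟨y, right_mem_segment ℝ x y, rfl⟩, rfl⟩⟩
  · rintro ⟨h1, h2⟩ _ ⟨_, ⟨w, ⟨a, b, ha, hb, hab, rfl⟩, rfl⟩, rfl⟩
    have h := hP h1 h2 ha hb hab
    have e : a • (z + s • x) + b • (z + s • y) = z + s • (a • x + b • y) := by
      have hb' : b = 1 - a := by linarith
      subst hb'
      module
    rw [e] at h
    exact h

/-- **Lemma.** Let `P ⊆ ℝ^d` be compact and convex with nonempty interior.  If for each `n`
the segment `[xₙ, yₙ]` is maximal with respect to `P`, `xₙ → x` and `yₙ → y`, then `[x, y]`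
is maximal with respect to `P` (in particular `x ≠ y`): the set of maximal segments is
closed. -/
theorem isMaxSeg_closed (d : ℕ) (P : Set (EuclideanSpace ℝ (Fin d)))
    (hPcomp : IsCompact P) (hPconv : Convex ℝ P) (hPint : (interior P).Nonempty)
    (x y : EuclideanSpace ℝ (Fin d)) (xs ys : ℕ → EuclideanSpace ℝ (Fin d))
    (hmax : ∀ n, IsMaxSeg P (xs n) (ys n))
    (hx : Tendsto xs atTop (𝓝 x)) (hy : Tendsto ys atTop (𝓝 y)) :
    IsMaxSeg P x y ∧ x ≠ y := by
  have hcl := hPcomp.isClosed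
  have hxP : x ∈ P := hcl.mem_of_tendsto hx
    (Eventually.of_forall fun n => (hmax n).1 (left_mem_segment ℝ _ _))
  have hyP : y ∈ P := hcl.mem_of_tendsto hy
    (Eventually.of_forall fun n => (hmax n).1 (right_mem_segment ℝ _ _))
  have key : IsMaxSeg P x y := by
    refine ⟨hPconv.segment_subset hxP hyP, ?_⟩
    rintro ⟨z, s, hs, h⟩
    rw [vadd_smul_segment_subset hPconv] at h
    obtain ⟨h1, h2⟩ := h
    obtain ⟨p, hp⟩ := hPint
    have hs0 : (0:ℝ) < s := by linarith
    obtain ⟨t, ht0, ht1, hts⟩ : ∃ t : ℝ, 0 < t ∧ t < 1 ∧ 1 < (1 - t) * s := by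
      refine ⟨(s - 1) / (2 * s), by apply div_pos <;> linarith, ?_, ?_⟩
      · rw [div_lt_one (by linarith)]; linarith
      · have : (1 - (s - 1) / (2 * s)) * s = (s + 1) / 2 := by field_simp; ring
        rw [this]; linarith
    have main : ∀ (u : EuclideanSpace ℝ (Fin d)) (us : ℕ → EuclideanSpace ℝ (Fin d)),
        z + s • u ∈ P → Tendsto us atTop (𝓝 u) →
        ∀ᶠ n in atTop, ((1 - t) • z + t • p) + ((1 - t) * s) • us n ∈ P := by
      intro u us hu hus
      have hi := hPconv.combo_self_interior_mem_interior hu hp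
        (by linarith : 0 ≤ 1 - t) ht0 (by ring)
      have e : (1 - t) • (z + s • u) + t • p =
          ((1 - t) • z + t • p) + ((1 - t) * s) • u := by module
      rw [e] at hi
      have ht := (hus.const_smul ((1 - t) * s)).const_add ((1 - t) • z + t • p)
      exact (ht.eventually (isOpen_interior.mem_nhds hi)).mono fun n hn => interior_subset hn
    obtain ⟨n, hn1, hn2⟩ := ((main x xs h1 hx).and (main y ys h2 hy)).exists
    exact (hmax n).2 ⟨_, _, hts, (vadd_smul_segment_subset hPconv _ _ _ _).2 ⟨hn1, hn2⟩⟩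
  refine ⟨key, ?_⟩
  rintro rfl
  refine key.2 ⟨-x, 2, by norm_num, (vadd_smul_segment_subset hPconv _ _ _ _).2 ?_⟩
  have e : -x + (2:ℝ) • x = x := by module
  rw [e]
  exact ⟨hxP, hxP⟩
end

section
/- Let P ⊆ ℝ^d be compact and convex with nonempty interior, and let x ∈ ∂P be such that at least one segment maximal with respect to P has x as an endpoint. Then the infimum δ_P(x) = inf{ |u_ℓ · n_H| : ℓ a segment maximal with respect to P with endpoint x, H a supporting hyperplane of P at x } is attained: there exist such a segment ℓ and such a hyperplane H with δ_P(x) = |u_ℓ · n_H|. -/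
open Pointwise Filter Topology Set RealInnerProductSpace

open RealInnerProductSpace in
/-- The hyperplane `{z | ⟪a, z⟫ = b}`, with unit normal `a`, is a supporting hyperplane of
`P` at `x`: it contains `x` and `P` lies in one of the two closed half-spaces bounded by it. -/
def IsSuppHyperplaneAt {d : ℕ} (P : Set (EuclideanSpace ℝ (Fin d)))
    (x a : EuclideanSpace ℝ (Fin d)) (b : ℝ) : Prop :=
  ‖a‖ = 1 ∧ ⟪a, x⟫ = b ∧ ∀ z ∈ P, ⟪a, z⟫ ≤ b

theorem isMaxSeg_iff_aux {d : ℕ} {P : Set (EuclideanSpace ℝ (Fin d))} (hPconv : Convex ℝ P)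
    {x : EuclideanSpace ℝ (Fin d)} (hx : x ∈ P) (y : EuclideanSpace ℝ (Fin d)) :
    IsMaxSeg P x y ↔ y ∈ P ∧ ¬ ∃ q ∈ P, ∃ s : ℝ, 1 < s ∧ q + s • (y - x) ∈ P := by
  unfold IsMaxSeg
  refine and_congr ⟨fun h => h (right_mem_segment ℝ x y), fun h => hPconv.segment_subset hx h⟩ ?_
  refine not_congr ⟨?_, ?_⟩
  · rintro ⟨z, s, hs, h⟩
    refine ⟨z + s • x, ?_, s, hs, ?_⟩
    · exact h ⟨s • x, ⟨x, left_mem_segment ℝ x y, rfl⟩, rfl⟩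
    · have : z + s • x + s • (y - x) = z + s • y := by module
      rw [this]
      exact h ⟨s • y, ⟨y, right_mem_segment ℝ x y, rfl⟩, rfl⟩
  · rintro ⟨q, hq, s, hs, h⟩
    refine ⟨q - s • x, s, hs, ?_⟩
    rintro _ ⟨_, ⟨w, ⟨a, b, ha, hb, hab, rfl⟩, rfl⟩, rfl⟩
    have : (q - s • x) +ᵥ s • (a • x + b • y) = a • q + b • (q + s • (y - x)) := by
      obtain rfl : a = 1 - b := by linarith
      rw [vadd_eq_add]
      module
    simp only [this]
    exact hPconv hq h ha hb hab

theorem isClosed_maxSeg_aux {d : ℕ} {P : Set (EuclideanSpace ℝ (Fin d))}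
    (hPconv : Convex ℝ P) (hPint : (interior P).Nonempty) (x : EuclideanSpace ℝ (Fin d)) :
    IsOpen {y | ∃ q ∈ P, ∃ s : ℝ, 1 < s ∧ q + s • (y - x) ∈ P} := by
  have : {y | ∃ q ∈ P, ∃ s : ℝ, 1 < s ∧ q + s • (y - x) ∈ P} =
      ⋃ q ∈ interior P, ⋃ s ∈ Ioi (1:ℝ), (fun y => q + s • (y - x)) ⁻¹' interior P := by
    ext y
    simp only [mem_setOf_eq, mem_iUnion, mem_preimage, exists_prop, mem_Ioi]
    constructor
    · rintro ⟨q, hq, s, hs, h⟩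
      obtain ⟨c, hc⟩ := hPint
      have hs0 : 0 < s := by linarith
      -- weight t on the points, 1 - t on c, with t * s = (1+s)/2
      set t : ℝ := (1 + s) / (2 * s) with ht
      have hts : t * s = (1 + s) / 2 := by rw [ht]; field_simp
      have ht0 : 0 ≤ t := by positivity
      have ht1 : t < 1 := by rw [ht, div_lt_one (by positivity)]; linarith
      refine ⟨(1 - t) • c + t • q, ?_, t * s, by linarith, ?_⟩
      · exact hPconv.combo_interior_self_mem_interior hc hq (by linarith) ht0 (by ring)
      · have e : (1 - t) • c + t • q + (t * s) • (y - x)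
            = (1 - t) • c + t • (q + s • (y - x)) := by module
        rw [e]
        exact hPconv.combo_interior_self_mem_interior hc h (by linarith) ht0 (by ring)
    · rintro ⟨q, hq, s, hs, h⟩
      exact ⟨q, interior_subset hq, s, hs, interior_subset h⟩
  rw [this]
  refine isOpen_biUnion fun q _ => isOpen_biUnion fun s _ => isOpen_interior.preimage ?_
  fun_prop

theorem exists_supp_aux {d : ℕ} {P : Set (EuclideanSpace ℝ (Fin d))}
    (hPconv : Convex ℝ P) (hPint : (interior P).Nonempty) {x : EuclideanSpace ℝ (Fin d)}
    (hx : x ∉ interior P) : ∃ a : EuclideanSpace ℝ (Fin d), ‖a‖ = 1 ∧ ∀ z ∈ P, ⟪a, z⟫ ≤ ⟪a, x⟫ := by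
  obtain ⟨f, hf⟩ := geometric_hahn_banach_open_point hPconv.interior isOpen_interior hx
  set w := (InnerProductSpace.toDual ℝ (EuclideanSpace ℝ (Fin d))).symm f with hw
  have hfw : ∀ z, f z = ⟪w, z⟫ := fun z => by
    rw [hw, InnerProductSpace.toDual_symm_apply]
  have hw0 : w ≠ 0 := by
    intro h
    obtain ⟨c, hc⟩ := hPint
    have := hf c hc
    simp [hfw, h] at this
  have hle : ∀ z ∈ P, f z ≤ f x := by
    intro z hz
    have hz' : z ∈ closure (interior P) := by
      rw [hPconv.closure_interior_eq_closure_of_nonempty_interior hPint]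
      exact subset_closure hz
    exact closure_minimal (fun z hz => (hf z hz).le)
      (isClosed_le f.continuous continuous_const) hz'
  refine ⟨‖w‖⁻¹ • w, norm_smul_inv_norm hw0, fun z hz => ?_⟩
  rw [real_inner_smul_left, real_inner_smul_left, ← hfw, ← hfw]
  exact mul_le_mul_of_nonneg_left (hle z hz) (by positivity)

/-- **Lemma.** Let `P ⊆ ℝ^d` be compact and convex with nonempty interior and let
`x ∈ ∂P` be the endpoint of at least one segment maximal with respect to `P`.  Then the
infimum `δ_P(x) = inf {|u_ℓ ⬝ n_H|}`, over segments `ℓ` maximal with respect to `P` with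
endpoint `x` and supporting hyperplanes `H` of `P` at `x`, is attained. -/
theorem deltaP_attained (d : ℕ) (P : Set (EuclideanSpace ℝ (Fin d)))
    (hPcomp : IsCompact P) (hPconv : Convex ℝ P) (hPint : (interior P).Nonempty)
    (x : EuclideanSpace ℝ (Fin d)) (hx : x ∈ frontier P) (hex : ∃ y, IsMaxSeg P x y) :
    ∃ (y a : EuclideanSpace ℝ (Fin d)) (b : ℝ), IsMaxSeg P x y ∧
      IsSuppHyperplaneAt P x a b ∧
      |⟪‖y - x‖⁻¹ • (y - x), a⟫| =
        sInf {r : ℝ | ∃ (y' a' : EuclideanSpace ℝ (Fin d)) (b' : ℝ),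
          IsMaxSeg P x y' ∧ IsSuppHyperplaneAt P x a' b' ∧
          r = |⟪‖y' - x‖⁻¹ • (y' - x), a'⟫|} := by
  have hxP : x ∈ P := hPcomp.isClosed.frontier_subset hx
  have hYc : IsCompact {y | IsMaxSeg P x y} := by
    have : {y | IsMaxSeg P x y} =
        P ∩ {y | ∃ q ∈ P, ∃ s : ℝ, 1 < s ∧ q + s • (y - x) ∈ P}ᶜ := by
      ext y
      exact isMaxSeg_iff_aux hPconv hxP y
    rw [this]
    exact hPcomp.inter_right (isClosed_maxSeg_aux hPconv hPint x).isClosed_compl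
  have hne : ∀ y, IsMaxSeg P x y → y - x ≠ 0 := by
    intro y hy h
    rw [isMaxSeg_iff_aux hPconv hxP] at hy
    exact hy.2 ⟨x, hxP, 2, by norm_num, by simpa [h] using hxP⟩
  have hAc : IsCompact {a : EuclideanSpace ℝ (Fin d) | ‖a‖ = 1 ∧ ∀ z ∈ P, ⟪a, z⟫ ≤ ⟪a, x⟫} := by
    have : {a : EuclideanSpace ℝ (Fin d) | ‖a‖ = 1 ∧ ∀ z ∈ P, ⟪a, z⟫ ≤ ⟪a, x⟫} =
        Metric.sphere 0 1 ∩ ⋂ z ∈ P, {a | ⟪a, z⟫ ≤ ⟪a, x⟫} := by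
      ext a
      simp
    rw [this]
    refine (isCompact_sphere _ _).inter_right (isClosed_biInter fun z _ => ?_)
    exact isClosed_le (by fun_prop) (by fun_prop)
  obtain ⟨y₀, hy₀⟩ := hex
  obtain ⟨a₀, ha₀⟩ := exists_supp_aux hPconv hPint hx.2
  obtain ⟨⟨y, a⟩, ⟨hy, ha⟩, hmin⟩ := (hYc.prod hAc).exists_isMinOn
    (f := fun p => |⟪‖p.1 - x‖⁻¹ • (p.1 - x), p.2⟫|) ⟨(y₀, a₀), hy₀, ha₀⟩ (by
      have hinv : ContinuousOn (fun p : EuclideanSpace ℝ (Fin d) × EuclideanSpace ℝ (Fin d) =>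
          ‖p.1 - x‖⁻¹) ({y | IsMaxSeg P x y} ×ˢ
            {a : EuclideanSpace ℝ (Fin d) | ‖a‖ = 1 ∧ ∀ z ∈ P, ⟪a, z⟫ ≤ ⟪a, x⟫}) :=
        ContinuousOn.inv₀ (by fun_prop) fun p hp => norm_ne_zero_iff.2 (hne p.1 hp.1)
      have h1 : ContinuousOn (fun p : EuclideanSpace ℝ (Fin d) × EuclideanSpace ℝ (Fin d) =>
          p.1 - x) ({y | IsMaxSeg P x y} ×ˢ
            {a : EuclideanSpace ℝ (Fin d) | ‖a‖ = 1 ∧ ∀ z ∈ P, ⟪a, z⟫ ≤ ⟪a, x⟫}) := by fun_prop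
      exact ((hinv.smul h1).inner continuousOn_snd).abs)
  refine ⟨y, a, ⟪a, x⟫, hy, ⟨ha.1, rfl, ha.2⟩, ?_⟩
  symm
  refine IsLeast.csInf_eq ⟨⟨y, a, ⟪a, x⟫, hy, ⟨ha.1, rfl, ha.2⟩, rfl⟩, ?_⟩
  rintro r ⟨y', a', b', hy', ⟨h1, rfl, h3⟩, rfl⟩
  exact isMinOn_iff.1 hmin (y', a') ⟨hy', h1, h3⟩
end
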